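/- There exist positive real numbers c1, c2, c3 such that for all T > c3 one has c1 * T^(1/2) * (log T)^3 < N(T) < c2 * T^(1/2) * (log T)^3. -/

import Mathlib

open Real

/-- The conditions defining the tuples counted by `N(T)`. -/
def StackyCounted (T : ℝ) (x1 x2 x3 y1 y2 y3 : ℤ) : Prop :=
  x1 ≠ 0 ∧ x2 ≠ 0 ∧ x3 ≠ 0 ∧ y1 ≠ 0 ∧ y2 ≠ 0 ∧ y3 ≠ 0 ∧
  Int.gcd x1 x2 = 1 ∧ Int.gcd x1 x3 = 1 ∧ Int.gcd x2 x3 = 1 ∧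
  Int.gcd y1 y2 = 1 ∧ Int.gcd y1 y3 = 1 ∧ Int.gcd y2 y3 = 1 ∧
  Squarefree x1 ∧ Squarefree x2 ∧ Squarefree x3 ∧
  x1 * y1 ^ 2 + x2 * y2 ^ 2 = x3 * y3 ^ 2 ∧
  0 < x1 ∧ |x2 * y2 ^ 2| ≤ x1 * y1 ^ 2 ∧
  ((|(x1 * y1) ^ 2 * x2 * x3| : ℤ) : ℝ) ≤ T

/-- `N(T)`: the number of tuples satisfying the height bound `T`. -/
noncomputable def stackyN (T : ℝ) : ℕ :=
  Set.ncard {v : ℤ × ℤ × ℤ × ℤ × ℤ × ℤ |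
    StackyCounted T v.1 v.2.1 v.2.2.1 v.2.2.2.1 v.2.2.2.2.1 v.2.2.2.2.2}

theorem card_le_of_separated {α : Type*} (S : Finset α) (f : α → ℝ) {δ a L : ℝ} (hδ : 0 < δ)
    (hL : 0 ≤ L) (hS : ∀ x ∈ S, a ≤ f x ∧ f x ≤ a + L)
    (hsep : ∀ x ∈ S, ∀ y ∈ S, x ≠ y → δ ≤ |f x - f y|) : (S.card : ℝ) ≤ L / δ + 1 := by
  have h1 : S.card ≤ (Finset.range (⌊L / δ⌋₊ + 1)).card := by
    apply Finset.card_le_card_of_injOn (fun x => ⌊(f x - a) / δ⌋₊)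
    · intro x hx
      have := hS x hx
      simp only [Finset.coe_range, Set.mem_Iio, Nat.lt_succ_iff]
      apply Nat.floor_le_floor
      gcongr
      linarith
    · intro x hx y hy hxy
      by_contra hne
      have hx' := hS x hx
      have hy' := hS y hy
      have hs := hsep x hx y hy hne
      simp only at hxy
      have e1 : 0 ≤ (f x - a) / δ := div_nonneg (by linarith) hδ.le
      have e2 : 0 ≤ (f y - a) / δ := div_nonneg (by linarith) hδ.le
      have k1 := Nat.floor_le e1
      have k2 := Nat.lt_floor_add_one ((f x - a) / δ)
      have k3 := Nat.floor_le e2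
      have k4 := Nat.lt_floor_add_one ((f y - a) / δ)
      rw [hxy] at k1 k2
      have : |(f x - a) / δ - (f y - a) / δ| < 1 := by rw [abs_lt]; constructor <;> linarith
      rw [← sub_div, abs_div, abs_of_pos hδ, div_lt_one hδ] at this
      have e3 : f x - a - (f y - a) = f x - f y := by ring
      rw [e3] at this
      linarith
  rw [Finset.card_range] at h1
  have h2 : (S.card : ℝ) ≤ (⌊L / δ⌋₊ : ℝ) + 1 := by exact_mod_cast h1
  have h3 := Nat.floor_le (div_nonneg hL hδ.le)
  linarith

theorem card_le_of_dvd_sub {α : Type*} (S : Finset α) (f : α → ℤ) {q : ℕ} {a L : ℝ} (hq : 0 < q)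
    (hL : 0 ≤ L) (hS : ∀ x ∈ S, a ≤ f x ∧ f x ≤ a + L) (hinj : Set.InjOn f S)
    (hc : ∀ x ∈ S, ∀ y ∈ S, (q : ℤ) ∣ f x - f y) : (S.card : ℝ) ≤ L / q + 1 := by
  apply card_le_of_separated S (fun x => (f x : ℝ)) (by exact_mod_cast hq) hL hS
  intro x hx y hy hne
  have h0 : f x - f y ≠ 0 := fun h => hne (hinj hx hy (by linarith))
  have h1 := Int.le_of_dvd (abs_pos.mpr h0) ((dvd_abs _ _).mpr (hc x hx y hy))
  exact_mod_cast h1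

/-- The matrix `χ (t + u)` has operator norm at most `√c`. -/
def HankelBound {R : Type*} [Fintype R] [Add R] (χ : R → ℝ) (c : ℝ) : Prop :=
  ∀ g : R → ℝ, ∑ t, (∑ u, g u * χ (t + u)) ^ 2 ≤ c * ∑ u, g u ^ 2

theorem HankelBound.prod {R S : Type*} [Fintype R] [Add R] [Fintype S] [Add S] {χ : R → ℝ}
    {ψ : S → ℝ} {c c' : ℝ} (hc : 0 ≤ c) (h : HankelBound χ c) (h' : HankelBound ψ c') :
    HankelBound (fun x : R × S => χ x.1 * ψ x.2) (c * c') := by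
  intro g
  calc ∑ t : R × S, (∑ u : R × S, g u * (χ (t + u).1 * ψ (t + u).2)) ^ 2
      = ∑ t₂ : S, ∑ t₁ : R, (∑ u₁ : R, (∑ u₂ : S, g (u₁, u₂) * ψ (t₂ + u₂)) * χ (t₁ + u₁)) ^ 2 := by
        rw [Fintype.sum_prod_type, Finset.sum_comm]
        refine Finset.sum_congr rfl fun t₂ _ => Finset.sum_congr rfl fun t₁ _ => ?_
        rw [Fintype.sum_prod_type]
        congr 1
        refine Finset.sum_congr rfl fun u₁ _ => ?_
        rw [Finset.sum_mul]
        refine Finset.sum_congr rfl fun u₂ _ => ?_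
        simp only [Prod.fst_add, Prod.snd_add]
        ring
    _ ≤ ∑ t₂ : S, c * ∑ u₁ : R, (∑ u₂ : S, g (u₁, u₂) * ψ (t₂ + u₂)) ^ 2 :=
        Finset.sum_le_sum fun t₂ _ => h _
    _ = c * ∑ u₁ : R, ∑ t₂ : S, (∑ u₂ : S, g (u₁, u₂) * ψ (t₂ + u₂)) ^ 2 := by
        rw [← Finset.mul_sum, Finset.sum_comm]
    _ ≤ c * ∑ u₁ : R, c' * ∑ u₂ : S, g (u₁, u₂) ^ 2 := by
        gcongr with u₁
        exact h' _
    _ = c * c' * ∑ u : R × S, g u ^ 2 := by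
        rw [Fintype.sum_prod_type, ← Finset.mul_sum, mul_assoc]

theorem HankelBound.comp_equiv {R S : Type*} [Fintype R] [Add R] [Fintype S] [Add S] {χ : S → ℝ}
    {c : ℝ} (h : HankelBound χ c) (e : R ≃+ S) : HankelBound (χ ∘ e) c := by
  intro g
  have := h (g ∘ e.symm)
  rw [← e.toEquiv.sum_comp, ← e.toEquiv.sum_comp (fun u => (g ∘ e.symm) u ^ 2)] at this
  convert this using 3 with t
  · rw [← e.toEquiv.sum_comp]
    simp
  · simp

theorem sum_quadraticChar_shift {p : ℕ} [Fact p.Prime] (hp : p ≠ 2) (k : ZMod p) :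
    ∑ t : ZMod p, quadraticChar (ZMod p) t * quadraticChar (ZMod p) (t + k) =
      if k = 0 then (p : ℤ) - 1 else -1 := by
  classical
  have hp1 : 1 ≤ p := (Fact.out : p.Prime).one_lt.le
  split_ifs with hk
  · subst hk
    have : ∀ t : ZMod p, quadraticChar (ZMod p) t * quadraticChar (ZMod p) (t + 0) =
        if t = 0 then 0 else 1 := by
      intro t
      split_ifs with ht
      · simp [ht]
      · rw [add_zero, ← sq, quadraticChar_sq_one ht]
    simp_rw [this]
    rw [Finset.sum_ite]
    simp [Finset.filter_ne', ZMod.card, Nat.cast_sub hp1]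
  · have h1 : ∀ t : ZMod p, quadraticChar (ZMod p) t * quadraticChar (ZMod p) (t + k) =
        if t = 0 then 0 else quadraticChar (ZMod p) (1 + k * t⁻¹) := by
      intro t
      split_ifs with ht
      · simp [ht]
      · have : t + k = t * (1 + k * t⁻¹) := by field_simp
        rw [this, map_mul, ← mul_assoc, ← sq, quadraticChar_sq_one ht, one_mul]
    have h2 : ∑ t : ZMod p, quadraticChar (ZMod p) (1 + k * t⁻¹) = 0 := by
      rw [← quadraticChar_sum_zero (F := ZMod p) (by rwa [ZMod.ringChar_zmod_n])]
      refine Fintype.sum_bijective (fun t => 1 + k * t⁻¹) ?_ _ _ fun t => rfl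
      apply Finite.injective_iff_bijective.mp
      intro a b hab
      simpa [hk] using hab
    simp_rw [h1]
    have h3 := Finset.sum_filter_add_sum_filter_not Finset.univ (fun t : ZMod p => t = 0)
      (fun t => quadraticChar (ZMod p) (1 + k * t⁻¹))
    have h4 : ∑ t : ZMod p with t = 0, quadraticChar (ZMod p) (1 + k * t⁻¹) = 1 := by
      rw [Finset.filter_eq' Finset.univ (0 : ZMod p)]
      simp
    rw [Finset.sum_ite, Finset.sum_const_zero]
    linarith

theorem hankelBound_quadraticChar {p : ℕ} [Fact p.Prime] (hp : p ≠ 2) :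
    HankelBound (fun x : ZMod p => (quadraticChar (ZMod p) x : ℝ)) p := by
  classical
  intro g
  have key : ∀ u v : ZMod p, ∑ t : ZMod p, (quadraticChar (ZMod p) (t + u) : ℝ) *
      quadraticChar (ZMod p) (t + v) = (if u = v then (p : ℝ) else 0) - 1 := by
    intro u v
    have h := sum_quadraticChar_shift hp (v - u)
    have h0 : ∑ t : ZMod p, quadraticChar (ZMod p) (t + u) * quadraticChar (ZMod p)
        (t + u + (v - u)) = ∑ t : ZMod p, quadraticChar (ZMod p) t *
        quadraticChar (ZMod p) (t + (v - u)) :=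
      Fintype.sum_equiv (Equiv.addRight u) _ _ fun _ => rfl
    rw [← h0] at h
    have h' : ∑ t : ZMod p, quadraticChar (ZMod p) (t + u) * quadraticChar (ZMod p) (t + v) =
        (if u = v then (p : ℤ) else 0) - 1 := by
      simp_rw [add_assoc, add_sub_cancel] at h
      rw [h]
      by_cases huv : u = v
      · simp [huv]
      · simp [huv, sub_eq_zero, Ne.symm huv]
    exact_mod_cast congrArg (Int.cast : ℤ → ℝ) h'
  calc ∑ t, (∑ u, g u * (quadraticChar (ZMod p) (t + u) : ℝ)) ^ 2
      = ∑ u, ∑ v, g u * g v * ∑ t : ZMod p, (quadraticChar (ZMod p) (t + u) : ℝ) *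
          quadraticChar (ZMod p) (t + v) := by
        simp_rw [sq, Finset.sum_mul_sum, Finset.mul_sum]
        rw [Finset.sum_comm]
        refine Finset.sum_congr rfl fun u _ => ?_
        rw [Finset.sum_comm]
        refine Finset.sum_congr rfl fun v _ => Finset.sum_congr rfl fun t _ => ?_
        ring
    _ = p * ∑ u, g u ^ 2 - (∑ u, g u) ^ 2 := by
        simp_rw [key, mul_sub, Finset.sum_sub_distrib]
        congr 1
        · simp [Finset.mul_sum]
          refine Finset.sum_congr rfl fun u _ => ?_
          ring
        · simp [sq, Finset.sum_mul_sum]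
    _ ≤ p * ∑ u, g u ^ 2 := by nlinarith [sq_nonneg (∑ u, g u)]

theorem hankelBound_jacobiSym (d : ℕ) (hd : Squarefree d) (hodd : Odd d) : ∀ [NeZero d],
    HankelBound (fun x : ZMod d => (jacobiSym (x.val : ℤ) d : ℝ)) d := by
  induction d using Nat.recOnPosPrimePosCoprime with
  | zero => exact absurd rfl hd.ne_zero
  | one =>
    intro _ g
    simp
  | prime_pow p n hp hn =>
    obtain rfl : n = 1 := by
      by_contra h
      have h2 : p * p ∣ p ^ n := by
        rw [← sq]
        exact pow_dvd_pow p (by omega)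
      exact hp.one_lt.ne' (Nat.isUnit_iff.mp (hd p h2))
    have := Fact.mk hp
    have hp2 : p ≠ 2 := by
      rintro rfl
      exact absurd hodd (by decide)
    rw [pow_one]
    intro _
    convert hankelBound_quadraticChar hp2 using 2 with x
    rw [← jacobiSym.legendreSym.to_jacobiSym, legendreSym]
    simp
  | coprime a b ha hb hab iha ihb =>
    intro _
    have : NeZero a := ⟨by omega⟩
    have : NeZero b := ⟨by omega⟩
    have h := ((iha (hd.squarefree_of_dvd (Dvd.intro _ rfl)) (hodd.of_dvd_nat (Dvd.intro _ rfl))).prod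
      (Nat.cast_nonneg a) (ihb (hd.squarefree_of_dvd (Dvd.intro_left _ rfl))
      (hodd.of_dvd_nat (Dvd.intro_left _ rfl)))).comp_equiv (ZMod.chineseRemainder hab).toAddEquiv
    rw [Nat.cast_mul]
    convert h using 2 with x
    have key : ∀ c : ℕ, ∀ _ : NeZero c, c ∣ a * b →
        jacobiSym ((x.cast : ZMod c).val : ℤ) c = jacobiSym (x.val : ℤ) c := by
      intro c _ hc
      rw [ZMod.cast_eq_val, ZMod.val_natCast, jacobiSym.mod_left (x.val : ℤ) c]
      norm_cast
    simp only [Function.comp]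
    have e1 : ((ZMod.chineseRemainder hab).toAddEquiv x).1 = (x.cast : ZMod a) := by
      change (ZMod.castHom (Nat.lcm_dvd_mul a b) (ZMod a × ZMod b) x).1 = _
      simp
    have e2 : ((ZMod.chineseRemainder hab).toAddEquiv x).2 = (x.cast : ZMod b) := by
      change (ZMod.castHom (Nat.lcm_dvd_mul a b) (ZMod a × ZMod b) x).2 = _
      simp
    rw [e1, e2, key a inferInstance (Dvd.intro _ rfl), key b inferInstance (Dvd.intro_left _ rfl),
      jacobiSym.mul_right]
    push_cast
    rfl

/-- A smoothed Pólya-Vinogradov inequality. -/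
theorem abs_sum_sum_jacobiSym_le (d : ℕ) (hd : Squarefree d) (hodd : Odd d) (K : ℕ) :
    |∑ i ∈ Finset.range K, ∑ j ∈ Finset.range K, (jacobiSym ((1 + i + j : ℕ) : ℤ) d : ℝ)| ≤
      K * (K / √d + √d) := by
  classical
  have : NeZero d := ⟨hd.ne_zero⟩
  have hd0 : (0 : ℝ) < d := by exact_mod_cast Nat.pos_of_ne_zero hd.ne_zero
  set χ : ZMod d → ℝ := fun x => (jacobiSym (x.val : ℤ) d : ℝ) with hχ
  set g : ZMod d → ℝ := fun u => ((Finset.range K).filter (fun j : ℕ => (j : ZMod d) = u)).card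
    with hg
  have hχc : ∀ n : ℕ, (jacobiSym (n : ℤ) d : ℝ) = χ n := by
    intro n
    simp only [hχ]
    rw [ZMod.val_natCast, jacobiSym.mod_left (n : ℤ) d]
    norm_cast
  have hfib : ∀ f : ZMod d → ℝ, ∑ j ∈ Finset.range K, f (j : ZMod d) = ∑ u, g u * f u := by
    intro f
    rw [← Finset.sum_fiberwise (Finset.range K) (fun j : ℕ => (j : ZMod d))]
    refine Finset.sum_congr rfl fun u _ => ?_
    rw [Finset.sum_congr rfl (g := fun _ => f u)]
    · simp [hg]
    · intro j hj
      rw [(Finset.mem_filter.mp hj).2]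
  have hgle : ∀ u, g u ≤ K / d + 1 := by
    intro u
    apply card_le_of_dvd_sub _ (fun j : ℕ => (j : ℤ)) (Nat.pos_of_ne_zero hd.ne_zero)
      (Nat.cast_nonneg K) (a := 0)
    · intro x hx
      have := Finset.mem_range.mp (Finset.mem_filter.mp hx).1
      constructor
      · exact_mod_cast Nat.zero_le x
      · rw [zero_add]
        exact_mod_cast this.le
    · intro x _ y _ h
      simpa using h
    · intro x hx y hy
      have hx := (Finset.mem_filter.mp hx).2
      have hy := (Finset.mem_filter.mp hy).2
      rw [← ZMod.intCast_zmod_eq_zero_iff_dvd]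
      push_cast
      rw [hx, hy, sub_self]
  have hgsum : ∑ u, g u = K := by
    have := hfib (fun _ => 1)
    simpa using this.symm
  have hg0 : ∀ u, 0 ≤ g u := fun u => Nat.cast_nonneg _
  have hg2 : ∑ u, g u ^ 2 ≤ K * (K / d + 1) := by
    calc ∑ u, g u ^ 2 ≤ ∑ u, g u * (K / d + 1) := by
          refine Finset.sum_le_sum fun u _ => ?_
          rw [sq]
          exact mul_le_mul_of_nonneg_left (hgle u) (hg0 u)
      _ = _ := by rw [← Finset.sum_mul, hgsum]
  have hV : ∑ i ∈ Finset.range K, ∑ j ∈ Finset.range K, (jacobiSym ((1 + i + j : ℕ) : ℤ) d : ℝ) =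
      ∑ t, g t * ∑ u, g u * χ ((1 + t) + u) := by
    rw [← hfib (fun t => ∑ u, g u * χ ((1 + t) + u))]
    refine Finset.sum_congr rfl fun i _ => ?_
    rw [← hfib (fun u => χ ((1 + (i : ZMod d)) + u))]
    refine Finset.sum_congr rfl fun j _ => ?_
    rw [hχc]
    push_cast
    rfl
  have hsq : (∑ t, g t * ∑ u, g u * χ ((1 + t) + u)) ^ 2 ≤ (K * (K / √d + √d)) ^ 2 := by
    calc (∑ t, g t * ∑ u, g u * χ ((1 + t) + u)) ^ 2
        ≤ (∑ t, g t ^ 2) * ∑ t, (∑ u, g u * χ ((1 + t) + u)) ^ 2 :=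
          Finset.sum_mul_sq_le_sq_mul_sq _ _ _
      _ = (∑ t, g t ^ 2) * ∑ t, (∑ u, g u * χ (t + u)) ^ 2 := by
          congr 1
          exact Equiv.sum_comp (Equiv.addLeft (1 : ZMod d)) (fun t => (∑ u, g u * χ (t + u)) ^ 2)
      _ ≤ (∑ t, g t ^ 2) * (d * ∑ u, g u ^ 2) := by
          exact mul_le_mul_of_nonneg_left (hankelBound_jacobiSym d hd hodd g)
            (Finset.sum_nonneg fun u _ => sq_nonneg (g u))
      _ ≤ (K * (K / d + 1)) * (d * (K * (K / d + 1))) :=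
          mul_le_mul hg2 (mul_le_mul_of_nonneg_left hg2 hd0.le)
            (mul_nonneg hd0.le (Finset.sum_nonneg fun u _ => sq_nonneg (g u))) (by positivity)
      _ = (K * (K / √d + √d)) ^ 2 := by
          have e : (d : ℝ) = √d ^ 2 := (Real.sq_sqrt hd0.le).symm
          have e' : √(d : ℝ) ≠ 0 := (Real.sqrt_pos.mpr hd0).ne'
          have : (K : ℝ) / √d + √d = √d * (K / d + 1) := by
            nth_rewrite 4 [e]
            field_simp
          rw [this, mul_pow, mul_pow, ← e]
          ring
  rw [hV]
  exact abs_le_of_sq_le_sq hsq (by positivity)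

/-- The Jacobi symbol `(D / d)`, extended by zero to even `d`. -/
def oddJacobi (D : ℤ) (d : ℕ) : ℤ := if Odd d then jacobiSym D d else 0

/-- The Jacobi symbol `(D / d)` restricted to odd squarefree `d`. -/
noncomputable def sqfreeJacobi (D : ℤ) (d : ℕ) : ℝ :=
  open Classical in if Squarefree d then (oddJacobi D d : ℝ) else 0

/-- The sum of `(D / d)` over the odd squarefree divisors `d` of `y`. -/
noncomputable def localCount (D : ℤ) (y : ℕ) : ℝ := ∑ d ∈ y.divisors, sqfreeJacobi D d

theorem oddJacobi_mul (D : ℤ) (a b : ℕ) : oddJacobi D (a * b) = oddJacobi D a * oddJacobi D b := by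
  unfold oddJacobi
  by_cases ha : Odd a <;> by_cases hb : Odd b <;> simp [Nat.odd_mul, ha, hb]
  have : NeZero a := ⟨ha.pos.ne'⟩
  have : NeZero b := ⟨hb.pos.ne'⟩
  exact jacobiSym.mul_right D a b

theorem oddJacobi_one (D : ℤ) : oddJacobi D 1 = 1 := by simp [oddJacobi]

theorem oddJacobi_zero (D : ℤ) : oddJacobi D 0 = 0 := by simp [oddJacobi]

theorem abs_oddJacobi_le (D : ℤ) (a : ℕ) : |oddJacobi D a| ≤ 1 := by
  unfold oddJacobi
  split_ifs
  · rcases jacobiSym.trichotomy D a with h | h | h <;> simp [h]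
  · simp

theorem oddJacobi_periodic (D : ℤ) : Function.Periodic (oddJacobi D) (4 * D.natAbs) := by
  intro d
  have h4 : Odd (d + 4 * D.natAbs) ↔ Odd d := by
    rw [Nat.odd_add]
    simp [show Even 4 by decide]
  unfold oddJacobi
  by_cases hd : Odd d
  · rw [if_pos hd, if_pos (h4.mpr hd), jacobiSym.mod_right D (h4.mpr hd), jacobiSym.mod_right D hd,
      Nat.add_mod_right]
  · rw [if_neg hd, if_neg (mt h4.mp hd)]

theorem abs_sqfreeJacobi_le (D : ℤ) (a : ℕ) : |sqfreeJacobi D a| ≤ 1 := by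
  unfold sqfreeJacobi
  split_ifs
  · exact_mod_cast abs_oddJacobi_le D a
  · simp

theorem localCount_eq_prod (D : ℤ) {y : ℕ} (hy : y ≠ 0) :
    localCount D y = ∏ p ∈ y.primeFactors, (1 + (oddJacobi D p : ℝ)) := by
  classical
  have hprod : ∀ s : Finset ℕ, (oddJacobi D (∏ p ∈ s, p) : ℝ) = ∏ p ∈ s, (oddJacobi D p : ℝ) := by
    intro s
    induction s using Finset.induction_on with
    | empty => simp [oddJacobi_one]
    | insert a s ha ih =>
      rw [Finset.prod_insert ha, Finset.prod_insert ha, oddJacobi_mul, ← ih]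
      push_cast
      rfl
  rw [Finset.prod_one_add, localCount]
  have h := Nat.sum_divisors_filter_squarefree hy (f := fun d => (oddJacobi D d : ℝ))
  unfold sqfreeJacobi
  rw [← Finset.sum_filter, h]
  have h2 : (UniqueFactorizationMonoid.normalizedFactors y).toFinset = y.primeFactors := by
    ext p
    rw [Multiset.mem_toFinset, Nat.factors_eq, Multiset.mem_coe, Nat.mem_primeFactors_iff_mem_primeFactorsList]
  rw [h2]
  refine Finset.sum_congr rfl fun s _ => ?_
  rw [← hprod]
  congr 2
  rw [Finset.prod_eq_multiset_prod, Multiset.map_id']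

theorem localCount_nonneg (D : ℤ) (y : ℕ) : 0 ≤ localCount D y := by
  rcases eq_or_ne y 0 with rfl | hy
  · simp [localCount]
  rw [localCount_eq_prod D hy]
  refine Finset.prod_nonneg fun p _ => ?_
  have := (abs_le.mp (abs_oddJacobi_le D p)).1
  have : (-1 : ℝ) ≤ oddJacobi D p := by exact_mod_cast this
  linarith

theorem two_pow_le_two_mul_localCount (D : ℤ) {y : ℕ} (hy : y ≠ 0)
    (h : ∀ p ∈ y.primeFactors, p ≠ 2 → jacobiSym D p = 1) :
    (2 : ℝ) ^ y.primeFactors.card ≤ 2 * localCount D y := by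
  classical
  rw [localCount_eq_prod D hy]
  have h1 : ∀ p ∈ y.primeFactors.erase 2, (1 + (oddJacobi D p : ℝ)) = 2 := by
    intro p hp
    have hp' := Finset.mem_erase.mp hp
    have : Odd p := (Nat.prime_of_mem_primeFactors hp'.2).odd_of_ne_two hp'.1
    simp [oddJacobi, this, h p hp'.2 hp'.1]
    norm_num
  have h3 : (oddJacobi D 2 : ℝ) = 0 := by simp [oddJacobi, show ¬ Odd 2 by decide]
  by_cases h2 : 2 ∈ y.primeFactors
  · rw [← Finset.mul_prod_erase _ _ h2, Finset.prod_congr rfl h1, Finset.prod_const,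
      ← Finset.card_erase_add_one h2, h3, pow_succ]
    linarith
  · rw [← Finset.erase_eq_of_notMem h2, Finset.prod_congr rfl h1, Finset.prod_const]
    have : (0 : ℝ) ≤ 2 ^ (y.primeFactors.erase 2).card := by positivity
    linarith

theorem localCount_le_card_divisors (D : ℤ) (y : ℕ) : localCount D y ≤ y.divisors.card := by
  unfold localCount
  refine (Finset.sum_le_card_nsmul _ _ 1 fun d _ => (abs_le.mp (abs_sqfreeJacobi_le D d)).2).trans ?_
  simp

theorem sum_sum_divisors (f : ℕ → ℝ) (U : ℕ) :
    ∑ y ∈ Finset.Ioc 0 U, ∑ d ∈ y.divisors, f d = ∑ d ∈ Finset.Ioc 0 U, f d * (U / d : ℕ) := by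
  classical
  have h : ∀ y ∈ Finset.Ioc 0 U, ∑ d ∈ y.divisors, f d =
      ∑ d ∈ Finset.Ioc 0 U, if d ∣ y then f d else 0 := by
    intro y hy
    have hy := Finset.mem_Ioc.mp hy
    rw [← Finset.sum_filter]
    refine Finset.sum_congr ?_ fun _ _ => rfl
    ext d
    simp only [Nat.mem_divisors, Finset.mem_filter, Finset.mem_Ioc]
    constructor
    · rintro ⟨h1, h2⟩
      exact ⟨⟨Nat.pos_of_dvd_of_pos h1 hy.1, (Nat.le_of_dvd hy.1 h1).trans hy.2⟩, h1⟩
    · rintro ⟨h1, h2⟩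
      exact ⟨h2, hy.1.ne'⟩
  rw [Finset.sum_congr rfl h, Finset.sum_comm]
  refine Finset.sum_congr rfl fun d _ => ?_
  rw [← Finset.sum_filter, Finset.sum_const, Nat.Ioc_filter_dvd_card_eq_div, nsmul_eq_mul, mul_comm]

theorem sum_localCount (D : ℤ) (U : ℕ) :
    ∑ y ∈ Finset.Ioc 0 U, localCount D y =
      ∑ d ∈ Finset.Ioc 0 U, sqfreeJacobi D d * (U / d : ℕ) :=
  sum_sum_divisors _ _

/-- An odd modulus at which a given nonsquare has Jacobi symbol `-1`. -/
theorem exists_jacobiSym_eq_neg_one {D : ℤ} (hD : D ≠ 0) (hns : ¬ IsSquare D) :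
    ∃ d : ℕ, Odd d ∧ jacobiSym D d = -1 := by
  have hn : D.natAbs ≠ 0 := Int.natAbs_ne_zero.mpr hD
  by_cases hp : ∃ p : ℕ, p.Prime ∧ p ≠ 2 ∧ Odd (D.natAbs.factorization p)
  · obtain ⟨p, pp, p2, hodd⟩ := hp
    have := Fact.mk pp
    have hpo : Odd p := pp.odd_of_ne_two p2
    obtain ⟨m, hm1, hm2⟩ : ∃ m : ℕ, ¬ p ∣ m ∧ D.natAbs = p ^ D.natAbs.factorization p * m :=
      ⟨_, Nat.not_dvd_ordCompl pp hn, (Nat.ordProj_mul_ordCompl_eq_self _ _).symm⟩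
    obtain ⟨e, he⟩ : ∃ e : ℤ, (e.natAbs = m) ∧ D = p ^ D.natAbs.factorization p * e := by
      rcases Int.natAbs_eq D with h | h
      · refine ⟨m, by simp, ?_⟩
        rw [h]
        simp only [Int.natAbs_natCast]
        exact_mod_cast hm2
      · refine ⟨-m, by simp, ?_⟩
        rw [h, mul_neg, neg_inj]
        simp only [Int.natAbs_neg, Int.natAbs_natCast]
        exact_mod_cast hm2
    obtain ⟨r, hr⟩ := FiniteField.exists_nonsquare (F := ZMod p) (by rwa [ZMod.ringChar_zmod_n])
    have hcop : Nat.Coprime (4 * m) p := by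
      refine Nat.Coprime.mul_left ?_ ?_
      · exact (Nat.coprime_pow_left_iff (n := 2) (by norm_num) 2 p).mpr
          ((Nat.coprime_primes Nat.prime_two pp).mpr (Ne.symm p2))
      · exact ((Nat.Prime.coprime_iff_not_dvd pp).mpr hm1).symm
    obtain ⟨d, hd1, hd2⟩ := Nat.chineseRemainder hcop 1 r.val
    have hm0 : m ≠ 0 := by
      rintro rfl
      exact hm1 (dvd_zero p)
    have hd4 : d % 4 = 1 := by
      have : d ≡ 1 [MOD 4] := hd1.of_mul_right m
      exact this
    have hdo : Odd d := Nat.odd_of_mod_four_eq_one hd4 |> Nat.odd_iff.mpr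
    refine ⟨d, hdo, ?_⟩
    have j1 : jacobiSym e d = 1 := by
      rw [jacobiSym.mod_right e hdo, he.1, hd1, Nat.mod_eq_of_lt (by omega)]
      simp
    have j2 : jacobiSym p d = -1 := by
      rw [jacobiSym.quadratic_reciprocity_one_mod_four' hpo hd4,
        ZMod.nonsquare_iff_jacobiSym_eq_neg_one]
      have : ((d : ℤ) : ZMod p) = r := by
        rw [Int.cast_natCast, (ZMod.natCast_eq_natCast_iff _ _ _).mpr hd2, ZMod.natCast_zmod_val]
      rwa [this]
    rw [he.2, jacobiSym.mul_left, jacobiSym.pow_left, j1, j2, hodd.neg_one_pow, mul_one]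
  · push Not at hp
    obtain ⟨a, b, hab, ha⟩ := Nat.sq_mul_squarefree D.natAbs
    have hb0 : b ≠ 0 := by
      rintro rfl
      simp at hab
      omega
    have hfac : ∀ p : ℕ, p.Prime → p ∣ a → p = 2 := by
      intro p pp hpa
      by_contra h2
      have h := hp p pp h2
      rw [← hab, Nat.factorization_mul (by positivity) ha.ne_zero, Nat.factorization_pow] at h
      have h1 : a.factorization p = 1 :=
        le_antisymm (Squarefree.natFactorization_le_one p ha)
          ((pp.dvd_iff_one_le_factorization ha.ne_zero).mp hpa)
      simp [h1, parity_simps] at h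
    have ha2 : a = 1 ∨ a = 2 := by
      have h : a ∣ 2 := by
        have h2 := Nat.eq_prime_pow_of_unique_prime_dvd ha.ne_zero (fun {q} hq hqa => hfac q hq hqa)
        have h3 : a.primeFactorsList.length ≤ 1 := by
          by_contra h
          have h4 : 2 * 2 ∣ a := by
            rw [h2]
            exact pow_dvd_pow 2 (show 2 ≤ _ by omega)
          exact absurd (Nat.isUnit_iff.mp (ha 2 h4)) (by norm_num)
        rw [h2]
        exact pow_dvd_pow 2 h3
      exact (Nat.dvd_prime Nat.prime_two).mp h
    have hsq : ∀ d : ℕ, Nat.Coprime b d → jacobiSym ((b : ℤ) ^ 2) d = 1 := fun d h =>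
      jacobiSym.sq_one' (by simpa using h)
    have hD' : D = (b : ℤ) ^ 2 * a ∨ D = (b : ℤ) ^ 2 * (-a) := by
      have hab' : (b : ℤ) ^ 2 * a = D.natAbs := by exact_mod_cast hab
      rcases Int.natAbs_eq D with h | h
      · left
        rw [hab', ← h]
      · right
        rw [mul_neg, hab', ← h]
    rcases ha2 with rfl | rfl
    · rcases hD' with h | h
      · exact absurd ⟨(b : ℤ), by rw [h]; push_cast; ring⟩ hns
      · have h3 : (4 * b - 1) % 4 = 3 := by omega
        have ho : Odd (4 * b - 1) := Nat.odd_iff.mpr (by omega)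
        have hc : Nat.Coprime b (4 * b - 1) := by
          have h1 : Nat.gcd b (4 * b - 1) ∣ 1 := by
            have := Nat.dvd_sub ((Nat.gcd_dvd_left b (4 * b - 1)).mul_left 4)
              (Nat.gcd_dvd_right b (4 * b - 1))
            rwa [show 4 * b - (4 * b - 1) = 1 by omega] at this
          exact Nat.dvd_one.mp h1
        refine ⟨4 * b - 1, ho, ?_⟩
        rw [h, jacobiSym.mul_left, hsq _ hc, one_mul, Nat.cast_one, jacobiSym.at_neg_one ho,
          ZMod.χ₄_nat_three_mod_four h3]
    · obtain ⟨k, m, hm, hbm⟩ := Nat.exists_eq_two_pow_mul_odd hb0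
      have hc8 : Nat.Coprime 8 m :=
        (Nat.coprime_pow_left_iff (n := 3) (by norm_num) 2 m).mpr (Nat.coprime_two_left.mpr hm)
      obtain ⟨d, hd1, hd2⟩ := Nat.chineseRemainder hc8 5 1
      have hd8 : d % 8 = 5 := hd1
      have ho : Odd d := Nat.odd_iff.mpr (by omega)
      have hc : Nat.Coprime b d := by
        rw [hbm]
        refine Nat.Coprime.mul_left (Nat.Coprime.pow_left _ (Nat.coprime_two_left.mpr ho)) ?_
        rw [Nat.coprime_comm, Nat.Coprime, hd2.gcd_eq, Nat.gcd_one_left]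
      have j2 : jacobiSym 2 d = -1 := by
        rw [jacobiSym.at_two ho, ZMod.χ₈_nat_mod_eight, hd8]
        decide
      have j1 : jacobiSym (-1) d = 1 := by
        rw [jacobiSym.at_neg_one ho, ZMod.χ₄_nat_one_mod_four (by omega)]
      refine ⟨d, ho, ?_⟩
      rcases hD' with h | h
      · rw [h, jacobiSym.mul_left, hsq _ hc, one_mul]
        exact j2
      · rw [h, jacobiSym.mul_left, hsq _ hc, one_mul, jacobiSym.neg _ ho]
        rw [jacobiSym.at_neg_one ho] at j1
        rw [j1, one_mul]
        exact j2

theorem sum_range_oddJacobi {D : ℤ} (hD : D ≠ 0) (hns : ¬ IsSquare D) :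
    ∑ d ∈ Finset.range (4 * D.natAbs), oddJacobi D d = 0 := by
  classical
  obtain ⟨d0, ho, hj⟩ := exists_jacobiSym_eq_neg_one hD hns
  set q := 4 * D.natAbs with hq
  have hq0 : 0 < q := by
    have := Int.natAbs_pos.mpr hD
    omega
  have hcop : Nat.Coprime q d0 := by
    refine Nat.Coprime.mul_left ?_ ?_
    · exact (Nat.coprime_pow_left_iff (n := 2) (by norm_num) 2 d0).mpr (Nat.coprime_two_left.mpr ho)
    · by_contra h
      have : jacobiSym D d0 = 0 := jacobiSym.eq_zero_iff.mpr ⟨ho.pos.ne', by simpa [Int.gcd] using h⟩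
      omega
  have hinj : Set.InjOn (fun d => d0 * d % q) (Finset.range q : Set ℕ) := by
    intro a ha b hb hab
    have ha := Finset.mem_range.mp ha
    have hb := Finset.mem_range.mp hb
    have h : d0 * a ≡ d0 * b [MOD q] := hab
    have h := Nat.ModEq.cancel_left_of_coprime hcop h
    rw [Nat.ModEq, Nat.mod_eq_of_lt ha, Nat.mod_eq_of_lt hb] at h
    exact h
  have himg : (Finset.range q).image (fun d => d0 * d % q) = Finset.range q := by
    apply Finset.eq_of_subset_of_card_le
    · intro x hx
      obtain ⟨a, -, rfl⟩ := Finset.mem_image.mp hx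
      exact Finset.mem_range.mpr (Nat.mod_lt _ hq0)
    · rw [Finset.card_image_of_injOn hinj]
  have h : ∑ d ∈ Finset.range q, oddJacobi D d = ∑ d ∈ Finset.range q, -oddJacobi D d := by
    conv_lhs => rw [← himg]
    rw [Finset.sum_image hinj]
    refine Finset.sum_congr rfl fun d _ => ?_
    rw [(oddJacobi_periodic D).map_mod_nat, oddJacobi_mul]
    simp only [oddJacobi, ho, hj, if_true]
    split_ifs <;> simp
  rw [Finset.sum_neg_distrib] at h
  omega

theorem abs_sum_range_le_of_periodic {f : ℕ → ℤ} {q : ℕ} (hq : 0 < q)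
    (hf : Function.Periodic f q)
    (h1 : ∀ d, |f d| ≤ 1) (h0 : ∑ d ∈ Finset.range q, f d = 0) (t : ℕ) :
    |∑ d ∈ Finset.range t, f d| ≤ q := by
  induction t using Nat.strong_induction_on with
  | _ t ih =>
    rcases le_total t q with h | h
    · refine (Finset.abs_sum_le_sum_abs _ _).trans ((Finset.sum_le_card_nsmul _ _ 1 fun d _ => h1 d).trans ?_)
      simpa using h
    · obtain ⟨s, rfl⟩ := Nat.exists_eq_add_of_le h
      rw [Finset.sum_range_add, h0, zero_add]
      have := ih s (by omega)
      simp_rw [add_comm q, hf _]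
      exact this

theorem abs_sum_oddJacobi_le {D : ℤ} (hD : D ≠ 0) (hns : ¬ IsSquare D) (t : ℕ) :
    |∑ d ∈ Finset.Ioc 0 t, (oddJacobi D d : ℝ)| ≤ min ((4 * D.natAbs : ℕ) : ℝ) t := by
  have e : ∑ d ∈ Finset.Ioc 0 t, oddJacobi D d = ∑ d ∈ Finset.range (t + 1), oddJacobi D d := by
    induction t with
    | zero => simp [oddJacobi_zero]
    | succ t ih => rw [Finset.sum_Ioc_succ_top (Nat.zero_le t), Finset.sum_range_succ, ih]
  apply le_min
  · have := Int.natAbs_pos.mpr hD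
    rw [← Int.cast_sum, e, ← Int.cast_abs, ← Int.cast_natCast]
    exact Int.cast_le.mpr (abs_sum_range_le_of_periodic (by omega) (oddJacobi_periodic D)
      (abs_oddJacobi_le D) (sum_range_oddJacobi hD hns) (t + 1))
  · refine (Finset.abs_sum_le_sum_abs _ _).trans ((Finset.sum_le_card_nsmul _ _ 1 fun d _ => ?_).trans ?_)
    · exact_mod_cast abs_oddJacobi_le D d
    · simp

theorem sum_moebius_sq_dvd {d U : ℕ} (hd : d ≠ 0) (hU : d ≤ U) :
    ∑ k ∈ Finset.Ioc 0 U, (if k ^ 2 ∣ d then (ArithmeticFunction.moebius k : ℝ) else 0) =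
      open Classical in if Squarefree d then 1 else 0 := by
  classical
  obtain ⟨a, b, hab, ha⟩ := Nat.sq_mul_squarefree d
  have hb0 : b ≠ 0 := by
    rintro rfl
    simp at hab
    omega
  have hk : ∀ k, k ^ 2 ∣ d ↔ k ∣ b := by
    intro k
    constructor
    · intro h
      rw [← hab] at h
      obtain ⟨g, k', b', hg, hcop, rfl, rfl⟩ := Nat.exists_coprime' (m := k) (n := b)
        (Nat.gcd_pos_of_pos_right _ (Nat.pos_of_ne_zero hb0))
      have hg0 : 0 < g ^ 2 := by positivity
      rw [mul_pow, mul_pow, mul_right_comm] at h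
      have h := Nat.dvd_of_mul_dvd_mul_right hg0 h
      have h := (Nat.Coprime.pow 2 2 hcop).dvd_of_dvd_mul_left h
      rw [sq] at h
      have := Nat.isUnit_iff.mp (ha k' h)
      rw [this, one_mul]
      exact Dvd.intro_left _ rfl
    · intro h
      rw [← hab]
      exact (pow_dvd_pow_of_dvd h 2).mul_right a
  have hbd : b ≤ U := by
    refine le_trans ?_ hU
    rw [← hab]
    have := Nat.pos_of_ne_zero ha.ne_zero
    nlinarith [Nat.pos_of_ne_zero hb0]
  have h1 : ∑ k ∈ Finset.Ioc 0 U, (if k ^ 2 ∣ d then (ArithmeticFunction.moebius k : ℝ) else 0) =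
      ∑ k ∈ b.divisors, (ArithmeticFunction.moebius k : ℝ) := by
    rw [← Finset.sum_filter]
    refine Finset.sum_congr ?_ fun _ _ => rfl
    ext k
    simp only [Finset.mem_filter, Finset.mem_Ioc, Nat.mem_divisors, hk]
    constructor
    · rintro ⟨-, h⟩
      exact ⟨h, hb0⟩
    · rintro ⟨h, -⟩
      exact ⟨⟨Nat.pos_of_dvd_of_pos h (Nat.pos_of_ne_zero hb0),
        (Nat.le_of_dvd (Nat.pos_of_ne_zero hb0) h).trans hbd⟩, h⟩
  have h2 : ∑ k ∈ b.divisors, (ArithmeticFunction.moebius k : ℝ) = if b = 1 then 1 else 0 := by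
    have h := congrArg (fun f => f b) ArithmeticFunction.coe_zeta_mul_moebius
    simp only [ArithmeticFunction.coe_zeta_mul_apply, ArithmeticFunction.one_apply] at h
    exact_mod_cast congrArg (Int.cast : ℤ → ℝ) h
  rw [h1, h2]
  congr 1
  rw [eq_iff_iff]
  constructor
  · rintro rfl
    simpa [← hab] using ha
  · intro h
    exact Nat.isUnit_iff.mp (h b (by rw [← hab, sq]; exact Dvd.intro _ rfl))

theorem sum_sqfreeJacobi (D : ℤ) (t : ℕ) :
    ∑ d ∈ Finset.Ioc 0 t, sqfreeJacobi D d = ∑ k ∈ Finset.Ioc 0 t,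
      (ArithmeticFunction.moebius k : ℝ) * oddJacobi D (k ^ 2) *
        ∑ e ∈ Finset.Ioc 0 (t / k ^ 2), (oddJacobi D e : ℝ) := by
  classical
  have h1 : ∀ d ∈ Finset.Ioc 0 t, sqfreeJacobi D d = ∑ k ∈ Finset.Ioc 0 t,
      if k ^ 2 ∣ d then (ArithmeticFunction.moebius k : ℝ) * oddJacobi D d else 0 := by
    intro d hd
    have hd := Finset.mem_Ioc.mp hd
    have h := sum_moebius_sq_dvd hd.1.ne' hd.2
    unfold sqfreeJacobi
    rw [show (if Squarefree d then (oddJacobi D d : ℝ) else 0) =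
      (if Squarefree d then 1 else 0) * oddJacobi D d by split_ifs <;> simp, ← h, Finset.sum_mul]
    refine Finset.sum_congr rfl fun k _ => ?_
    rw [ite_mul, zero_mul]
  rw [Finset.sum_congr rfl h1, Finset.sum_comm]
  refine Finset.sum_congr rfl fun k hk => ?_
  have hk2 : 0 < k ^ 2 := by
    have := (Finset.mem_Ioc.mp hk).1
    positivity
  rw [← Finset.sum_filter, mul_assoc, Finset.mul_sum, Finset.mul_sum]
  refine Finset.sum_bij' (fun d _ => d / k ^ 2) (fun e _ => k ^ 2 * e) ?_ ?_ ?_ ?_ ?_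
  · intro d hd
    simp only [Finset.mem_filter, Finset.mem_Ioc] at hd ⊢
    exact ⟨Nat.div_pos (Nat.le_of_dvd hd.1.1 hd.2) hk2, Nat.div_le_div_right hd.1.2⟩
  · intro e he
    simp only [Finset.mem_filter, Finset.mem_Ioc] at he ⊢
    refine ⟨⟨Nat.mul_pos hk2 he.1, ?_⟩, Dvd.intro _ rfl⟩
    exact (Nat.mul_le_mul_left _ he.2).trans (Nat.mul_div_le _ _)
  · intro d hd
    exact Nat.mul_div_cancel' (Finset.mem_filter.mp hd).2
  · intro e _
    exact Nat.mul_div_cancel_left e hk2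
  · intro d hd
    conv_lhs => rw [← Nat.mul_div_cancel' (Finset.mem_filter.mp hd).2, oddJacobi_mul]
    push_cast
    ring

theorem sum_min_div_sq_le {q x : ℝ} (hq : 0 < q) (hx : 0 ≤ x) (n : ℕ) :
    ∑ k ∈ Finset.Ioc 0 n, min q (x / (k : ℝ) ^ 2) ≤ 3 * √(q * x) := by
  have hterm : ∀ k : ℕ, min q (x / (k : ℝ) ^ 2) ≤ x / (k : ℝ) ^ 2 := fun k => min_le_right _ _
  have hzeta : ∀ K : ℕ, 0 < K → ∀ n, ∑ k ∈ Finset.Ioc K n, min q (x / (k : ℝ) ^ 2) ≤ x / K := by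
    intro K hK n
    rcases le_total K n with h | h
    · calc _ ≤ ∑ k ∈ Finset.Ioc K n, x * ((k : ℝ) ^ 2)⁻¹ :=
            Finset.sum_le_sum fun k _ => hterm k
        _ ≤ x * ((K : ℝ)⁻¹ - (n : ℝ)⁻¹) := by
            rw [← Finset.mul_sum]
            exact mul_le_mul_of_nonneg_left (sum_Ioc_inv_sq_le_sub hK.ne' h) hx
        _ ≤ x / K := by
            rw [div_eq_mul_inv]
            apply mul_le_mul_of_nonneg_left _ hx
            have : (0 : ℝ) ≤ (n : ℝ)⁻¹ := by positivity
            linarith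
    · rw [Finset.Ioc_eq_empty (by omega), Finset.sum_empty]
      positivity
  have hs : √(q * x) = √q * √x := Real.sqrt_mul hq.le x
  have hsq := Real.mul_self_sqrt hq.le
  have hsx := Real.mul_self_sqrt hx
  have hq' := Real.sqrt_pos.mpr hq
  have hx' := Real.sqrt_nonneg x
  rw [hs]
  rcases lt_or_ge x q with h | h
  · have hxq : √x ≤ √q := Real.sqrt_le_sqrt h.le
    rcases Nat.eq_zero_or_pos n with rfl | hn
    · simp
      positivity
    · rw [← Finset.sum_Ioc_consecutive _ (Nat.zero_le 1) hn]
      have h1 := hzeta 1 one_pos n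
      have h2 := hterm 1
      simp only [Nat.cast_one, one_pow, div_one] at h1 h2
      rw [show Finset.Ioc 0 1 = {1} from rfl, Finset.sum_singleton]
      simp only [Nat.cast_one, one_pow, div_one]
      nlinarith
  · have hxq : √q ≤ √x := Real.sqrt_le_sqrt h
    set K := ⌊√x / √q⌋₊ with hK
    have h1 : 1 ≤ √x / √q := (one_le_div hq').mpr hxq
    have hK1 : 1 ≤ K := Nat.le_floor (by simpa using h1)
    have hKle : (K : ℝ) ≤ √x / √q := Nat.floor_le (by positivity)
    have hKlt : √x / √q < K + 1 := Nat.lt_floor_add_one _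
    have hK1' : (1 : ℝ) ≤ K := by exact_mod_cast hK1
    have hKge : √x ≤ 2 * K * √q := by
      rw [div_lt_iff₀ hq'] at hKlt
      nlinarith
    have hsmall : ∀ m : ℕ, m ≤ K → ∑ k ∈ Finset.Ioc 0 m, min q (x / (k : ℝ) ^ 2) ≤ √q * √x := by
      intro m hm
      calc _ ≤ ∑ k ∈ Finset.Ioc 0 m, q := Finset.sum_le_sum fun k _ => min_le_left _ _
        _ = m * q := by simp
        _ ≤ K * q := by gcongr
        _ ≤ √x / √q * q := by gcongr
        _ = √q * √x := by
          field_simp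
          linear_combination -√x * hsq
    rcases le_total n K with hn | hn
    · have := hsmall n hn
      nlinarith [mul_nonneg hq'.le hx']
    · rw [← Finset.sum_Ioc_consecutive _ (Nat.zero_le K) hn]
      have h2 := hsmall K le_rfl
      have h3 := hzeta K hK1 n
      have h4 : x / K ≤ 2 * (√q * √x) := by
        rw [div_le_iff₀ (by linarith)]
        nlinarith
      linarith

theorem abs_sum_sqfreeJacobi_le {D : ℤ} (hD : D ≠ 0) (hns : ¬ IsSquare D) (t : ℕ) :
    |∑ d ∈ Finset.Ioc 0 t, sqfreeJacobi D d| ≤ 3 * √((4 * D.natAbs : ℕ) * t) := by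
  rw [sum_sqfreeJacobi]
  have hq : (0 : ℝ) < (4 * D.natAbs : ℕ) := by
    have := Int.natAbs_pos.mpr hD
    exact_mod_cast (by omega : 0 < 4 * D.natAbs)
  refine (Finset.abs_sum_le_sum_abs _ _).trans (le_trans (Finset.sum_le_sum fun k hk => ?_)
    (sum_min_div_sq_le hq (Nat.cast_nonneg t) t))
  have h1 : |(ArithmeticFunction.moebius k : ℝ)| ≤ 1 := by
    exact_mod_cast ArithmeticFunction.abs_moebius_le_one (n := k)
  have h2 : |(oddJacobi D (k ^ 2) : ℝ)| ≤ 1 := by exact_mod_cast abs_oddJacobi_le D (k ^ 2)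
  rw [abs_mul, abs_mul]
  have h3 := abs_sum_oddJacobi_le hD hns (t / k ^ 2)
  have h4 : ((t / k ^ 2 : ℕ) : ℝ) ≤ t / (k : ℝ) ^ 2 := by
    exact_mod_cast Nat.cast_div_le (α := ℝ) (m := t) (n := k ^ 2)
  calc _ ≤ 1 * 1 * |∑ e ∈ Finset.Ioc 0 (t / k ^ 2), (oddJacobi D e : ℝ)| := by gcongr
    _ ≤ _ := by
      rw [one_mul, one_mul]
      exact h3.trans (min_le_min le_rfl h4)

theorem sum_one_div_sqrt_le (n : ℕ) : ∑ m ∈ Finset.Ioc 0 n, 1 / √(m : ℝ) ≤ 2 * √n := by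
  induction n with
  | zero => simp
  | succ n ih =>
    rw [Finset.sum_Ioc_succ_top (Nat.zero_le n)]
    have h1 : (0 : ℝ) < √((n + 1 : ℕ) : ℝ) := Real.sqrt_pos.mpr (by positivity)
    have h2 : (√((n + 1 : ℕ) : ℝ)) ^ 2 = n + 1 := by
      rw [Real.sq_sqrt (by positivity)]
      push_cast
      rfl
    have h3 : (√(n : ℝ)) ^ 2 = n := Real.sq_sqrt (by positivity)
    have h4 : 1 / √((n + 1 : ℕ) : ℝ) ≤ 2 * √((n + 1 : ℕ) : ℝ) - 2 * √(n : ℝ) := by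
      rw [div_le_iff₀ h1]
      nlinarith [sq_nonneg (√((n + 1 : ℕ) : ℝ) - √(n : ℝ))]
    linarith

theorem abs_tail_le {b : ℕ → ℝ} {q : ℝ} (hq : 0 < q)
    (hb : ∀ t : ℕ, |∑ d ∈ Finset.Ioc 0 t, b d| ≤ 3 * √(q * t)) {Z U : ℕ} (hZ : 0 < Z) :
    |∑ d ∈ Finset.Ioc Z U, b d * (U / d : ℕ)| ≤ 12 * U * √(q / Z) := by
  classical
  have h1 : ∑ d ∈ Finset.Ioc Z U, b d * (U / d : ℕ) =
      ∑ m ∈ Finset.Ioc 0 (U / Z), ∑ d ∈ Finset.Ioc Z (U / m), b d := by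
    have h2 : ∀ d ∈ Finset.Ioc Z U, b d * (U / d : ℕ) =
        ∑ m ∈ Finset.Ioc 0 (U / Z), if d ≤ U / m then b d else 0 := by
      intro d hd
      have hd := Finset.mem_Ioc.mp hd
      rw [← Finset.sum_filter, Finset.sum_const, nsmul_eq_mul, mul_comm]
      congr 2
      have hset : (Finset.Ioc 0 (U / Z)).filter (fun m => d ≤ U / m) = Finset.Ioc 0 (U / d) := by
        ext m
        simp only [Finset.mem_filter, Finset.mem_Ioc]
        constructor
        · rintro ⟨⟨h1, -⟩, h2⟩
          refine ⟨h1, ?_⟩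
          rw [Nat.le_div_iff_mul_le (by omega), mul_comm]
          exact (Nat.le_div_iff_mul_le h1).mp h2
        · rintro ⟨h1, h2⟩
          refine ⟨⟨h1, h2.trans (Nat.div_le_div_left hd.1.le hZ)⟩, ?_⟩
          rw [Nat.le_div_iff_mul_le h1, mul_comm]
          exact (Nat.le_div_iff_mul_le (by omega)).mp h2
      rw [hset, Nat.card_Ioc, Nat.sub_zero]
    rw [Finset.sum_congr rfl h2, Finset.sum_comm]
    refine Finset.sum_congr rfl fun m hm => ?_
    rw [← Finset.sum_filter]
    refine Finset.sum_congr ?_ fun _ _ => rfl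
    ext d
    simp only [Finset.mem_filter, Finset.mem_Ioc]
    constructor
    · rintro ⟨⟨h1, h2⟩, h3⟩
      exact ⟨h1, h3⟩
    · rintro ⟨h1, h3⟩
      exact ⟨⟨h1, h3.trans (Nat.div_le_self _ _)⟩, h3⟩
  rw [h1]
  have hZ' : (0 : ℝ) < Z := by exact_mod_cast hZ
  have h3 : ∀ m ∈ Finset.Ioc 0 (U / Z), |∑ d ∈ Finset.Ioc Z (U / m), b d| ≤
      6 * √(q * U) * (1 / √m) := by
    intro m hm
    have hm := Finset.mem_Ioc.mp hm
    have hm0 : (0 : ℝ) < m := by exact_mod_cast hm.1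
    have hZm : Z ≤ U / m := by
      rw [Nat.le_div_iff_mul_le hm.1, mul_comm]
      exact (Nat.le_div_iff_mul_le hZ).mp hm.2
    have e : ∑ d ∈ Finset.Ioc Z (U / m), b d =
        ∑ d ∈ Finset.Ioc 0 (U / m), b d - ∑ d ∈ Finset.Ioc 0 Z, b d := by
      rw [eq_sub_iff_add_eq, add_comm]
      exact Finset.sum_Ioc_consecutive b (Nat.zero_le Z) hZm
    rw [e]
    have hle : √(q * Z) ≤ √(q * (U / m : ℕ)) := by
      apply Real.sqrt_le_sqrt
      gcongr
    have hle2 : √(q * (U / m : ℕ)) ≤ √(q * U) * (1 / √m) := by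
      rw [mul_one_div, ← Real.sqrt_div (by positivity), mul_div_assoc]
      apply Real.sqrt_le_sqrt
      gcongr
      exact Nat.cast_div_le
    calc _ ≤ _ := abs_sub _ _
      _ ≤ 3 * √(q * (U / m : ℕ)) + 3 * √(q * Z) := add_le_add (hb _) (hb _)
      _ ≤ _ := by linarith
  calc _ ≤ _ := Finset.abs_sum_le_sum_abs _ _
    _ ≤ ∑ m ∈ Finset.Ioc 0 (U / Z), 6 * √(q * U) * (1 / √m) := Finset.sum_le_sum h3
    _ ≤ 6 * √(q * U) * (2 * √((U / Z : ℕ) : ℝ)) := by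
      rw [← Finset.mul_sum]
      gcongr
      exact sum_one_div_sqrt_le _
    _ ≤ 6 * √(q * U) * (2 * √(U / Z)) := by
      gcongr
      exact Nat.cast_div_le
    _ = 12 * U * √(q / Z) := by
      rw [Real.sqrt_mul hq.le, Real.sqrt_div (by positivity), Real.sqrt_div hq.le]
      have := Real.mul_self_sqrt (Nat.cast_nonneg (α := ℝ) U)
      linear_combination 12 * √q / √Z * this

/-- For nonsquare `D`, only small divisors matter in the mean value of `localCount D`. -/
theorem sum_localCount_le {D : ℤ} (hD : D ≠ 0) (hns : ¬ IsSquare D) {Z : ℕ} (hZ : 0 < Z)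
    (hDZ : D.natAbs ≤ 8 * Z) (U : ℕ) :
    ∑ y ∈ Finset.Ioc 0 U, localCount D y ≤
      72 * U + ∑ d ∈ Finset.Ioc 0 Z, sqfreeJacobi D d * (U / d : ℕ) := by
  have hq : (0 : ℝ) < (4 * D.natAbs : ℕ) := by
    have := Int.natAbs_pos.mpr hD
    exact_mod_cast (by omega : 0 < 4 * D.natAbs)
  have h := abs_tail_le hq (fun t => abs_sum_sqfreeJacobi_le hD hns t) (Z := Z) (U := U) hZ
  have hZ' : (0 : ℝ) < Z := by exact_mod_cast hZ
  have hs : √(((4 * D.natAbs : ℕ) : ℝ) / Z) ≤ 6 := by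
    rw [Real.sqrt_le_left (by norm_num), div_le_iff₀ hZ']
    have : ((4 * D.natAbs : ℕ) : ℝ) ≤ ((32 * Z : ℕ) : ℝ) := by exact_mod_cast (by omega)
    push_cast at this ⊢
    linarith
  have h2 : |∑ d ∈ Finset.Ioc Z U, sqfreeJacobi D d * (U / d : ℕ)| ≤ 72 * U := by
    refine h.trans ?_
    have : (0 : ℝ) ≤ U := Nat.cast_nonneg U
    nlinarith
  rw [sum_localCount]
  have hz : ∀ a b : ℕ, U ≤ a → ∑ d ∈ Finset.Ioc a b, sqfreeJacobi D d * (U / d : ℕ) = 0 := by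
    intro a b hab
    refine Finset.sum_eq_zero fun d hd => ?_
    have := (Finset.mem_Ioc.mp hd).1
    rw [Nat.div_eq_of_lt (by omega), Nat.cast_zero, mul_zero]
  have h3 := (abs_le.mp h2).2
  rcases le_total Z U with hZU | hZU
  · rw [← Finset.sum_Ioc_consecutive _ (Nat.zero_le Z) hZU]
    linarith
  · rw [← Finset.sum_Ioc_consecutive _ (Nat.zero_le U) hZU, hz U Z le_rfl]
    have : (0 : ℝ) ≤ U := Nat.cast_nonneg U
    linarith

theorem sum_one_div_mul_sqrt_le (n : ℕ) :
    ∑ m ∈ Finset.Ioc 0 n, 1 / ((m : ℝ) * √(m : ℝ)) ≤ 3 := by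
  have key : ∀ n : ℕ, ∑ m ∈ Finset.Ioc 0 (n + 1), 1 / ((m : ℝ) * √(m : ℝ)) ≤
      3 - 2 / √((n + 1 : ℕ) : ℝ) := by
    intro n
    induction n with
    | zero =>
      rw [show Finset.Ioc 0 (0 + 1) = {1} from rfl, Finset.sum_singleton]
      norm_num
    | succ n ih =>
      rw [Finset.sum_Ioc_succ_top (Nat.zero_le _)]
      have ha : (0 : ℝ) < √((n + 1 : ℕ) : ℝ) := Real.sqrt_pos.mpr (by positivity)
      have hb : (0 : ℝ) < √((n + 1 + 1 : ℕ) : ℝ) := Real.sqrt_pos.mpr (by positivity)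
      have ha2 := Real.mul_self_sqrt (Nat.cast_nonneg (α := ℝ) (n + 1))
      have hb2 := Real.mul_self_sqrt (Nat.cast_nonneg (α := ℝ) (n + 1 + 1))
      have hab : √((n + 1 : ℕ) : ℝ) ≤ √((n + 1 + 1 : ℕ) : ℝ) :=
        Real.sqrt_le_sqrt (by exact_mod_cast Nat.le_succ _)
      have hc : ((n + 1 + 1 : ℕ) : ℝ) = ((n + 1 : ℕ) : ℝ) + 1 := by push_cast; ring
      rw [← hb2] at hc
      rw [← ha2] at hc
      rw [← hb2]
      generalize √((n + 1 + 1 : ℕ) : ℝ) = b at *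
      generalize √((n + 1 : ℕ) : ℝ) = a at *
      have hb1 : 0 ≤ b := hb.le
      rw [Real.sqrt_mul_self hb1]
      have h : 1 / (b * b * b) ≤ 2 / a - 2 / b := by
        rw [div_sub_div _ _ ha.ne' hb.ne', div_le_div_iff₀ (by positivity) (by positivity)]
        have h1 : (b - a) * (b + a) = 1 := by linarith
        have h2 : 1 ≤ 2 * b * (b - a) := by nlinarith
        have h3 : a * b * 1 ≤ b * b * (2 * b * (b - a)) := by
          apply mul_le_mul _ h2 (by norm_num) (by positivity)
          exact mul_le_mul_of_nonneg_right hab hb1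
        nlinarith
      linarith
  rcases n with - | n
  · simp
  · refine (key n).trans ?_
    have : 0 ≤ 2 / √((n + 1 : ℕ) : ℝ) := by positivity
    linarith

theorem smooth_sum_le {t : ℕ → ℝ} {X : ℕ} (ht : ∀ n, 1 ≤ n → n < 4 * X → 0 ≤ t n) :
    X * ∑ n ∈ Finset.Ico X (2 * X), t n ≤
      ∑ i ∈ Finset.range (2 * X), ∑ j ∈ Finset.range (2 * X), t (1 + i + j) := by
  have h1 : ∀ i ∈ Finset.range X, ∑ n ∈ Finset.Ico X (2 * X), t n ≤
      ∑ j ∈ Finset.range (2 * X), t (1 + i + j) := by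
    intro i hi
    have hi := Finset.mem_range.mp hi
    have hinj : Set.InjOn (fun n => n - (1 + i)) (Finset.Ico X (2 * X) : Set ℕ) := by
      intro a ha b hb hab
      have ha := Finset.mem_Ico.mp ha
      have hb := Finset.mem_Ico.mp hb
      simp only at hab
      omega
    calc ∑ n ∈ Finset.Ico X (2 * X), t n
        = ∑ j ∈ (Finset.Ico X (2 * X)).image (fun n => n - (1 + i)), t (1 + i + j) := by
          rw [Finset.sum_image hinj]
          refine Finset.sum_congr rfl fun n hn => ?_
          have hn := Finset.mem_Ico.mp hn
          congr 1
          omega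
      _ ≤ _ := by
          refine Finset.sum_le_sum_of_subset_of_nonneg ?_ ?_
          · intro j hj
            obtain ⟨n, hn, rfl⟩ := Finset.mem_image.mp hj
            have hn := Finset.mem_Ico.mp hn
            exact Finset.mem_range.mpr (by omega)
          · intro j hj _
            have hj := Finset.mem_range.mp hj
            exact ht _ (by omega) (by omega)
  calc (X : ℝ) * ∑ n ∈ Finset.Ico X (2 * X), t n
      = ∑ i ∈ Finset.range X, ∑ n ∈ Finset.Ico X (2 * X), t n := by simp
    _ ≤ ∑ i ∈ Finset.range X, ∑ j ∈ Finset.range (2 * X), t (1 + i + j) := Finset.sum_le_sum h1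
    _ ≤ _ := by
        refine Finset.sum_le_sum_of_subset_of_nonneg ?_ ?_
        · exact Finset.range_subset_range.mpr (by omega)
        · intro i hi _
          have hi := Finset.mem_range.mp hi
          refine Finset.sum_nonneg fun j hj => ?_
          have hj := Finset.mem_range.mp hj
          exact ht _ (by omega) (by omega)

theorem sqfreeJacobi_nonneg_of_isSquare {D : ℤ} (hD : IsSquare D) (d : ℕ) :
    0 ≤ sqfreeJacobi D d := by
  obtain ⟨m, rfl⟩ := hD
  unfold sqfreeJacobi oddJacobi
  split_ifs
  · rw [jacobiSym.mul_left]
    exact_mod_cast mul_self_nonneg _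
  · simp
  · exact le_rfl

/-- `sum_localCount_le` majorant, for which square `D` need not be excluded. -/
theorem majorant_nonneg {D : ℤ} (hD : D ≠ 0) {Z : ℕ} (hZ : 0 < Z)
    (hDZ : D.natAbs ≤ 8 * Z) (U : ℕ) :
    0 ≤ 72 * (U : ℝ) + ∑ d ∈ Finset.Ioc 0 Z, sqfreeJacobi D d * (U / d : ℕ) := by
  by_cases hns : IsSquare D
  · have : 0 ≤ ∑ d ∈ Finset.Ioc 0 Z, sqfreeJacobi D d * (U / d : ℕ) :=
      Finset.sum_nonneg fun d _ =>
        mul_nonneg (sqfreeJacobi_nonneg_of_isSquare hns d) (Nat.cast_nonneg _)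
    positivity
  · exact (Finset.sum_nonneg fun y _ => localCount_nonneg D y).trans
      (sum_localCount_le hD hns hZ hDZ U)

theorem abs_sum_sum_sqfreeJacobi_le (D : ℤ) (d K : ℕ) :
    |∑ i ∈ Finset.range K, ∑ j ∈ Finset.range K, sqfreeJacobi (D * (1 + i + j : ℕ)) d| ≤
      K * (K / √d + √d) := by
  classical
  by_cases h : Squarefree d ∧ Odd d
  · have e : ∀ i j : ℕ, sqfreeJacobi (D * (1 + i + j : ℕ)) d =
        (jacobiSym D d : ℝ) * (jacobiSym ((1 + i + j : ℕ) : ℤ) d : ℝ) := by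
      intro i j
      simp only [sqfreeJacobi, oddJacobi, h.1, h.2, if_true, jacobiSym.mul_left]
      push_cast
      rfl
    simp_rw [e, ← Finset.mul_sum, abs_mul]
    have h1 : |(jacobiSym D d : ℝ)| ≤ 1 := by
      rcases jacobiSym.trichotomy D d with h | h | h <;> simp [h]
    calc _ ≤ 1 * _ := mul_le_mul h1 (abs_sum_sum_jacobiSym_le d h.1 h.2 K) (abs_nonneg _) zero_le_one
      _ = _ := one_mul _
  · have e : ∀ i j : ℕ, sqfreeJacobi (D * (1 + i + j : ℕ)) d = 0 := by
      intro i j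
      simp only [sqfreeJacobi, oddJacobi]
      split_ifs with h1 h2
      · exact absurd ⟨h1, h2⟩ h
      · simp
      · rfl
    simp_rw [e]
    simp
    positivity

theorem sum_majorant_le {D : ℤ} (hD : D ≠ 0) {X1 X2 U : ℕ} (hX1 : 0 < X1) (h12 : X1 ≤ X2)
    (hDX : D.natAbs < 2 * X1) :
    ∑ n ∈ Finset.Ico X2 (2 * X2), (72 * (U : ℝ) + ∑ d ∈ Finset.Ioc 0 (X1 * X2),
      sqfreeJacobi (D * (n : ℕ)) d * (U / d : ℕ)) ≤ 308 * X2 * U := by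
  have hX2 : 0 < X2 := by omega
  have hX2' : (0 : ℝ) < X2 := by exact_mod_cast hX2
  have hU : (0 : ℝ) ≤ U := Nat.cast_nonneg U
  have h1 := smooth_sum_le (X := X2) (t := fun n => 72 * (U : ℝ) + ∑ d ∈ Finset.Ioc 0 (X1 * X2),
      sqfreeJacobi (D * (n : ℕ)) d * (U / d : ℕ)) (by
    intro n hn1 hn2
    refine majorant_nonneg (mul_ne_zero hD (by exact_mod_cast (by omega))) (by positivity) ?_ U
    rw [Int.natAbs_mul, Int.natAbs_natCast]
    nlinarith)
  set K := 2 * X2 with hK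
  have hK' : (K : ℝ) = 2 * X2 := by rw [hK]; push_cast; rfl
  have hZ : √((X1 * X2 : ℕ) : ℝ) ≤ X2 := by
    rw [Real.sqrt_le_left (by positivity), sq]
    exact_mod_cast Nat.mul_le_mul_right X2 h12
  have h2 : ∑ i ∈ Finset.range K, ∑ j ∈ Finset.range K, (72 * (U : ℝ) +
      ∑ d ∈ Finset.Ioc 0 (X1 * X2), sqfreeJacobi (D * (1 + i + j : ℕ)) d * (U / d : ℕ)) =
      72 * U * K * K + ∑ d ∈ Finset.Ioc 0 (X1 * X2), (U / d : ℕ) *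
        ∑ i ∈ Finset.range K, ∑ j ∈ Finset.range K, sqfreeJacobi (D * (1 + i + j : ℕ)) d := by
    simp_rw [Finset.sum_add_distrib]
    congr 1
    · simp
      ring
    · simp_rw [Finset.mul_sum]
      rw [Finset.sum_congr rfl fun i _ => Finset.sum_comm, Finset.sum_comm]
      simp_rw [mul_comm]
  have h3 : ∑ d ∈ Finset.Ioc 0 (X1 * X2), ((U / d : ℕ) : ℝ) *
        ∑ i ∈ Finset.range K, ∑ j ∈ Finset.range K, sqfreeJacobi (D * (1 + i + j : ℕ)) d ≤
      ∑ d ∈ Finset.Ioc 0 (X1 * X2), (U * K * K * (1 / (d * √d)) + U * K * (1 / √d)) := by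
    refine Finset.sum_le_sum fun d hd => ?_
    have hd0 : (0 : ℝ) < d := by exact_mod_cast (Finset.mem_Ioc.mp hd).1
    have hd1 : (0 : ℝ) < √d := Real.sqrt_pos.mpr hd0
    calc _ ≤ (U / d : ℝ) * (K * (K / √d + √d)) :=
          mul_le_mul_of_nonneg Nat.cast_div_le
            ((le_abs_self _).trans (abs_sum_sum_sqfreeJacobi_le D d K)) (Nat.cast_nonneg _) (by positivity)
      _ = U * K * K * (1 / (d * √d)) + U * K * (√d / d) := by
          field_simp
      _ = _ := by rw [Real.sqrt_div_self']
  rw [Finset.sum_add_distrib, ← Finset.mul_sum, ← Finset.mul_sum] at h3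
  have h4 := sum_one_div_mul_sqrt_le (X1 * X2)
  have h5 := (sum_one_div_sqrt_le (X1 * X2)).trans (mul_le_mul_of_nonneg_left hZ zero_le_two)
  have hUK : 0 ≤ U * (K : ℝ) := by positivity
  have hUKK : 0 ≤ U * (K : ℝ) * K := by positivity
  have h6 := mul_le_mul_of_nonneg_left h4 hUKK
  have h7 := mul_le_mul_of_nonneg_left h5 hUK
  have h8 : X2 * ∑ n ∈ Finset.Ico X2 K, (72 * (U : ℝ) + ∑ d ∈ Finset.Ioc 0 (X1 * X2),
      sqfreeJacobi (D * (n : ℕ)) d * (U / d : ℕ)) ≤ X2 * (308 * X2 * U) := by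
    refine h1.trans ?_
    rw [h2]
    rw [hK'] at *
    nlinarith
  exact le_of_mul_le_mul_left h8 hX2'

theorem sum_sum_localCount_le_aux {s : ℤ} (hs : s.natAbs = 1) {X1 X2 : ℕ} (hX1 : 0 < X1)
    (h12 : X1 ≤ X2) (U : ℕ) :
    ∑ n1 ∈ Finset.Ico X1 (2 * X1), ∑ n2 ∈ Finset.Ico X2 (2 * X2),
      (open Classical in if IsSquare (s * n1 * n2) then 0 else
        ∑ y ∈ Finset.Ioc 0 U, localCount (s * n1 * n2) y) ≤ 308 * X1 * X2 * U := by
  classical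
  have h : ∀ n1 ∈ Finset.Ico X1 (2 * X1), ∑ n2 ∈ Finset.Ico X2 (2 * X2),
      (if IsSquare (s * n1 * n2) then 0 else ∑ y ∈ Finset.Ioc 0 U, localCount (s * n1 * n2) y) ≤
      308 * X2 * U := by
    intro n1 hn1
    have hn1 := Finset.mem_Ico.mp hn1
    have hD : s * n1 ≠ 0 := by
      have : s ≠ 0 := by
        rintro rfl
        simp at hs
      exact mul_ne_zero this (by exact_mod_cast (by omega))
    have hDn : (s * n1).natAbs = n1 := by rw [Int.natAbs_mul, hs]; simp
    refine le_trans (Finset.sum_le_sum fun n2 hn2 => ?_)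
      (sum_majorant_le (U := U) hD hX1 h12 (by omega))
    have hn2 := Finset.mem_Ico.mp hn2
    have hD2 : s * n1 * n2 ≠ 0 := mul_ne_zero hD (by exact_mod_cast (by omega))
    have hle : (s * n1 * n2).natAbs ≤ 8 * (X1 * X2) := by
      rw [Int.natAbs_mul, hDn, Int.natAbs_natCast]
      nlinarith
    have hZ : 0 < X1 * X2 := Nat.mul_pos hX1 (by omega)
    split_ifs with hsq
    · exact majorant_nonneg hD2 hZ hle U
    · exact sum_localCount_le hD2 hsq hZ hle U
  calc _ ≤ ∑ n1 ∈ Finset.Ico X1 (2 * X1), 308 * (X2 : ℝ) * U := Finset.sum_le_sum h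
    _ = _ := by
      rw [Finset.sum_const, Nat.card_Ico, nsmul_eq_mul, two_mul, Nat.add_sub_cancel]
      ring

theorem sum_sum_localCount_le {s : ℤ} (hs : s.natAbs = 1) {X1 X2 : ℕ} (hX1 : 0 < X1)
    (hX2 : 0 < X2) (U : ℕ) :
    ∑ n1 ∈ Finset.Ico X1 (2 * X1), ∑ n2 ∈ Finset.Ico X2 (2 * X2),
      (open Classical in if IsSquare (s * n1 * n2) then 0 else
        ∑ y ∈ Finset.Ioc 0 U, localCount (s * n1 * n2) y) ≤ 308 * X1 * X2 * U := by
  rcases le_total X1 X2 with h | h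
  · exact sum_sum_localCount_le_aux hs hX1 h U
  · rw [Finset.sum_comm]
    convert sum_sum_localCount_le_aux hs hX2 h U using 1
    · simp_rw [mul_right_comm]
    · ring

theorem prime_pow_dvd_two_mul_or {p e : ℕ} (pp : p.Prime) {r t m : ℤ} (hm : ¬ (p : ℤ) ∣ m)
    (hsum : r + t = 2 * m) (h : (p : ℤ) ^ e ∣ r * t) :
    (p : ℤ) ^ e ∣ 2 * r ∨ (p : ℤ) ^ e ∣ 2 * t := by
  have hp' : Prime (p : ℤ) := Nat.prime_iff_prime_int.mp pp
  have key : ∀ {x z : ℤ}, ¬ (p : ℤ) ∣ x → (p : ℤ) ^ e ∣ x * z → (p : ℤ) ^ e ∣ z := by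
    intro x z hx hxz
    exact (IsCoprime.pow_left ((Prime.coprime_iff_not_dvd hp').mpr hx)).dvd_of_dvd_mul_left hxz
  by_cases hr : (p : ℤ) ∣ r
  · by_cases ht : (p : ℤ) ∣ t
    · have h2 : (p : ℤ) ∣ 2 := by
        have : (p : ℤ) ∣ 2 * m := hsum ▸ dvd_add hr ht
        exact (hp'.dvd_or_dvd this).resolve_right hm
      have hp2 : p = 2 := (Nat.prime_dvd_prime_iff_eq pp Nat.prime_two).mp (by exact_mod_cast h2)
      subst hp2
      obtain ⟨a, rfl⟩ := hr
      obtain ⟨b, rfl⟩ := ht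
      push_cast at *
      by_cases ha : (2 : ℤ) ∣ a
      · have hb : ¬ (2 : ℤ) ∣ b := by omega
        left
        apply key hb
        convert h using 1
        ring
      · right
        apply key ha
        convert h using 1
        ring
    · left
      exact (key ht (by rwa [mul_comm])).mul_left 2
  · right
    exact (key hr h).mul_left 2

theorem eq_of_coprime_of_mul_eq {u v u' v' : ℕ} (hv : 0 < v) (h : u.Coprime v)
    (h' : u'.Coprime v') (he : u * v' = u' * v) : u = u' ∧ v = v' := by
  have h1 : v ∣ v' := h.symm.dvd_of_dvd_mul_left (he ▸ Dvd.intro_left _ rfl)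
  have h2 : v' ∣ v := h'.symm.dvd_of_dvd_mul_left (he ▸ Dvd.intro_left _ rfl)
  obtain rfl := Nat.dvd_antisymm h1 h2
  exact ⟨Nat.eq_of_mul_eq_mul_right hv he, rfl⟩

/-- Primitive solutions of a binary quadratic congruence modulo `y ^ 2`, with slopes in a short
interval. -/
theorem card_solutions_le {A B : ℤ} {y : ℕ} (hy : 0 < y) (hA : IsCoprime A y) (hB : IsCoprime B y)
    (S : Finset (ℕ × ℕ)) {V c ℓ : ℝ} (hV : 0 < V) (hℓ : 0 ≤ ℓ)
    (hpos : ∀ w ∈ S, 0 < w.2) (hcop : ∀ w ∈ S, w.1.Coprime w.2)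
    (hVle : ∀ w ∈ S, (w.2 : ℝ) ≤ 2 * V)
    (hdvd : ∀ w ∈ S, (y : ℤ) ^ 2 ∣ A * (w.1 : ℤ) ^ 2 - B * (w.2 : ℤ) ^ 2)
    (hslope : ∀ w ∈ S, c ≤ (w.1 : ℝ) / w.2 ∧ (w.1 : ℝ) / w.2 ≤ c + ℓ) :
    (S.card : ℝ) ≤ 2 * localCount (A * B) y * (1 + 8 * V ^ 2 * ℓ / y ^ 2) := by
  classical
  have hy' : (0 : ℝ) < y := by exact_mod_cast hy
  have hfac : 0 ≤ 1 + 8 * V ^ 2 * ℓ / y ^ 2 := by positivity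
  rcases S.eq_empty_or_nonempty with rfl | ⟨w0, hw0⟩
  · have := localCount_nonneg (A * B) y
    simp
    positivity
  have hndA : ∀ {p : ℕ}, p.Prime → p ∣ y → ¬ (p : ℤ) ∣ A := by
    intro p pp hpy hpA
    have h := hA.isUnit_of_dvd' hpA (Int.natCast_dvd_natCast.mpr hpy)
    exact (Nat.prime_iff_prime_int.mp pp).not_isUnit h
  have hndB : ∀ {p : ℕ}, p.Prime → p ∣ y → ¬ (p : ℤ) ∣ B := by
    intro p pp hpy hpB
    have h := hB.isUnit_of_dvd' hpB (Int.natCast_dvd_natCast.mpr hpy)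
    exact (Nat.prime_iff_prime_int.mp pp).not_isUnit h
  have hnd : ∀ {p : ℕ}, p.Prime → p ∣ y → ∀ w ∈ S, ¬ (p : ℤ) ∣ (w.1 : ℤ) ∧ ¬ (p : ℤ) ∣ (w.2 : ℤ) := by
    intro p pp hpy w hw
    have hp' : Prime (p : ℤ) := Nat.prime_iff_prime_int.mp pp
    have h1 : (p : ℤ) ∣ A * (w.1 : ℤ) ^ 2 - B * (w.2 : ℤ) ^ 2 :=
      dvd_trans (dvd_pow (Int.natCast_dvd_natCast.mpr hpy) two_ne_zero) (hdvd w hw)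
    have hiff : (p : ℤ) ∣ (w.1 : ℤ) ↔ (p : ℤ) ∣ (w.2 : ℤ) := by
      constructor
      · intro h
        have h2 : (p : ℤ) ∣ B * (w.2 : ℤ) ^ 2 := by
          rw [← dvd_sub_right ((dvd_pow h two_ne_zero).mul_left A)]
          exact h1
        exact hp'.dvd_of_dvd_pow ((hp'.dvd_or_dvd h2).resolve_left (hndB pp hpy))
      · intro h
        have h2 : (p : ℤ) ∣ A * (w.1 : ℤ) ^ 2 := by
          rw [← dvd_sub_left ((dvd_pow h two_ne_zero).mul_left B)]
          exact h1
        exact hp'.dvd_of_dvd_pow ((hp'.dvd_or_dvd h2).resolve_left (hndA pp hpy))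
    have hnot : ¬ ((p : ℤ) ∣ (w.1 : ℤ) ∧ (p : ℤ) ∣ (w.2 : ℤ)) := by
      rintro ⟨h1, h2⟩
      have := Nat.dvd_gcd (Int.natCast_dvd_natCast.mp h1) (Int.natCast_dvd_natCast.mp h2)
      rw [hcop w hw] at this
      exact pp.one_lt.ne' (Nat.dvd_one.mp this)
    tauto
  have hjac : ∀ p ∈ y.primeFactors, p ≠ 2 → jacobiSym (A * B) p = 1 := by
    intro p hp _
    have pp := Nat.prime_of_mem_primeFactors hp
    have hpy := Nat.dvd_of_mem_primeFactors hp
    have := Fact.mk pp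
    have hp' : Prime (p : ℤ) := Nat.prime_iff_prime_int.mp pp
    have hg : ∀ {x : ℤ}, ¬ (p : ℤ) ∣ x → x.gcd p = 1 := by
      intro x hx
      rw [← Int.isCoprime_iff_gcd_eq_one]
      exact ((Prime.coprime_iff_not_dvd hp').mpr hx).symm
    obtain ⟨hn1, hn2⟩ := hnd pp hpy w0 hw0
    have h1 : jacobiSym (A * B * (w0.1 : ℤ) ^ 2) p = jacobiSym ((B * w0.2) ^ 2) p := by
      apply jacobiSym.mod_left'
      apply Int.ModEq.symm
      rw [Int.modEq_iff_dvd]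
      have := dvd_trans (dvd_pow (Int.natCast_dvd_natCast.mpr hpy) two_ne_zero) (hdvd w0 hw0)
      rw [show A * B * (w0.1 : ℤ) ^ 2 - (B * w0.2) ^ 2 =
        B * (A * (w0.1 : ℤ) ^ 2 - B * (w0.2 : ℤ) ^ 2) by ring]
      exact this.mul_left B
    rw [jacobiSym.sq_one', jacobiSym.mul_left, jacobiSym.sq_one' (hg hn1), mul_one] at h1
    · exact h1
    · apply hg
      intro h
      rcases hp'.dvd_or_dvd h with h | h
      · exact hndB pp hpy h
      · exact hn2 h
  set um : ℕ × ℕ → ℤ := fun w => w.1 * w0.2 - w0.1 * w.2 with hum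
  set up : ℕ × ℕ → ℤ := fun w => w.1 * w0.2 + w0.1 * w.2 with hup
  set f : ℕ × ℕ → Finset ℕ := fun w => y.primeFactors.filter
    fun p => (p : ℤ) ^ (y ^ 2).factorization p ∣ 2 * um w with hf
  have hor : ∀ w ∈ S, ∀ p ∈ y.primeFactors, (p : ℤ) ^ (y ^ 2).factorization p ∣ 2 * um w ∨
      (p : ℤ) ^ (y ^ 2).factorization p ∣ 2 * up w := by
    intro w hw p hp
    have pp := Nat.prime_of_mem_primeFactors hp
    have hpy := Nat.dvd_of_mem_primeFactors hp
    have hp' : Prime (p : ℤ) := Nat.prime_iff_prime_int.mp pp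
    apply prime_pow_dvd_two_mul_or (r := um w) (t := up w) (m := w.1 * w0.2) pp
    · intro h
      rcases hp'.dvd_or_dvd h with h | h
      · exact (hnd pp hpy w hw).1 h
      · exact (hnd pp hpy w0 hw0).2 h
    · simp only [hum, hup]
      ring
    · have h1 : (y : ℤ) ^ 2 ∣ A * (um w * up w) := by
        have h2 := dvd_sub ((hdvd w hw).mul_left ((w0.2 : ℤ) ^ 2))
          ((hdvd w0 hw0).mul_left ((w.2 : ℤ) ^ 2))
        rw [show A * (um w * up w) = (w0.2 : ℤ) ^ 2 * (A * (w.1 : ℤ) ^ 2 - B * (w.2 : ℤ) ^ 2) -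
          (w.2 : ℤ) ^ 2 * (A * (w0.1 : ℤ) ^ 2 - B * (w0.2 : ℤ) ^ 2) by simp only [hum, hup]; ring]
        exact h2
      have h2 : (y : ℤ) ^ 2 ∣ um w * up w := (IsCoprime.pow_left hA.symm).dvd_of_dvd_mul_left h1
      refine dvd_trans ?_ h2
      exact_mod_cast Nat.ordProj_dvd (y ^ 2) p
  have hsame : ∀ w ∈ S, ∀ w' ∈ S, f w = f w' →
      (y : ℤ) ^ 2 ∣ 2 * ((w.1 : ℤ) * w'.2 - w'.1 * w.2) := by
    intro w hw w' hw' hff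
    have h0 : y ^ 2 ∣ (2 * ((w.1 : ℤ) * w'.2 - w'.1 * w.2)).natAbs := by
      rw [Nat.dvd_iff_prime_pow_dvd_dvd]
      intro p k pp hpk
      rcases Nat.eq_zero_or_pos k with rfl | hk
      · simp
      have hpy : p ∣ y := pp.dvd_of_dvd_pow (dvd_trans (dvd_pow_self p hk.ne') hpk)
      have hp' : Prime (p : ℤ) := Nat.prime_iff_prime_int.mp pp
      have hpm : p ∈ y.primeFactors := Nat.mem_primeFactors.mpr ⟨pp, hpy, hy.ne'⟩
      have hke : k ≤ (y ^ 2).factorization p :=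
        (pp.pow_dvd_iff_le_factorization (by positivity)).mp hpk
      rw [← Int.natCast_dvd]
      push_cast
      refine dvd_trans (pow_dvd_pow _ hke) ?_
      have hc : IsCoprime ((p : ℤ) ^ (y ^ 2).factorization p) (w0.2 : ℤ) :=
        IsCoprime.pow_left ((Prime.coprime_iff_not_dvd hp').mpr (hnd pp hpy w0 hw0).2)
      apply hc.dvd_of_dvd_mul_left
      by_cases hin : p ∈ f w
      · have hin' := hff ▸ hin
        have h1 := (Finset.mem_filter.mp hin).2
        have h2 := (Finset.mem_filter.mp hin').2
        have h3 := dvd_sub (h1.mul_right (w'.2 : ℤ)) (h2.mul_right (w.2 : ℤ))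
        convert h3 using 1
        simp only [hum]
        ring
      · have hin' : p ∉ f w' := hff ▸ hin
        have h1 := (hor w hw p hpm).resolve_left fun h => hin (Finset.mem_filter.mpr ⟨hpm, h⟩)
        have h2 := (hor w' hw' p hpm).resolve_left fun h => hin' (Finset.mem_filter.mpr ⟨hpm, h⟩)
        have h3 := dvd_sub (h1.mul_right (w'.2 : ℤ)) (h2.mul_right (w.2 : ℤ))
        convert h3 using 1
        simp only [hup]
        ring
    rw [← Int.natCast_dvd] at h0
    exact_mod_cast h0
  have hfiber : ∀ b ∈ y.primeFactors.powerset,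
      ((S.filter fun w => f w = b).card : ℝ) ≤ 1 + 8 * V ^ 2 * ℓ / y ^ 2 := by
    intro b _
    have h := card_le_of_separated (S.filter fun w => f w = b) (fun w => (w.1 : ℝ) / w.2)
      (a := c) (L := ℓ) (δ := (y : ℝ) ^ 2 / (8 * V ^ 2)) (by positivity) hℓ ?_ ?_
    · refine h.trans (le_of_eq ?_)
      field_simp
      ring
    · intro w hw
      have := hslope w (Finset.mem_filter.mp hw).1
      exact this
    · intro w hw w' hw' hne
      obtain ⟨hw, hwb⟩ := Finset.mem_filter.mp hw
      obtain ⟨hw', hwb'⟩ := Finset.mem_filter.mp hw'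
      have h1 := hsame w hw w' hw' (hwb.trans hwb'.symm)
      have hdet : (w.1 : ℤ) * w'.2 - w'.1 * w.2 ≠ 0 := by
        intro h0
        have h2 : w.1 * w'.2 = w'.1 * w.2 := by
          have : (w.1 : ℤ) * w'.2 = w'.1 * w.2 := by linarith
          exact_mod_cast this
        have h3 := eq_of_coprime_of_mul_eq (hpos w hw) (hcop w hw) (hcop w' hw') h2
        exact hne (Prod.ext h3.1 h3.2)
      have h2 := Int.le_of_dvd (abs_pos.mpr (mul_ne_zero two_ne_zero hdet)) ((dvd_abs _ _).mpr h1)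
      have h3 : (y : ℝ) ^ 2 ≤ 2 * |(w.1 : ℝ) * w'.2 - w'.1 * w.2| := by
        rw [abs_mul, abs_two] at h2
        exact_mod_cast h2
      have hv : (0 : ℝ) < w.2 := by exact_mod_cast hpos w hw
      have hv' : (0 : ℝ) < w'.2 := by exact_mod_cast hpos w' hw'
      have e : (w.1 : ℝ) / w.2 - (w'.1 : ℝ) / w'.2 =
          ((w.1 : ℝ) * w'.2 - w'.1 * w.2) / (w.2 * w'.2) := by
        field_simp
      rw [e, abs_div, abs_of_pos (mul_pos hv hv'), div_le_div_iff₀ (by positivity) (by positivity)]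
      have h4 : (w.2 : ℝ) * w'.2 ≤ (2 * V) * (2 * V) :=
        mul_le_mul (hVle w hw) (hVle w' hw') hv'.le (by positivity)
      calc (y : ℝ) ^ 2 * (w.2 * w'.2) ≤ (2 * |(w.1 : ℝ) * w'.2 - w'.1 * w.2|) * ((2 * V) * (2 * V)) :=
            mul_le_mul h3 h4 (by positivity) (by positivity)
        _ = _ := by ring
  have hcard : S.card = ∑ b ∈ y.primeFactors.powerset, (S.filter fun w => f w = b).card :=
    Finset.card_eq_sum_card_fiberwise fun w _ =>
      Finset.mem_powerset.mpr (Finset.filter_subset _ _)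
  calc (S.card : ℝ) = ∑ b ∈ y.primeFactors.powerset, ((S.filter fun w => f w = b).card : ℝ) := by
        rw [hcard]
        push_cast
        rfl
    _ ≤ ∑ b ∈ y.primeFactors.powerset, (1 + 8 * V ^ 2 * ℓ / y ^ 2) := Finset.sum_le_sum hfiber
    _ = 2 ^ y.primeFactors.card * (1 + 8 * V ^ 2 * ℓ / y ^ 2) := by
        rw [Finset.sum_const, Finset.card_powerset, nsmul_eq_mul]
        push_cast
        rfl
    _ ≤ _ := mul_le_mul_of_nonneg_right (two_pow_le_two_mul_localCount _ hy.ne' hjac) hfac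

theorem sum_card_divisors_le (U : ℕ) :
    ∑ y ∈ Finset.Ioc 0 U, (y.divisors.card : ℝ) ≤ U * (1 + log U) := by
  have h := sum_sum_divisors (fun _ => 1) U
  simp only [Finset.sum_const, nsmul_eq_mul, mul_one, one_mul] at h
  rw [h]
  calc _ ≤ ∑ d ∈ Finset.Ioc 0 U, U * ((d : ℝ)⁻¹) := by
        refine Finset.sum_le_sum fun d _ => ?_
        rw [← div_eq_mul_inv]
        exact Nat.cast_div_le
    _ ≤ _ := by
        rw [← Finset.mul_sum]
        apply mul_le_mul_of_nonneg_left _ (Nat.cast_nonneg _)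
        have := harmonic_le_one_add_log U
        rw [harmonic_eq_sum_Icc] at this
        push_cast at this
        exact this

/-- Counting primitive solutions in a box by fibering over two coefficients and one modulus. -/
theorem card_le_of_fibration {τ : Type*} (S : Finset τ) (n1 n2 y u v : τ → ℕ) {s : ℤ}
    (hs : s.natAbs = 1) {X1 X2 Y : ℕ} (hX1 : 0 < X1) (hX2 : 0 < X2) (hY : 0 < Y)
    {V ℓ Λ : ℝ} (c : ℕ → ℕ → ℝ) (hV : 0 < V) (hℓ : 0 ≤ ℓ) (hΛ : 1 ≤ Λ)
    (hΛ' : X1 = 1 → X2 = 1 → 1 + log (2 * Y) ≤ Λ)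
    (hn1 : ∀ t ∈ S, X1 ≤ n1 t ∧ n1 t < 2 * X1) (hn2 : ∀ t ∈ S, X2 ≤ n2 t ∧ n2 t < 2 * X2)
    (hy : ∀ t ∈ S, Y ≤ y t ∧ y t < 2 * Y)
    (hinj : ∀ t ∈ S, ∀ t' ∈ S, n1 t = n1 t' → n2 t = n2 t' → y t = y t' → u t = u t' →
      v t = v t' → t = t')
    (hc1 : ∀ t ∈ S, (n1 t).Coprime (y t)) (hc2 : ∀ t ∈ S, (n2 t).Coprime (y t))
    (hpos : ∀ t ∈ S, 0 < v t) (hcop : ∀ t ∈ S, (u t).Coprime (v t))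
    (hVle : ∀ t ∈ S, (v t : ℝ) ≤ 2 * V)
    (hdvd : ∀ t ∈ S, (y t : ℤ) ^ 2 ∣ n1 t * (u t : ℤ) ^ 2 - s * n2 t * (v t : ℤ) ^ 2)
    (hslope : ∀ t ∈ S, c (n1 t) (n2 t) ≤ (u t : ℝ) / v t ∧
      (u t : ℝ) / v t ≤ c (n1 t) (n2 t) + ℓ)
    (hsq : ∀ t ∈ S, IsSquare (s * n1 t * n2 t) → n1 t = 1 ∧ n2 t = 1) :
    (S.card : ℝ) ≤ 1300 * Λ * (X1 * X2 * Y * (1 + 8 * V ^ 2 * ℓ / Y ^ 2)) := by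
  classical
  set F : ℝ := 1 + 8 * V ^ 2 * ℓ / Y ^ 2 with hF
  have hY' : (0 : ℝ) < Y := by exact_mod_cast hY
  have hF0 : 0 ≤ F := by positivity
  set g1 : ℕ → ℕ → ℕ → ℝ := fun a b z =>
    if IsSquare (s * a * b) then 0 else localCount (s * a * b) z with hg1
  set g2 : ℕ → ℕ → ℕ → ℝ := fun a b z => if a = 1 ∧ b = 1 then (z.divisors.card : ℝ) else 0
    with hg2
  have hg1n : ∀ a b z, 0 ≤ g1 a b z := by
    intro a b z
    simp only [hg1]
    split_ifs
    · exact le_rfl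
    · exact localCount_nonneg _ _
  have hg2n : ∀ a b z, 0 ≤ g2 a b z := by
    intro a b z
    simp only [hg2]
    split_ifs <;> positivity
  have hfib : ∀ a b z, ((S.filter fun t => n1 t = a ∧ n2 t = b ∧ y t = z).card : ℝ) ≤
      2 * F * (g1 a b z + g2 a b z) := by
    intro a b z
    set R := S.filter fun t => n1 t = a ∧ n2 t = b ∧ y t = z with hR
    rcases R.eq_empty_or_nonempty with h | ⟨t0, ht0⟩
    · rw [h]
      have := hg1n a b z
      have := hg2n a b z
      simp only [Finset.card_empty, Nat.cast_zero]
      positivity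
    have hmem : ∀ t ∈ R, t ∈ S ∧ n1 t = a ∧ n2 t = b ∧ y t = z := fun t ht => by
      simpa [hR] using ht
    obtain ⟨h0S, h0a, h0b, h0z⟩ := hmem t0 ht0
    have hzY : Y ≤ z := h0z ▸ (hy t0 h0S).1
    have hzY' : (Y : ℝ) ≤ z := by exact_mod_cast hzY
    have hinjR : Set.InjOn (fun t => (u t, v t)) (R : Set τ) := by
      intro t ht t' ht' h
      obtain ⟨m, e1, e2, e3⟩ := hmem t ht
      obtain ⟨m', e1', e2', e3'⟩ := hmem t' ht'
      have h := Prod.mk.inj h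
      exact hinj t m t' m' (e1.trans e1'.symm) (e2.trans e2'.symm) (e3.trans e3'.symm) h.1 h.2
    have hs' : IsCoprime s (z : ℤ) := by
      rcases Int.natAbs_eq s with h | h <;> rw [h, hs]
      · exact isCoprime_one_left
      · exact isCoprime_one_left.neg_left
    have hb := card_solutions_le (A := a) (B := s * b) (y := z) (by omega)
      (by rw [← h0a, ← h0z]; exact Nat.isCoprime_iff_coprime.mpr (hc1 t0 h0S))
      (hs'.mul_left (by rw [← h0b, ← h0z]; exact Nat.isCoprime_iff_coprime.mpr (hc2 t0 h0S)))
      (R.image fun t => (u t, v t)) (V := V) (c := c a b) (ℓ := ℓ) hV hℓ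
      (by
        intro w hw
        obtain ⟨t, ht, rfl⟩ := Finset.mem_image.mp hw
        exact hpos t (hmem t ht).1)
      (by
        intro w hw
        obtain ⟨t, ht, rfl⟩ := Finset.mem_image.mp hw
        exact hcop t (hmem t ht).1)
      (by
        intro w hw
        obtain ⟨t, ht, rfl⟩ := Finset.mem_image.mp hw
        exact hVle t (hmem t ht).1)
      (by
        intro w hw
        obtain ⟨t, ht, rfl⟩ := Finset.mem_image.mp hw
        obtain ⟨m, e1, e2, e3⟩ := hmem t ht
        have := hdvd t m
        rwa [e1, e2, e3] at this)
      (by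
        intro w hw
        obtain ⟨t, ht, rfl⟩ := Finset.mem_image.mp hw
        obtain ⟨m, e1, e2, e3⟩ := hmem t ht
        have := hslope t m
        rwa [e1, e2] at this)
    rw [Finset.card_image_of_injOn hinjR, show (a : ℤ) * (s * b) = s * a * b by ring] at hb
    have hFz : 1 + 8 * V ^ 2 * ℓ / (z : ℝ) ^ 2 ≤ F := by
      rw [hF]
      gcongr
    have hloc : localCount (s * a * b) z ≤ g1 a b z + g2 a b z := by
      simp only [hg1]
      split_ifs with h
      · have h1 := hsq t0 h0S (by rwa [h0a, h0b])
        rw [h0a, h0b] at h1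
        simp only [hg2, h1, and_self, if_true, zero_add]
        exact localCount_le_card_divisors _ _
      · have := hg2n a b z
        linarith
    calc (R.card : ℝ) ≤ _ := hb
      _ ≤ 2 * localCount (s * a * b) z * F :=
        mul_le_mul_of_nonneg_left hFz (mul_nonneg zero_le_two (localCount_nonneg _ _))
      _ = 2 * F * localCount (s * a * b) z := by ring
      _ ≤ _ := mul_le_mul_of_nonneg_left hloc (by positivity)
  set K := Finset.Ico X1 (2 * X1) ×ˢ Finset.Ico X2 (2 * X2) ×ˢ Finset.Ioc 0 (2 * Y) with hK
  have hcard : S.card = ∑ k ∈ K, (S.filter fun t => (n1 t, n2 t, y t) = k).card :=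
    Finset.card_eq_sum_card_fiberwise fun t ht => by
      have := hy t ht
      rw [hK, Finset.mem_coe, Finset.mem_product, Finset.mem_product, Finset.mem_Ico,
        Finset.mem_Ico, Finset.mem_Ioc]
      exact ⟨hn1 t ht, hn2 t ht, show 0 < y t by omega, show y t ≤ 2 * Y by omega⟩
  have h1 : (S.card : ℝ) ≤ ∑ k ∈ K, 2 * F * (g1 k.1 k.2.1 k.2.2 + g2 k.1 k.2.1 k.2.2) := by
    rw [hcard]
    push_cast
    refine Finset.sum_le_sum fun k _ => ?_
    simpa only [Prod.ext_iff] using hfib k.1 k.2.1 k.2.2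
  rw [← Finset.mul_sum, Finset.sum_add_distrib] at h1
  have hS1 : ∑ k ∈ K, g1 k.1 k.2.1 k.2.2 ≤ 308 * X1 * X2 * (2 * Y) := by
    have := sum_sum_localCount_le hs hX1 hX2 (2 * Y)
    push_cast at this
    refine le_trans (le_of_eq ?_) this
    rw [hK, Finset.sum_product]
    refine Finset.sum_congr rfl fun a _ => ?_
    rw [Finset.sum_product]
    refine Finset.sum_congr rfl fun b _ => ?_
    simp only [hg1]
    split_ifs <;> simp
  have hS2 : ∑ k ∈ K, g2 k.1 k.2.1 k.2.2 ≤ Λ * (2 * Y) := by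
    by_cases h : X1 = 1 ∧ X2 = 1
    · obtain ⟨rfl, rfl⟩ := h
      have e : ∑ k ∈ K, g2 k.1 k.2.1 k.2.2 =
          ∑ z ∈ Finset.Ioc 0 (2 * Y), (z.divisors.card : ℝ) := by
        rw [hK, show Finset.Ico 1 (2 * 1) = {1} from rfl, Finset.sum_product,
          Finset.sum_singleton, Finset.sum_product, Finset.sum_singleton]
        simp [hg2]
      rw [e]
      refine (sum_card_divisors_le _).trans ?_
      have := hΛ' rfl rfl
      push_cast
      nlinarith
    · have e : ∑ k ∈ K, g2 k.1 k.2.1 k.2.2 = 0 := by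
        refine Finset.sum_eq_zero fun k hk => ?_
        simp only [hK, Finset.mem_product, Finset.mem_Ico] at hk
        simp only [hg2]
        rw [if_neg]
        rintro ⟨e1, e2⟩
        exact h ⟨by omega, by omega⟩
      rw [e]
      positivity
  have hX1' : (1 : ℝ) ≤ X1 := by exact_mod_cast hX1
  have hX2' : (1 : ℝ) ≤ X2 := by exact_mod_cast hX2
  have hXX : (1 : ℝ) ≤ X1 * X2 := by nlinarith
  have h2 : 308 * X1 * X2 * (2 * Y) + Λ * (2 * Y) ≤ 650 * Λ * (X1 * X2 * Y : ℝ) := by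
    have e1 : (X1 * X2 * Y : ℝ) ≤ Λ * (X1 * X2 * Y) := by
      have : (0 : ℝ) ≤ X1 * X2 * Y := by positivity
      nlinarith
    have e2 : Λ * Y ≤ Λ * (X1 * X2 * Y : ℝ) := by
      apply mul_le_mul_of_nonneg_left _ (by linarith)
      nlinarith
    have e3 : (0 : ℝ) ≤ Λ * (X1 * X2 * Y) := by positivity
    linarith
  calc (S.card : ℝ) ≤ _ := h1
    _ ≤ 2 * F * (650 * Λ * (X1 * X2 * Y : ℝ)) :=
      mul_le_mul_of_nonneg_left ((add_le_add hS1 hS2).trans h2) (by positivity)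
    _ = _ := by ring

/-- Positive primitive solutions of `a₁ b₁² + a₂ b₂² = a₃ b₃²` with `a₂ b₂² ≤ a₁ b₁²`. -/
@[ext]
structure ConicPoint where
  (a1 a2 a3 b1 b2 b3 : ℕ)
  b1_pos : 0 < b1
  b2_pos : 0 < b2
  b3_pos : 0 < b3
  sqf1 : Squarefree a1
  sqf2 : Squarefree a2
  sqf3 : Squarefree a3
  a12 : a1.Coprime a2
  a13 : a1.Coprime a3
  a23 : a2.Coprime a3
  b12 : b1.Coprime b2
  b13 : b1.Coprime b3
  b23 : b2.Coprime b3
  eqn : a1 * b1 ^ 2 + a2 * b2 ^ 2 = a3 * b3 ^ 2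
  le : a2 * b2 ^ 2 ≤ a1 * b1 ^ 2

theorem coprime_of_forall_prime_dvd {a b a' b' : ℕ} (ha : a.Coprime a') (hb : b.Coprime b')
    (h : ∀ p, p.Prime → p ∣ a → p ∣ b → p ∣ a' * b' ^ 2) : a.Coprime b := by
  refine Nat.Coprime.symm (Nat.coprime_of_dvd fun p hp hpb hpa => ?_)
  rcases (Nat.Prime.dvd_mul hp).mp (h p hp hpa hpb) with h | h
  · exact Nat.not_coprime_of_dvd_of_dvd hp.one_lt hpa h ha
  · exact Nat.not_coprime_of_dvd_of_dvd hp.one_lt hpb (hp.dvd_of_dvd_pow h) hb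

namespace ConicPoint

variable (t : ConicPoint)

theorem a1_pos : 0 < t.a1 := Nat.pos_of_ne_zero t.sqf1.ne_zero
theorem a2_pos : 0 < t.a2 := Nat.pos_of_ne_zero t.sqf2.ne_zero
theorem a3_pos : 0 < t.a3 := Nat.pos_of_ne_zero t.sqf3.ne_zero

theorem a1_b2 : t.a1.Coprime t.b2 := coprime_of_forall_prime_dvd t.a13 t.b23 fun p _ h1 h2 => by
  rw [← t.eqn]
  exact dvd_add (h1.mul_right _) ((h2.pow two_ne_zero).mul_left _)

theorem a1_b3 : t.a1.Coprime t.b3 :=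
  coprime_of_forall_prime_dvd t.a12 t.b23.symm fun p _ h1 h2 => by
    have : p ∣ t.a1 * t.b1 ^ 2 + t.a2 * t.b2 ^ 2 := by
      rw [t.eqn]
      exact (h2.pow two_ne_zero).mul_left _
    exact (Nat.dvd_add_right (h1.mul_right _)).mp this

theorem a2_b1 : t.a2.Coprime t.b1 := coprime_of_forall_prime_dvd t.a23 t.b13 fun p _ h1 h2 => by
  rw [← t.eqn]
  exact dvd_add ((h2.pow two_ne_zero).mul_left _) (h1.mul_right _)

theorem a2_b3 : t.a2.Coprime t.b3 :=
  coprime_of_forall_prime_dvd t.a12.symm t.b13.symm fun p _ h1 h2 => by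
    have : p ∣ t.a1 * t.b1 ^ 2 + t.a2 * t.b2 ^ 2 := by
      rw [t.eqn]
      exact (h2.pow two_ne_zero).mul_left _
    exact (Nat.dvd_add_left (h1.mul_right _)).mp this

theorem a3_b1 : t.a3.Coprime t.b1 :=
  coprime_of_forall_prime_dvd t.a23.symm t.b12 fun p _ h1 h2 => by
    have : p ∣ t.a1 * t.b1 ^ 2 + t.a2 * t.b2 ^ 2 := by
      rw [t.eqn]
      exact h1.mul_right _
    exact (Nat.dvd_add_right ((h2.pow two_ne_zero).mul_left _)).mp this

theorem a3_b2 : t.a3.Coprime t.b2 :=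
  coprime_of_forall_prime_dvd t.a13.symm t.b12.symm fun p _ h1 h2 => by
    have : p ∣ t.a1 * t.b1 ^ 2 + t.a2 * t.b2 ^ 2 := by
      rw [t.eqn]
      exact h1.mul_right _
    exact (Nat.dvd_add_left ((h2.pow two_ne_zero).mul_left _)).mp this

end ConicPoint

theorem eq_one_of_isSquare_mul {m n : ℕ} (hm : Squarefree m) (hn : Squarefree n)
    (h : m.Coprime n) (hs : IsSquare (1 * (m : ℤ) * n)) : m = 1 ∧ n = 1 := by
  rw [one_mul] at hs
  have hs' : IsSquare (m * n) := by exact_mod_cast hs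
  have h1 : Squarefree (m * n) := (Nat.squarefree_mul h).mpr ⟨hm, hn⟩
  obtain ⟨r, hr⟩ := hs'
  have := h1 r ⟨1, by rw [hr, mul_one]⟩
  rw [Nat.isUnit_iff] at this
  rw [this] at hr
  exact ⟨Nat.eq_one_of_mul_eq_one_right hr, Nat.eq_one_of_mul_eq_one_left hr⟩

/-- A dyadic box for the coordinates of a `ConicPoint`. -/
structure ConicPoint.InBox (t : ConicPoint) (X1 X2 X3 Y1 Y2 Y3 : ℕ) : Prop where
  x1 : X1 ≤ t.a1 ∧ t.a1 < 2 * X1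
  x2 : X2 ≤ t.a2 ∧ t.a2 < 2 * X2
  x3 : X3 ≤ t.a3 ∧ t.a3 < 2 * X3
  y1 : Y1 ≤ t.b1 ∧ t.b1 < 2 * Y1
  y2 : Y2 ≤ t.b2 ∧ t.b2 < 2 * Y2
  y3 : Y3 ≤ t.b3 ∧ t.b3 < 2 * Y3

section Box

variable (S : Finset ConicPoint) {X1 X2 X3 Y1 Y2 Y3 : ℕ} {Λ : ℝ}

theorem card_box_le_one (hS : ∀ t ∈ S, t.InBox X1 X2 X3 Y1 Y2 Y3) (hX2 : 0 < X2)
    (hX3 : 0 < X3) (hY1 : 0 < Y1) (hY3 : 0 < Y3) (hΛ : 1 ≤ Λ)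
    (hΛ' : X2 = 1 → X3 = 1 → 1 + log (2 * Y1) ≤ Λ) :
    (S.card : ℝ) ≤ 1300 * Λ * (X2 * X3 * Y1 * (1 + 16 * Y2 * Y3 / Y1 ^ 2)) := by
  have hY3' : (0 : ℝ) < Y3 := by exact_mod_cast hY3
  have h := card_le_of_fibration S (fun t => t.a2) (fun t => t.a3) (fun t => t.b1)
    (fun t => t.b2) (fun t => t.b3) (s := 1) rfl hX2 hX3 hY1 (V := Y3) (ℓ := 2 * Y2 / Y3)
    (fun _ _ => 0) hY3' (by positivity) hΛ hΛ' (fun t ht => (hS t ht).x2)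
    (fun t ht => (hS t ht).x3) (fun t ht => (hS t ht).y1)
    (by
      intro t _ t' _ e1 e2 e3 e4 e5
      have h1 := t.eqn
      have h2 := t'.eqn
      rw [← e1, ← e2, ← e3, ← e4, ← e5, ← h1] at h2
      have := Nat.eq_of_mul_eq_mul_right (pow_pos t.b1_pos 2) (Nat.add_right_cancel h2)
      exact ConicPoint.ext this.symm e1 e2 e3 e4 e5)
    (fun t _ => t.a2_b1) (fun t _ => t.a3_b1) (fun t _ => t.b3_pos) (fun t _ => t.b23)
    (fun t ht => by exact_mod_cast (hS t ht).y3.2.le)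
    (fun t _ => ⟨-t.a1, by
      have := t.eqn
      zify at this
      linear_combination this⟩)
    (fun t ht => by
      have h1 : (t.b2 : ℝ) ≤ 2 * Y2 := by exact_mod_cast (hS t ht).y2.2.le
      have h2 : (Y3 : ℝ) ≤ t.b3 := by exact_mod_cast (hS t ht).y3.1
      refine ⟨by positivity, ?_⟩
      rw [zero_add]
      gcongr)
    (fun t _ h => eq_one_of_isSquare_mul t.sqf2 t.sqf3 t.a23 h)
  refine h.trans (le_of_eq ?_)
  have : 8 * (Y3 : ℝ) ^ 2 * (2 * Y2 / Y3) = 16 * Y2 * Y3 := by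
    field_simp
    ring
  rw [this]

theorem card_box_le_three (hS : ∀ t ∈ S, t.InBox X1 X2 X3 Y1 Y2 Y3) (hX1 : 0 < X1)
    (hX2 : 0 < X2) (hY2 : 0 < Y2) (hY3 : 0 < Y3) (hΛ : 1 ≤ Λ)
    (hΛ' : X1 = 1 → X2 = 1 → 1 + log (2 * Y3) ≤ Λ) :
    (S.card : ℝ) ≤ 1300 * Λ * (X1 * X2 * Y3 * (1 + 16 * Y1 * Y2 / Y3 ^ 2)) := by
  have hY2' : (0 : ℝ) < Y2 := by exact_mod_cast hY2
  have h := card_le_of_fibration S (fun t => t.a1) (fun t => t.a2) (fun t => t.b3)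
    (fun t => t.b1) (fun t => t.b2) (s := -1) rfl hX1 hX2 hY3 (V := Y2) (ℓ := 2 * Y1 / Y2)
    (fun _ _ => 0) hY2' (by positivity) hΛ hΛ' (fun t ht => (hS t ht).x1)
    (fun t ht => (hS t ht).x2) (fun t ht => (hS t ht).y3)
    (by
      intro t _ t' _ e1 e2 e3 e4 e5
      have h1 := t.eqn
      have h2 := t'.eqn
      rw [← e1, ← e2, ← e3, ← e4, ← e5, h1] at h2
      have := Nat.eq_of_mul_eq_mul_right (pow_pos t.b3_pos 2) h2
      exact ConicPoint.ext e1 e2 this e4 e5 e3)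
    (fun t _ => t.a1_b3) (fun t _ => t.a2_b3) (fun t _ => t.b2_pos) (fun t _ => t.b12)
    (fun t ht => by exact_mod_cast (hS t ht).y2.2.le)
    (fun t _ => ⟨t.a3, by
      have := t.eqn
      zify at this
      linear_combination this⟩)
    (fun t ht => by
      have h1 : (t.b1 : ℝ) ≤ 2 * Y1 := by exact_mod_cast (hS t ht).y1.2.le
      have h2 : (Y2 : ℝ) ≤ t.b2 := by exact_mod_cast (hS t ht).y2.1
      refine ⟨by positivity, ?_⟩
      rw [zero_add]
      gcongr)
    (fun t _ h => by
      exfalso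
      have h1 := h.nonneg
      have : 0 < (t.a1 : ℤ) * t.a2 := by
        have := t.a1_pos
        have := t.a2_pos
        positivity
      linarith)
  refine h.trans (le_of_eq ?_)
  have : 8 * (Y2 : ℝ) ^ 2 * (2 * Y1 / Y2) = 16 * Y1 * Y2 := by
    field_simp
    ring
  rw [this]

theorem card_box_le_two (hS : ∀ t ∈ S, t.InBox X1 X2 X3 Y1 Y2 Y3) (hX1 : 0 < X1)
    (hX3 : 0 < X3) (hY1 : 0 < Y1) (hY2 : 0 < Y2) (hY3 : 0 < Y3) (hΛ : 1 ≤ Λ)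
    (hΛ' : X1 = 1 → X3 = 1 → 1 + log (2 * Y2) ≤ Λ) :
    (S.card : ℝ) ≤ 1300 * Λ * (X1 * X3 * Y2 * (1 + 64 * X2 * Y3 / (X1 * Y1))) := by
  have hX1' : (0 : ℝ) < X1 := by exact_mod_cast hX1
  have hY1' : (0 : ℝ) < Y1 := by exact_mod_cast hY1
  have hY2' : (0 : ℝ) < Y2 := by exact_mod_cast hY2
  have hY3' : (0 : ℝ) < Y3 := by exact_mod_cast hY3
  set ℓ : ℝ := 8 * X2 * Y2 ^ 2 / (X1 * Y1 * Y3) with hℓ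
  have hℓ0 : 0 ≤ ℓ := by positivity
  have h := card_le_of_fibration S (fun t => t.a1) (fun t => t.a3) (fun t => t.b2)
    (fun t => t.b1) (fun t => t.b3) (s := 1) rfl hX1 hX3 hY2 (V := Y3) (ℓ := ℓ)
    (fun a b => √((b : ℝ) / a) - ℓ) hY3' hℓ0 hΛ hΛ' (fun t ht => (hS t ht).x1)
    (fun t ht => (hS t ht).x3) (fun t ht => (hS t ht).y2)
    (by
      intro t _ t' _ e1 e2 e3 e4 e5
      have h1 := t.eqn
      have h2 := t'.eqn
      rw [← e1, ← e2, ← e3, ← e4, ← e5, ← h1] at h2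
      have := Nat.eq_of_mul_eq_mul_right (pow_pos t.b2_pos 2) (Nat.add_left_cancel h2)
      exact ConicPoint.ext e1 this.symm e2 e4 e3 e5)
    (fun t _ => t.a1_b2) (fun t _ => t.a3_b2) (fun t _ => t.b3_pos) (fun t _ => t.b13)
    (fun t ht => by exact_mod_cast (hS t ht).y3.2.le)
    (fun t _ => ⟨-t.a2, by
      have := t.eqn
      zify at this
      linear_combination this⟩)
    (fun t ht => by
      have p1 : (0 : ℝ) < t.a1 := by exact_mod_cast t.a1_pos
      have p2 : (0 : ℝ) < t.b1 := by exact_mod_cast t.b1_pos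
      have p3 : (0 : ℝ) < t.b3 := by exact_mod_cast t.b3_pos
      have h1 : (t.a2 : ℝ) ≤ 2 * X2 := by exact_mod_cast (hS t ht).x2.2.le
      have h2 : (t.b2 : ℝ) ≤ 2 * Y2 := by exact_mod_cast (hS t ht).y2.2.le
      have h3 : (X1 : ℝ) ≤ t.a1 := by exact_mod_cast (hS t ht).x1.1
      have h4 : (Y1 : ℝ) ≤ t.b1 := by exact_mod_cast (hS t ht).y1.1
      have h5 : (Y3 : ℝ) ≤ t.b3 := by exact_mod_cast (hS t ht).y3.1
      have e : (t.a1 * t.b1 ^ 2 + t.a2 * t.b2 ^ 2 : ℝ) = t.a3 * t.b3 ^ 2 := by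
        exact_mod_cast t.eqn
      have hle : (t.a2 * t.b2 ^ 2 / (t.a1 * t.b1 * t.b3) : ℝ) ≤ ℓ := by
        calc (t.a2 * t.b2 ^ 2 / (t.a1 * t.b1 * t.b3) : ℝ)
            ≤ (2 * X2) * (2 * Y2) ^ 2 / (X1 * Y1 * Y3) := by gcongr
          _ = ℓ := by rw [hℓ]; ring
      have hr : (t.a3 / t.a1 : ℝ) =
          (t.b1 / t.b3) ^ 2 + t.b1 / t.b3 * (t.a2 * t.b2 ^ 2 / (t.a1 * t.b1 * t.b3)) := by
        field_simp
        linarith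
      have hx : (0 : ℝ) < t.b1 / t.b3 := by positivity
      have hm := mul_le_mul_of_nonneg_left hle hx.le
      constructor
      · rw [sub_le_iff_le_add]
        apply Real.sqrt_le_iff.mpr ⟨by positivity, ?_⟩
        rw [hr]
        nlinarith
      · rw [sub_add_cancel]
        apply Real.le_sqrt_of_sq_le
        rw [hr]
        have : (0 : ℝ) ≤ t.b1 / t.b3 * (t.a2 * t.b2 ^ 2 / (t.a1 * t.b1 * t.b3)) := by
          positivity
        linarith)
    (fun t _ h => eq_one_of_isSquare_mul t.sqf1 t.sqf3 t.a13 h)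
  refine h.trans (le_of_eq ?_)
  have : 8 * (Y3 : ℝ) ^ 2 * ℓ / Y2 ^ 2 = 64 * X2 * Y3 / (X1 * Y1) := by
    rw [hℓ]
    field_simp
    ring
  rw [this]

end Box

theorem ConicPoint.InBox.exponents {t : ConicPoint} {α1 α2 α3 β1 β2 β3 : ℕ}
    (h : t.InBox (2 ^ α1) (2 ^ α2) (2 ^ α3) (2 ^ β1) (2 ^ β2) (2 ^ β3)) :
    α1 + 2 * β1 ≤ α3 + 2 * β3 + 2 ∧ α3 + 2 * β3 ≤ α1 + 2 * β1 + 3 ∧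
      α2 + 2 * β2 ≤ α1 + 2 * β1 + 2 := by
  have key : ∀ {α β a b : ℕ}, 2 ^ α ≤ a ∧ a < 2 * 2 ^ α → 2 ^ β ≤ b ∧ b < 2 * 2 ^ β →
      2 ^ (α + 2 * β) ≤ a * b ^ 2 ∧ a * b ^ 2 < 2 ^ (α + 2 * β + 3) := by
    intro α β a b ha hb
    constructor
    · rw [pow_add, mul_comm 2 β, pow_mul]
      exact Nat.mul_le_mul ha.1 (Nat.pow_le_pow_left hb.1 2)
    · rw [show (2 : ℕ) ^ (α + 2 * β + 3) = (2 * 2 ^ α) * (2 * 2 ^ β) ^ 2 by ring]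
      exact Nat.mul_lt_mul_of_lt_of_lt ha.2 (Nat.pow_lt_pow_left hb.2 two_ne_zero)
  obtain ⟨l1, u1⟩ := key h.x1 h.y1
  obtain ⟨l2, u2⟩ := key h.x2 h.y2
  obtain ⟨l3, u3⟩ := key h.x3 h.y3
  have e := t.eqn
  have l := t.le
  refine ⟨?_, ?_, ?_⟩
  · have : 2 ^ (α1 + 2 * β1) < 2 ^ (α3 + 2 * β3 + 3) := by omega
    have := (Nat.pow_lt_pow_iff_right (a := 2) (by norm_num)).mp this
    omega
  · have : 2 ^ (α3 + 2 * β3) < 2 ^ (α1 + 2 * β1 + 3 + 1) := by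
      rw [pow_succ _ (α1 + 2 * β1 + 3)]
      omega
    have := (Nat.pow_lt_pow_iff_right (a := 2) (by norm_num)).mp this
    omega
  · have : 2 ^ (α2 + 2 * β2) < 2 ^ (α1 + 2 * β1 + 3) := by omega
    have := (Nat.pow_lt_pow_iff_right (a := 2) (by norm_num)).mp this
    omega

/-- The bound for a dyadic box, in terms of a sixth root `w` of `2`. -/
theorem card_dyadic_le (S : Finset ConicPoint) {α1 α2 α3 β1 β2 β3 : ℕ} {w Λ : ℝ}
    (hS : ∀ t ∈ S, t.InBox (2 ^ α1) (2 ^ α2) (2 ^ α3) (2 ^ β1) (2 ^ β2) (2 ^ β3))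
    (hw1 : 1 ≤ w) (hw : w ^ 6 = 2) (hΛ : 1 ≤ Λ)
    (h1 : α2 = 0 → α3 = 0 → 1 + log (2 * 2 ^ β1) ≤ Λ)
    (h2 : α1 = 0 → α3 = 0 → 1 + log (2 * 2 ^ β2) ≤ Λ)
    (h3 : α1 = 0 → α2 = 0 → 1 + log (2 * 2 ^ β3) ≤ Λ)
    (hpq : α1 + 2 * β1 ≤ α3 + 2 * β3 + 2) (hqp : α3 + 2 * β3 ≤ α1 + 2 * β1 + 3)
    (hcp : α2 + 2 * β2 ≤ α1 + 2 * β1 + 2) :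
    (S.card : ℝ) ≤
      668200 * (Λ * w ^ (3 * (α1 + α2 + α3) + 2 * (α3 + 2 * β3) + (α2 + 2 * β2))) := by
  set n := 3 * (α1 + α2 + α3) + 2 * (α3 + 2 * β3) + (α2 + 2 * β2) with hn
  have hw0 : 0 < w := by linarith
  have hpow : ∀ k : ℕ, ((2 : ℝ) ^ k) = w ^ (6 * k) := fun k => by rw [pow_mul, hw]
  have hone : ∀ k : ℕ, (2 : ℕ) ^ k = 1 → k = 0 := fun k hk => by
    by_contra h
    exact (Nat.one_lt_two_pow h).ne' hk
  have hU : ∀ k, 6 * k ≤ n + 2 → (2 : ℝ) ^ k ≤ 2 * w ^ n := by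
    intro k hk
    rw [hpow]
    calc w ^ (6 * k) ≤ w ^ (n + 6) := pow_le_pow_right₀ hw1 (by omega)
      _ = 2 * w ^ n := by rw [pow_add, hw]; ring
  have hV : ∀ k l, 6 * k ≤ 6 * l + n + 18 → (2 : ℝ) ^ k / 2 ^ l ≤ 8 * w ^ n := by
    intro k l hk
    rw [div_le_iff₀ (by positivity), hpow, hpow]
    calc w ^ (6 * k) ≤ w ^ (6 * l + n + 18) := pow_le_pow_right₀ hw1 hk
      _ = (w ^ 6) ^ 3 * w ^ n * w ^ (6 * l) := by ring
      _ = _ := by rw [hw]; norm_num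
  have hfin : ∀ x y : ℝ, x ≤ 2 * w ^ n → y ≤ 8 * w ^ n → ∀ z : ℝ, z ≤ 1300 * Λ * (x + 64 * y) →
      z ≤ 668200 * (Λ * w ^ n) := by
    intro x y hx hy z hz
    calc z ≤ _ := hz
      _ ≤ 1300 * Λ * (2 * w ^ n + 64 * (8 * w ^ n)) := by gcongr
      _ = _ := by ring
  have hp2 : ∀ k : ℕ, (0 : ℝ) < 2 ^ k := fun k => by positivity
  have hcases : 6 * (α2 + α3 + β1) ≤ n + 2 ∨ 6 * (α1 + α3 + β2) ≤ n + 2 ∨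
      6 * (α1 + α2 + β3) ≤ n + 2 := by omega
  rcases hcases with h | h | h
  · have hb := card_box_le_one S hS (by positivity) (by positivity) (by positivity)
      (by positivity) hΛ (fun e e' => by push_cast; exact h1 (hone _ e) (hone _ e'))
    push_cast at hb
    refine hfin _ _ (hU _ h) (hV (α2 + α3 + β2 + β3) β1 (by omega)) _ (hb.trans ?_)
    have e : (2 : ℝ) ^ α2 * 2 ^ α3 * 2 ^ β1 * (1 + 16 * 2 ^ β2 * 2 ^ β3 / (2 ^ β1) ^ 2) =
        2 ^ (α2 + α3 + β1) + 16 * (2 ^ (α2 + α3 + β2 + β3) / 2 ^ β1) := by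
      have := (hp2 β1).ne'
      field_simp
      ring
    rw [e]
    have : (0 : ℝ) < 2 ^ (α2 + α3 + β2 + β3) / 2 ^ β1 := by positivity
    gcongr
    norm_num
  · have hb := card_box_le_two S hS (by positivity) (by positivity) (by positivity)
      (by positivity) (by positivity) hΛ
      (fun e e' => by push_cast; exact h2 (hone _ e) (hone _ e'))
    push_cast at hb
    refine hfin _ _ (hU _ h) (hV (α2 + α3 + β2 + β3) β1 (by omega)) _ (hb.trans ?_)
    have e : (2 : ℝ) ^ α1 * 2 ^ α3 * 2 ^ β2 * (1 + 64 * 2 ^ α2 * 2 ^ β3 / (2 ^ α1 * 2 ^ β1)) =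
        2 ^ (α1 + α3 + β2) + 64 * (2 ^ (α2 + α3 + β2 + β3) / 2 ^ β1) := by
      have := (hp2 β1).ne'
      have := (hp2 α1).ne'
      field_simp
      ring
    rw [e]
  · have hb := card_box_le_three S hS (by positivity) (by positivity) (by positivity)
      (by positivity) hΛ (fun e e' => by push_cast; exact h3 (hone _ e) (hone _ e'))
    push_cast at hb
    refine hfin _ _ (hU _ h) (hV (α1 + α2 + β1 + β2) β3 (by omega)) _ (hb.trans ?_)
    have e : (2 : ℝ) ^ α1 * 2 ^ α2 * 2 ^ β3 * (1 + 16 * 2 ^ β1 * 2 ^ β2 / (2 ^ β3) ^ 2) =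
        2 ^ (α1 + α2 + β3) + 16 * (2 ^ (α1 + α2 + β1 + β2) / 2 ^ β3) := by
      have := (hp2 β3).ne'
      field_simp
      ring
    rw [e]
    have : (0 : ℝ) < 2 ^ (α1 + α2 + β1 + β2) / 2 ^ β3 := by positivity
    gcongr
    norm_num

theorem sum_pow_le_of_injOn {ι : Type*} (B : Finset ι) (f : ι → ℕ) (hf : Set.InjOn f B) {M : ℕ}
    (hM : ∀ b ∈ B, f b < M) {w : ℝ} (hw : 1 < w) :
    ∑ b ∈ B, w ^ f b ≤ w ^ M / (w - 1) := by
  classical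
  have hw0 : 0 < w := by linarith
  calc ∑ b ∈ B, w ^ f b = ∑ c ∈ B.image f, w ^ c := (Finset.sum_image hf).symm
    _ ≤ ∑ c ∈ Finset.range M, w ^ c := by
        apply Finset.sum_le_sum_of_subset_of_nonneg
        · intro c hc
          obtain ⟨b, hb, rfl⟩ := Finset.mem_image.mp hc
          exact Finset.mem_range.mpr (hM b hb)
        · intros
          positivity
    _ = (w ^ M - 1) / (w - 1) := geom_sum_eq hw.ne' M
    _ ≤ _ := by
        have : 0 < w - 1 := by linarith
        gcongr
        linarith

theorem exists_sixth_root_two : ∃ w : ℝ, 11 / 10 < w ∧ w ^ 6 = 2 := by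
  refine ⟨(2 : ℝ) ^ (1 / 6 : ℝ), ?_, ?_⟩
  · apply lt_of_pow_lt_pow_left₀ 6 (by positivity)
    rw [← Real.rpow_natCast, ← Real.rpow_natCast, ← Real.rpow_mul (by norm_num)]
    norm_num
  · rw [← Real.rpow_natCast, ← Real.rpow_mul (by norm_num)]
    norm_num

theorem sum_admissible_exponents_le (R : Finset ℕ) (α1 α2 α3 K : ℕ) {w : ℝ} (hw1 : 11 / 10 < w)
    (hw : w ^ 6 = 2) :
    ∑ β3 ∈ R, ∑ β1 ∈ R, ∑ β2 ∈ R,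
      (if α1 + α2 + α3 + (α3 + 2 * β3) < K ∧ α1 + 2 * β1 ≤ α3 + 2 * β3 + 2 ∧
          α3 + 2 * β3 ≤ α1 + 2 * β1 + 3 ∧ α2 + 2 * β2 ≤ α1 + 2 * β1 + 2 then
        w ^ (3 * (α1 + α2 + α3) + 2 * (α3 + 2 * β3) + (α2 + 2 * β2)) else 0) ≤
      480 * w ^ (3 * K) := by
  have hw0 : 0 < w := by linarith
  have h3 : 1331 / 1000 < w ^ 3 := by
    have := pow_lt_pow_left₀ hw1 (by norm_num) three_ne_zero
    norm_num at this ⊢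
    exact this
  set s := α1 + α2 + α3 with hs
  have hβ2 : ∀ q : ℕ, ∑ β2 ∈ R with α2 + 2 * β2 < q + 6, w ^ (α2 + 2 * β2) ≤ 20 * w ^ q := by
    intro q
    refine (sum_pow_le_of_injOn _ (fun β2 => α2 + 2 * β2) (fun a _ b _ h => ?_) (M := q + 6)
      (fun b hb => (Finset.mem_filter.mp hb).2) (by linarith)).trans ?_
    · simp only at h
      omega
    · rw [div_le_iff₀ (by linarith), pow_add, hw]
      have := pow_pos hw0 q
      nlinarith
  have hβ1 : ∀ q : ℕ, ((R.filter fun β1 => α1 + 2 * β1 ≤ q + 2 ∧ q ≤ α1 + 2 * β1 + 3).card : ℝ) ≤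
      6 := by
    intro q
    have : (R.filter fun β1 => α1 + 2 * β1 ≤ q + 2 ∧ q ≤ α1 + 2 * β1 + 3).card ≤
        (Finset.Icc (q - 3) (q + 2)).card := by
      apply Finset.card_le_card_of_injOn (fun β1 => α1 + 2 * β1)
      · intro b hb
        have := (Finset.mem_filter.mp hb).2
        simp only [Finset.coe_Icc, Set.mem_Icc]
        omega
      · intro a _ b _ h
        simp only at h
        omega
    rw [Nat.card_Icc] at this
    exact_mod_cast this.trans (by omega)
  calc _ ≤ ∑ β3 ∈ R, (if s + (α3 + 2 * β3) < K then
        120 * (w ^ (3 * s) * (w ^ 3) ^ (α3 + 2 * β3)) else 0) := by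
        refine Finset.sum_le_sum fun β3 _ => ?_
        set q := α3 + 2 * β3 with hq
        split_ifs with hK
        · calc _ ≤ ∑ β1 ∈ R, (if α1 + 2 * β1 ≤ q + 2 ∧ q ≤ α1 + 2 * β1 + 3 then
                w ^ (3 * s + 2 * q) * (20 * w ^ q) else 0) := by
                refine Finset.sum_le_sum fun β1 _ => ?_
                split_ifs with h1
                · calc _ ≤ ∑ β2 ∈ R, (if α2 + 2 * β2 < q + 6 then
                        w ^ (3 * s + 2 * q) * w ^ (α2 + 2 * β2) else 0) := by
                        refine Finset.sum_le_sum fun β2 _ => ?_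
                        split_ifs with h2 h3 h3
                        · rw [pow_add]
                        · omega
                        · positivity
                        · exact le_rfl
                    _ ≤ _ := by
                        rw [← Finset.sum_filter, ← Finset.mul_sum]
                        exact mul_le_mul_of_nonneg_left (hβ2 q) (by positivity)
                · refine (Finset.sum_eq_zero fun β2 _ => ?_).le
                  rw [if_neg]
                  tauto
            _ ≤ 6 * (w ^ (3 * s + 2 * q) * (20 * w ^ q)) := by
                rw [← Finset.sum_filter, Finset.sum_const, nsmul_eq_mul]
                exact mul_le_mul_of_nonneg_right (hβ1 q) (by positivity)
            _ = _ := by ring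
        · refine (Finset.sum_eq_zero fun β1 _ => Finset.sum_eq_zero fun β2 _ => ?_).le
          rw [if_neg]
          tauto
    _ = 120 * w ^ (3 * s) * ∑ β3 ∈ R with s + (α3 + 2 * β3) < K, (w ^ 3) ^ (α3 + 2 * β3) := by
        rw [← Finset.sum_filter, Finset.mul_sum]
        exact Finset.sum_congr rfl fun _ _ => by ring
    _ ≤ _ := by
        by_cases hK : s ≤ K
        · have h := sum_pow_le_of_injOn (R.filter fun β3 => s + (α3 + 2 * β3) < K)
            (fun β3 => α3 + 2 * β3) (fun a _ b _ h => by simp only at h; omega) (M := K - s)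
            (fun b hb => by have := (Finset.mem_filter.mp hb).2; omega) (w := w ^ 3)
            (by linarith)
          have h4 : (w ^ 3) ^ (K - s) / (w ^ 3 - 1) ≤ 4 * (w ^ 3) ^ (K - s) := by
            rw [div_le_iff₀ (by linarith)]
            have : 0 < (w ^ 3) ^ (K - s) := by positivity
            nlinarith
          calc _ ≤ 120 * w ^ (3 * s) * (4 * (w ^ 3) ^ (K - s)) :=
                mul_le_mul_of_nonneg_left (h.trans h4) (by positivity)
            _ = 480 * (w ^ (3 * s) * w ^ (3 * (K - s))) := by rw [← pow_mul]; ring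
            _ = _ := by rw [← pow_add]; congr 2; omega
        · rw [Finset.filter_false_of_mem fun β3 _ => by omega]
          simp only [Finset.sum_empty, mul_zero]
          positivity

theorem log_two_mul_two_pow_le (β : ℕ) : log (2 * 2 ^ β) ≤ β + 1 := by
  rw [← pow_succ', log_pow]
  push_cast
  have := Real.log_two_lt_d9
  have : (0 : ℝ) ≤ β := Nat.cast_nonneg β
  nlinarith

/-- Upper bound for the number of positive primitive solutions of bounded height. -/
theorem card_conicPoint_le (S : Finset ConicPoint) {K : ℕ} (hK : 0 < K)
    (hS : ∀ t ∈ S, t.a1 * t.a2 * t.a3 * (t.a3 * t.b3 ^ 2) < 2 ^ K) :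
    (S.card : ℝ) ≤ 10 ^ 11 * (√(2 ^ K) * K ^ 3) := by
  classical
  obtain ⟨w, hw1, hw⟩ := exists_sixth_root_two
  have hw0 : 0 < w := by linarith
  set R := Finset.range (K + 3) with hR
  set δ : ℕ → ℝ := fun x => if x = 0 then 1 else 0 with hδ
  have hδ0 : ∀ x, 0 ≤ δ x := fun x => by
    simp only [hδ]
    split_ifs <;> norm_num
  set Λ : ℕ → ℕ → ℕ → ℝ := fun x y z => 1 + (K + 3) * (δ x * δ y + δ x * δ z + δ y * δ z) with hΛ
  have hΛ1 : ∀ x y z, 1 ≤ Λ x y z := by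
    intro x y z
    have : 0 ≤ (K + 3 : ℝ) * (δ x * δ y + δ x * δ z + δ y * δ z) := by
      have := hδ0 x
      have := hδ0 y
      have := hδ0 z
      positivity
    simp only [hΛ]
    linarith
  set key : ConicPoint → ℕ × ℕ × ℕ × ℕ × ℕ × ℕ := fun t => (Nat.log 2 t.a1, Nat.log 2 t.a2,
    Nat.log 2 t.a3, Nat.log 2 t.b3, Nat.log 2 t.b1, Nat.log 2 t.b2) with hkey
  have hlog : ∀ {a : ℕ}, 0 < a → 2 ^ Nat.log 2 a ≤ a ∧ a < 2 * 2 ^ Nat.log 2 a := by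
    intro a ha
    refine ⟨Nat.pow_log_le_self 2 ha.ne', ?_⟩
    rw [← pow_succ']
    exact Nat.lt_pow_succ_log_self (by norm_num) a
  have hbox : ∀ t : ConicPoint, t.InBox (2 ^ Nat.log 2 t.a1) (2 ^ Nat.log 2 t.a2)
      (2 ^ Nat.log 2 t.a3) (2 ^ Nat.log 2 t.b1) (2 ^ Nat.log 2 t.b2) (2 ^ Nat.log 2 t.b3) :=
    fun t => ⟨hlog t.a1_pos, hlog t.a2_pos, hlog t.a3_pos, hlog t.b1_pos, hlog t.b2_pos,
      hlog t.b3_pos⟩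
  have hsum : ∀ t ∈ S, Nat.log 2 t.a1 + Nat.log 2 t.a2 + Nat.log 2 t.a3 +
      (Nat.log 2 t.a3 + 2 * Nat.log 2 t.b3) < K := by
    intro t ht
    have hb := hbox t
    apply (Nat.pow_lt_pow_iff_right (a := 2) (by norm_num)).mp
    refine lt_of_le_of_lt ?_ (hS t ht)
    calc 2 ^ (Nat.log 2 t.a1 + Nat.log 2 t.a2 + Nat.log 2 t.a3 +
          (Nat.log 2 t.a3 + 2 * Nat.log 2 t.b3))
        = 2 ^ Nat.log 2 t.a1 * 2 ^ Nat.log 2 t.a2 * 2 ^ Nat.log 2 t.a3 *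
          (2 ^ Nat.log 2 t.a3 * (2 ^ Nat.log 2 t.b3) ^ 2) := by ring
      _ ≤ _ := Nat.mul_le_mul (Nat.mul_le_mul (Nat.mul_le_mul hb.x1.1 hb.x2.1) hb.x3.1)
        (Nat.mul_le_mul hb.x3.1 (Nat.pow_le_pow_left hb.y3.1 2))
  have hcard : S.card = ∑ k ∈ R ×ˢ R ×ˢ R ×ˢ R ×ˢ R ×ˢ R, (S.filter fun t => key t = k).card := by
    refine Finset.card_eq_sum_card_fiberwise fun t ht => ?_
    have h1 := hsum t ht
    obtain ⟨h2, h3, h4⟩ := (hbox t).exponents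
    rw [Finset.mem_coe]
    simp only [hkey, hR, Finset.mem_product, Finset.mem_range]
    omega
  have hfib : ∀ α1 ∈ R, ∀ α2 ∈ R, ∀ α3 ∈ R, ∀ β3 ∈ R, ∀ β1 ∈ R, ∀ β2 ∈ R,
      ((S.filter fun t => key t = (α1, α2, α3, β3, β1, β2)).card : ℝ) ≤
      668200 * Λ α1 α2 α3 * (if α1 + α2 + α3 + (α3 + 2 * β3) < K ∧
          α1 + 2 * β1 ≤ α3 + 2 * β3 + 2 ∧
          α3 + 2 * β3 ≤ α1 + 2 * β1 + 3 ∧ α2 + 2 * β2 ≤ α1 + 2 * β1 + 2 then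
        w ^ (3 * (α1 + α2 + α3) + 2 * (α3 + 2 * β3) + (α2 + 2 * β2)) else 0) := by
    intro α1 _ α2 _ α3 _ β3 hβ3 β1 hβ1 β2 hβ2
    have hΛp := hΛ1 α1 α2 α3
    rcases (S.filter fun t => key t = (α1, α2, α3, β3, β1, β2)).eq_empty_or_nonempty with h | h
    · rw [h]
      simp only [Finset.card_empty, Nat.cast_zero]
      split_ifs <;> positivity
    have hmem : ∀ t ∈ S.filter fun t => key t = (α1, α2, α3, β3, β1, β2),
        t.InBox (2 ^ α1) (2 ^ α2) (2 ^ α3) (2 ^ β1) (2 ^ β2) (2 ^ β3) ∧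
        α1 + α2 + α3 + (α3 + 2 * β3) < K := by
      intro t ht
      obtain ⟨htS, e⟩ := Finset.mem_filter.mp ht
      simp only [hkey, Prod.mk.injEq] at e
      obtain ⟨rfl, rfl, rfl, rfl, rfl, rfl⟩ := e
      exact ⟨hbox t, hsum t htS⟩
    obtain ⟨t0, ht0⟩ := h
    obtain ⟨h2, h3, h4⟩ := (hmem t0 ht0).1.exponents
    rw [if_pos ⟨(hmem t0 ht0).2, h2, h3, h4⟩]
    have hl : ∀ β ∈ R, 1 + log (2 * 2 ^ β) ≤ 1 + (K + 3) := by
      intro β hβ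
      have := log_two_mul_two_pow_le β
      have : (β : ℝ) + 1 ≤ K + 3 := by
        exact_mod_cast Finset.mem_range.mp hβ
      linarith
    have hbig : ∀ x : ℝ, 1 ≤ x → 1 + (K + 3 : ℝ) ≤ 1 + (K + 3) * x := fun x hx => by
      have : (0 : ℝ) ≤ K := Nat.cast_nonneg K
      nlinarith
    have hδ00 : δ 0 = 1 := by simp [hδ]
    rw [mul_assoc]
    refine card_dyadic_le _ (fun t ht => (hmem t ht).1) (by linarith) hw hΛp ?_ ?_ ?_ h2 h3 h4
    · rintro rfl rfl
      refine (hl β1 hβ1).trans (hbig _ ?_)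
      rw [hδ00]
      linarith [hδ0 α1]
    · rintro rfl rfl
      refine (hl β2 hβ2).trans (hbig _ ?_)
      rw [hδ00]
      linarith [hδ0 α2]
    · rintro rfl rfl
      refine (hl β3 hβ3).trans (hbig _ ?_)
      rw [hδ00]
      linarith [hδ0 α3]
  have hK1 : (1 : ℝ) ≤ K := by exact_mod_cast hK
  have hΛsum : ∑ α1 ∈ R, ∑ α2 ∈ R, ∑ α3 ∈ R, Λ α1 α2 α3 ≤ 256 * K ^ 3 := by
    have h1 : ∑ x ∈ R, δ x = 1 := by simp [hδ, hR]
    have hRc : R.card = K + 3 := Finset.card_range _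
    have h2 : ∑ α1 ∈ R, ∑ α2 ∈ R, ∑ α3 ∈ R, Λ α1 α2 α3 = (K + 3) ^ 3 + 3 * (K + 3) ^ 2 := by
      simp only [hΛ, Finset.sum_add_distrib, ← Finset.mul_sum, ← Finset.sum_mul, Finset.sum_const,
        h1, nsmul_eq_mul, hRc]
      push_cast
      ring
    rw [h2]
    have h3 : (K + 3 : ℝ) ≤ 4 * K := by linarith
    have h4 : (3 : ℝ) ≤ K + 3 := by linarith
    have h5 : (K + 3 : ℝ) ^ 3 ≤ (4 * K) ^ 3 := by gcongr
    nlinarith [sq_nonneg (K + 3 : ℝ)]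
  have hw3 : w ^ (3 * K) = √(2 ^ K) := by
    rw [eq_comm, Real.sqrt_eq_iff_mul_self_eq (by positivity) (by positivity), ← hw]
    ring
  calc (S.card : ℝ) ≤ ∑ α1 ∈ R, ∑ α2 ∈ R, ∑ α3 ∈ R, 668200 * Λ α1 α2 α3 * (480 * w ^ (3 * K)) := by
        rw [hcard]
        push_cast
        simp only [Finset.sum_product]
        refine Finset.sum_le_sum fun α1 h1 => Finset.sum_le_sum fun α2 h2 =>
          Finset.sum_le_sum fun α3 h3 => ?_
        have := sum_admissible_exponents_le R α1 α2 α3 K hw1 hw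
        have hΛp := hΛ1 α1 α2 α3
        refine le_trans ?_ (mul_le_mul_of_nonneg_left this (by positivity))
        simp only [Finset.mul_sum]
        exact Finset.sum_le_sum fun β3 h4 => Finset.sum_le_sum fun β1 h5 =>
          Finset.sum_le_sum fun β2 h6 => hfib α1 h1 α2 h2 α3 h3 β3 h4 β1 h5 β2 h6
    _ = 668200 * 480 * w ^ (3 * K) * ∑ α1 ∈ R, ∑ α2 ∈ R, ∑ α3 ∈ R, Λ α1 α2 α3 := by
        simp only [Finset.mul_sum]
        exact Finset.sum_congr rfl fun _ _ => Finset.sum_congr rfl fun _ _ =>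
          Finset.sum_congr rfl fun _ _ => by ring
    _ ≤ 668200 * 480 * w ^ (3 * K) * (256 * K ^ 3) :=
        mul_le_mul_of_nonneg_left hΛsum (by positivity)
    _ ≤ _ := by
        rw [hw3]
        have : 0 ≤ √(2 ^ K) * (K : ℝ) ^ 3 := by positivity
        linarith

theorem exists_conicPoint {x1 x2 x3 y1 y2 y3 : ℤ} (h1 : 0 < x1) (h2 : 0 < x2) (h3 : 0 < x3)
    (k1 : y1 ≠ 0) (k2 : y2 ≠ 0) (k3 : y3 ≠ 0) (g12 : Int.gcd x1 x2 = 1) (g13 : Int.gcd x1 x3 = 1)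
    (g23 : Int.gcd x2 x3 = 1) (e12 : Int.gcd y1 y2 = 1) (e13 : Int.gcd y1 y3 = 1)
    (e23 : Int.gcd y2 y3 = 1) (s1 : Squarefree x1) (s2 : Squarefree x2) (s3 : Squarefree x3)
    (e : x1 * y1 ^ 2 + x2 * y2 ^ 2 = x3 * y3 ^ 2) (l : x2 * y2 ^ 2 ≤ x1 * y1 ^ 2) :
    ∃ t : ConicPoint, (t.a1 : ℤ) = x1 ∧ (t.a2 : ℤ) = x2 ∧ (t.a3 : ℤ) = x3 ∧
      t.b1 = y1.natAbs ∧ t.b2 = y2.natAbs ∧ t.b3 = y3.natAbs := by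
  lift x1 to ℕ using h1.le
  lift x2 to ℕ using h2.le
  lift x3 to ℕ using h3.le
  refine ⟨⟨x1, x2, x3, y1.natAbs, y2.natAbs, y3.natAbs, Int.natAbs_pos.mpr k1,
    Int.natAbs_pos.mpr k2, Int.natAbs_pos.mpr k3, Int.squarefree_natCast.mp s1,
    Int.squarefree_natCast.mp s2, Int.squarefree_natCast.mp s3, g12, g13, g23, e12, e13, e23,
    ?_, ?_⟩, rfl, rfl, rfl, rfl, rfl, rfl⟩
  · zify
    simpa only [sq_abs] using e
  · zify
    simpa only [sq_abs] using l

theorem exists_unit_mul_natAbs (y : ℤ) : ∃ s : ℤˣ, (s : ℤ) * y.natAbs = y := by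
  rcases Int.natAbs_eq y with h | h
  · exact ⟨1, by rw [Units.val_one, one_mul]; exact h.symm⟩
  · exact ⟨-1, by rw [Units.val_neg, Units.val_one, neg_one_mul]; exact h.symm⟩

/-- The integral solutions attached to a positive one, up to signs and rearrangement. -/
def ConicPoint.toTuple (w : ConicPoint × ℤˣ × ℤˣ × ℤˣ × Fin 3) : ℤ × ℤ × ℤ × ℤ × ℤ × ℤ :=
  match w with
  | (t, r, s, u, 0) => (t.a1, t.a2, t.a3, r * t.b1, s * t.b2, u * t.b3)
  | (t, r, s, u, 1) => (t.a3, -t.a2, t.a1, r * t.b3, s * t.b2, u * t.b1)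
  | (t, r, s, u, 2) => (t.a3, -t.a1, t.a2, r * t.b3, s * t.b1, u * t.b2)

theorem StackyCounted.exists_toTuple {T : ℝ} {x1 x2 x3 y1 y2 y3 : ℤ}
    (h : StackyCounted T x1 x2 x3 y1 y2 y3) :
    ∃ w : ConicPoint × ℤˣ × ℤˣ × ℤˣ × Fin 3,
      ((w.1.a1 * w.1.a2 * w.1.a3 * (w.1.a3 * w.1.b3 ^ 2) : ℕ) : ℝ) ≤ 2 * T ∧
      ConicPoint.toTuple w = (x1, x2, x3, y1, y2, y3) := by
  obtain ⟨-, h2, h3, k1, k2, k3, g12, g13, g23, e12, e13, e23, s1, s2, s3, e, h1, l, ht⟩ := h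
  have hy1 : 0 < y1 ^ 2 := by positivity
  have hy2 : 0 < y2 ^ 2 := by positivity
  have hy3 : 0 < y3 ^ 2 := by positivity
  have l' := abs_le.mp l
  have h3' : 0 < x3 := by
    rcases lt_or_gt_of_ne h3 with h | h
    · nlinarith
    · exact h
  obtain ⟨r, hr⟩ := exists_unit_mul_natAbs y1
  obtain ⟨s, hs⟩ := exists_unit_mul_natAbs y2
  obtain ⟨u, hu⟩ := exists_unit_mul_natAbs y3
  have key : ∀ {n : ℕ} {z : ℤ}, (n : ℤ) ≤ 2 * z → z = |(x1 * y1) ^ 2 * x2 * x3| →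
      (n : ℝ) ≤ 2 * T := by
    intro n z h hz
    have h' : ((n : ℤ) : ℝ) ≤ ((2 * z : ℤ) : ℝ) := Int.cast_le.mpr h
    rw [← hz] at ht
    push_cast at h'
    linarith
  rcases lt_or_gt_of_ne h2 with h2 | h2
  · have habs : |(x1 * y1) ^ 2 * x2 * x3| = x1 * (-x2) * x3 * (x1 * y1 ^ 2) := by
      rw [abs_of_nonpos]
      · ring
      · have : 0 ≤ (x1 * y1) ^ 2 * (-x2) * x3 := by
          have : 0 < -x2 := by linarith
          positivity
        linarith
    have hpos : 0 ≤ x1 * (-x2) * x3 * (x1 * y1 ^ 2) := habs ▸ abs_nonneg _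
    have s2' : Squarefree (-x2) := by
      rw [← Int.squarefree_natAbs, Int.natAbs_neg, Int.squarefree_natAbs]
      exact s2
    rcases le_total (-x2 * y2 ^ 2) (x3 * y3 ^ 2) with hle | hle
    · obtain ⟨t, t1, t2, t3, t4, t5, t6⟩ := exists_conicPoint h3' (by linarith : 0 < -x2) h1 k3 k2
        k1 (by rw [Int.gcd_neg, Int.gcd_comm]; exact g23) (by rw [Int.gcd_comm]; exact g13)
        (by rw [Int.neg_gcd, Int.gcd_comm]; exact g12) (by rw [Int.gcd_comm]; exact e23)
        (by rw [Int.gcd_comm]; exact e13) (by rw [Int.gcd_comm]; exact e12) s3 s2' s1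
        (by linarith) hle
      refine ⟨(t, r, s, u, 1), key ?_ habs.symm, ?_⟩
      · push_cast
        rw [t1, t2, t3, t6, Int.natCast_natAbs, sq_abs]
        linarith
      · simp only [ConicPoint.toTuple, t1, t2, t3, t4, t5, t6, hr, hs, hu, neg_neg]
    · obtain ⟨t, t1, t2, t3, t4, t5, t6⟩ := exists_conicPoint (by linarith : 0 < -x2) h3' h1 k2 k3
        k1 (by rw [Int.neg_gcd]; exact g23) (by rw [Int.neg_gcd, Int.gcd_comm]; exact g12)
        (by rw [Int.gcd_comm]; exact g13) e23
        (by rw [Int.gcd_comm]; exact e12) (by rw [Int.gcd_comm]; exact e13) s2' s3 s1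
        (by linarith) hle
      refine ⟨(t, r, s, u, 2), key ?_ habs.symm, ?_⟩
      · push_cast
        rw [t1, t2, t3, t6, Int.natCast_natAbs, sq_abs]
        linarith
      · simp only [ConicPoint.toTuple, t1, t2, t3, t4, t5, t6, hr, hs, hu, neg_neg]
  · have habs : |(x1 * y1) ^ 2 * x2 * x3| = x1 * x2 * x3 * (x1 * y1 ^ 2) := by
      rw [abs_of_nonneg (by positivity)]
      ring
    obtain ⟨t, t1, t2, t3, t4, t5, t6⟩ := exists_conicPoint h1 h2 h3' k1 k2 k3 g12 g13 g23 e12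
      e13 e23 s1 s2 s3 e l'.2
    refine ⟨(t, r, s, u, 0), key ?_ habs.symm, ?_⟩
    · push_cast
      rw [t1, t2, t3, t6, Int.natCast_natAbs, sq_abs]
      have : 0 < x1 * x2 * x3 := by positivity
      nlinarith
    · simp only [ConicPoint.toTuple, t1, t2, t3, t4, t5, t6, hr, hs, hu]

theorem finite_conicPoint_and_ncard_le {T : ℝ} (hT : 2 ≤ T) :
    {t : ConicPoint | ((t.a1 * t.a2 * t.a3 * (t.a3 * t.b3 ^ 2) : ℕ) : ℝ) ≤ 2 * T}.Finite ∧
    ({t : ConicPoint | ((t.a1 * t.a2 * t.a3 * (t.a3 * t.b3 ^ 2) : ℕ) : ℝ) ≤ 2 * T}.ncard : ℝ) ≤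
      25 * 10 ^ 12 * (√T * log T ^ 3) := by
  set P := {t : ConicPoint | ((t.a1 * t.a2 * t.a3 * (t.a3 * t.b3 ^ 2) : ℕ) : ℝ) ≤ 2 * T} with hP
  set K := Nat.log 2 ⌊2 * T⌋₊ + 1 with hK
  have hfl : ⌊2 * T⌋₊ ≠ 0 := (Nat.floor_pos.mpr (by linarith)).ne'
  have h2K : (2 : ℝ) ^ K ≤ 4 * T := by
    have h1 : ((2 ^ Nat.log 2 ⌊2 * T⌋₊ : ℕ) : ℝ) ≤ ⌊2 * T⌋₊ :=
      Nat.cast_le.mpr (Nat.pow_log_le_self 2 hfl)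
    have h2 := Nat.floor_le (by linarith : 0 ≤ 2 * T)
    push_cast at h1
    rw [hK, pow_succ]
    linarith
  have hsqrt : √(2 ^ K) ≤ 2 * √T := by
    rw [show 2 * √T = √(4 * T) by
      rw [Real.sqrt_mul (by norm_num), show (4 : ℝ) = 2 ^ 2 by norm_num,
        Real.sqrt_sq (by norm_num)]]
    exact Real.sqrt_le_sqrt h2K
  have hlogT : log 2 ≤ log T := Real.log_le_log (by norm_num) hT
  have hKlog : (K : ℝ) ≤ 5 * log T := by
    have h1 := Real.log_le_log (by positivity) h2K
    rw [Real.log_pow, Real.log_mul (by norm_num) (by linarith),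
      show (4 : ℝ) = 2 ^ 2 by norm_num, Real.log_pow] at h1
    push_cast at h1
    have := Real.log_two_gt_d9
    have : (0 : ℝ) ≤ K := Nat.cast_nonneg K
    nlinarith
  have hlog0 : 0 ≤ log T := Real.log_nonneg (by linarith)
  have hfin : ∀ S : Finset ConicPoint, (S : Set ConicPoint) ⊆ P →
      (S.card : ℝ) ≤ 25 * 10 ^ 12 * (√T * log T ^ 3) := by
    intro S hS
    have h := card_conicPoint_le S (K := K) (Nat.succ_pos _) fun t ht => by
      have h1 : _ ≤ ⌊2 * T⌋₊ := Nat.le_floor (hS ht)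
      exact lt_of_le_of_lt h1 (Nat.lt_pow_succ_log_self (by norm_num) _)
    calc (S.card : ℝ) ≤ _ := h
      _ ≤ 10 ^ 11 * ((2 * √T) * (5 * log T) ^ 3) := by gcongr
      _ = _ := by ring
  have hPf : P.Finite := by
    by_contra hinf
    obtain ⟨S, hS, hc⟩ := Set.Infinite.exists_subset_card_eq hinf
      (⌊25 * 10 ^ 12 * (√T * log T ^ 3)⌋₊ + 1)
    have h1 := hfin S hS
    have h2 := Nat.lt_floor_add_one (25 * 10 ^ 12 * (√T * log T ^ 3))
    rw [hc] at h1
    push_cast at h1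
    linarith
  refine ⟨hPf, ?_⟩
  rw [Set.ncard_eq_toFinset_card P hPf]
  exact hfin _ (by simp)

theorem stackyN_upper_bound {T : ℝ} (hT : 2 ≤ T) :
    {v : ℤ × ℤ × ℤ × ℤ × ℤ × ℤ |
      StackyCounted T v.1 v.2.1 v.2.2.1 v.2.2.2.1 v.2.2.2.2.1 v.2.2.2.2.2}.Finite ∧
    (stackyN T : ℝ) ≤ 6 * 10 ^ 14 * (√T * log T ^ 3) := by
  obtain ⟨hf, hc⟩ := finite_conicPoint_and_ncard_le hT
  set P := {t : ConicPoint | ((t.a1 * t.a2 * t.a3 * (t.a3 * t.b3 ^ 2) : ℕ) : ℝ) ≤ 2 * T} with hP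
  have hsub : {v : ℤ × ℤ × ℤ × ℤ × ℤ × ℤ |
      StackyCounted T v.1 v.2.1 v.2.2.1 v.2.2.2.1 v.2.2.2.2.1 v.2.2.2.2.2} ⊆
      ConicPoint.toTuple '' (P ×ˢ (Set.univ : Set (ℤˣ × ℤˣ × ℤˣ × Fin 3))) := by
    intro v hv
    obtain ⟨w, h1, h2⟩ := StackyCounted.exists_toTuple hv
    exact ⟨w, ⟨h1, Set.mem_univ _⟩, h2⟩
  have hfin : (P ×ˢ (Set.univ : Set (ℤˣ × ℤˣ × ℤˣ × Fin 3))).Finite := hf.prod Set.finite_univ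
  refine ⟨(hfin.image _).subset hsub, ?_⟩
  have h1 := (Set.ncard_le_ncard hsub (hfin.image _)).trans (Set.ncard_image_le hfin)
  rw [Set.ncard_prod, Set.ncard_univ, Nat.card_eq_fintype_card] at h1
  have h2 : Fintype.card (ℤˣ × ℤˣ × ℤˣ × Fin 3) = 24 := by
    rfl
  rw [h2] at h1
  have h3 : (stackyN T : ℝ) ≤ P.ncard * 24 := by exact_mod_cast h1
  linarith

theorem le_card_of_residue {q : ℕ} (hq : 0 < q) (S : Finset ℤ) (a L : ℝ) (v : ℤ)
    (hS : ∀ x : ℤ, a < x → x ≤ a + L → (q : ℤ) ∣ x - v → x ∈ S) : L / q - 1 ≤ S.card := by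
  have hq' : (0 : ℝ) < q := by exact_mod_cast hq
  set I := Finset.Ioc ⌊(a - v) / q⌋ ⌊(a + L - v) / q⌋ with hI
  have h1 : I.card ≤ S.card := by
    apply Finset.card_le_card_of_injOn (fun k => v + q * k)
    · intro k hk
      rw [Finset.mem_coe, hI, Finset.mem_Ioc, Int.floor_lt, Int.le_floor, div_lt_iff₀ hq',
        le_div_iff₀ hq'] at hk
      apply hS
      · push_cast
        linarith
      · push_cast
        linarith
      · exact ⟨k, by ring⟩
    · intro k _ k' _ h
      have h' : (q : ℤ) * k = q * k' := by simpa using h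
      exact mul_left_cancel₀ (by exact_mod_cast hq.ne') h'
  have h2 : (⌊(a + L - v) / q⌋ - ⌊(a - v) / q⌋ : ℤ) ≤ (I.card : ℤ) := by
    rw [hI, Int.card_Ioc]
    exact Int.self_le_toNat _
  have h3 : ((⌊(a + L - v) / q⌋ - ⌊(a - v) / q⌋ : ℤ) : ℝ) ≤ ((I.card : ℤ) : ℝ) :=
    Int.cast_le.mpr h2
  push_cast at h3
  have h4 := Int.lt_floor_add_one ((a + L - v) / q)
  have h5 := Int.floor_le ((a - v) / q)
  have h6 : (a + L - v) / q = (a - v) / q + L / q := by ring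
  have h7 : (I.card : ℝ) ≤ S.card := Nat.cast_le.mpr h1
  linarith

theorem card_le_of_dvd_sub_pairs (E : Finset (ℤ × ℤ)) {q1 q2 : ℕ} {a b L1 L2 : ℝ} (hq1 : 0 < q1)
    (hq2 : 0 < q2) (hL1 : 0 ≤ L1) (hL2 : 0 ≤ L2)
    (hE : ∀ x ∈ E, (a ≤ x.1 ∧ x.1 ≤ a + L1) ∧ (b ≤ x.2 ∧ x.2 ≤ b + L2))
    (h1 : ∀ x ∈ E, ∀ x' ∈ E, (q1 : ℤ) ∣ x.1 - x'.1)
    (h2 : ∀ x ∈ E, ∀ x' ∈ E, x.1 = x'.1 → (q2 : ℤ) ∣ x.2 - x'.2) :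
    (E.card : ℝ) ≤ (L1 / q1 + 1) * (L2 / q2 + 1) := by
  classical
  have hI : ((E.image Prod.fst).card : ℝ) ≤ L1 / q1 + 1 := by
    apply card_le_of_dvd_sub (E.image Prod.fst) id (a := a) hq1 hL1
    · intro x hx
      obtain ⟨e, he, rfl⟩ := Finset.mem_image.mp hx
      exact (hE e he).1
    · exact Function.injective_id.injOn
    · intro x hx x' hx'
      obtain ⟨e, he, rfl⟩ := Finset.mem_image.mp hx
      obtain ⟨e', he', rfl⟩ := Finset.mem_image.mp hx'
      exact h1 e he e' he'
  have hfib : ∀ k ∈ E.image Prod.fst, ((E.filter fun x => x.1 = k).card : ℝ) ≤ L2 / q2 + 1 := by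
    intro k _
    apply card_le_of_dvd_sub (E.filter fun x => x.1 = k) Prod.snd (a := b) hq2 hL2
    · intro x hx
      exact (hE x (Finset.mem_filter.mp hx).1).2
    · intro x hx x' hx' h
      exact Prod.ext ((Finset.mem_filter.mp hx).2.trans (Finset.mem_filter.mp hx').2.symm) h
    · intro x hx x' hx'
      exact h2 x (Finset.mem_filter.mp hx).1 x' (Finset.mem_filter.mp hx').1
        ((Finset.mem_filter.mp hx).2.trans (Finset.mem_filter.mp hx').2.symm)
  rw [Finset.card_eq_sum_card_image Prod.fst E]
  push_cast
  calc _ ≤ ∑ _k ∈ E.image Prod.fst, (L2 / q2 + 1) := Finset.sum_le_sum hfib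
    _ = (E.image Prod.fst).card * (L2 / q2 + 1) := by rw [Finset.sum_const, nsmul_eq_mul]
    _ ≤ _ := mul_le_mul_of_nonneg_right hI (by positivity)

/-- Pairwise coprime positive integers congruent to `1` modulo `W`. -/
structure UnitTriple (W y1 y2 y3 : ℕ) : Prop where
  pos1 : 0 < y1
  pos2 : 0 < y2
  pos3 : 0 < y3
  mod1 : (W : ℤ) ∣ y1 - 1
  mod2 : (W : ℤ) ∣ y2 - 1
  mod3 : (W : ℤ) ∣ y3 - 1
  cop12 : y1.Coprime y2
  cop13 : y1.Coprime y3
  cop23 : y2.Coprime y3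

/-- Pairs `(x₁, x₂)` in a box with `x₁ ≡ x₂ ≡ 1` modulo `W` and `y₃² ∣ x₁ y₁² + x₂ y₂²`. -/
noncomputable def latticePairs (W y1 y2 y3 : ℕ) (A : ℝ) : Finset (ℤ × ℤ) :=
  (Finset.Ioc ⌊A / y1 ^ 2⌋ ⌊A / y1 ^ 2 + A / y1 ^ 2⌋ ×ˢ
    Finset.Ioc ⌊A / (2 * y2 ^ 2)⌋ ⌊A / (2 * y2 ^ 2) + A / (2 * y2 ^ 2)⌋).filter fun x =>
      (W : ℤ) ∣ x.1 - 1 ∧ (W : ℤ) ∣ x.2 - 1 ∧ (y3 : ℤ) ^ 2 ∣ x.1 * y1 ^ 2 + x.2 * y2 ^ 2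

theorem isCoprime_of_dvd_sub_one {W : ℕ} {z : ℤ} (h : (W : ℤ) ∣ z - 1) : IsCoprime (W : ℤ) z := by
  obtain ⟨k, hk⟩ := h
  exact ⟨-k, 1, by linear_combination hk⟩

theorem mem_latticePairs {W y1 y2 y3 : ℕ} {A : ℝ} {x : ℤ × ℤ} :
    x ∈ latticePairs W y1 y2 y3 A ↔
      ((A / y1 ^ 2 < x.1 ∧ x.1 ≤ A / y1 ^ 2 + A / y1 ^ 2) ∧
        (A / (2 * y2 ^ 2) < x.2 ∧ x.2 ≤ A / (2 * y2 ^ 2) + A / (2 * y2 ^ 2))) ∧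
      (W : ℤ) ∣ x.1 - 1 ∧ (W : ℤ) ∣ x.2 - 1 ∧ (y3 : ℤ) ^ 2 ∣ x.1 * y1 ^ 2 + x.2 * y2 ^ 2 := by
  simp only [latticePairs, Finset.mem_filter, Finset.mem_product, Finset.mem_Ioc, Int.floor_lt,
    Int.le_floor]

section Lattice

variable {W y1 y2 y3 : ℕ} {A : ℝ}

theorem le_card_latticePairs (hW : 0 < W) (hy : UnitTriple W y1 y2 y3)
    (h : 1 ≤ A / (2 * W * y2 ^ 2 * y3 ^ 2)) :
    (A / (W * y1 ^ 2) - 1) * (A / (2 * W * y2 ^ 2 * y3 ^ 2) - 1) ≤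
      (latticePairs W y1 y2 y3 A).card := by
  classical
  set X := (Finset.Ioc ⌊A / (y1 : ℝ) ^ 2⌋ ⌊A / (y1 : ℝ) ^ 2 + A / y1 ^ 2⌋).filter fun x =>
    (W : ℤ) ∣ x - 1 with hX
  have hXc : A / (W * y1 ^ 2) - 1 ≤ X.card := by
    have := le_card_of_residue hW X (A / y1 ^ 2) (A / y1 ^ 2) 1 fun x l u h => by
      rw [hX, Finset.mem_filter, Finset.mem_Ioc, Int.floor_lt, Int.le_floor]
      exact ⟨⟨l, u⟩, h⟩
    rwa [div_div, mul_comm] at this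
  have hfib : ∀ x1 ∈ X, A / (2 * W * y2 ^ 2 * y3 ^ 2) - 1 ≤
      (((latticePairs W y1 y2 y3 A).filter fun x => x.1 = x1).card : ℝ) := by
    intro x1 hx1
    rw [hX, Finset.mem_filter, Finset.mem_Ioc, Int.floor_lt, Int.le_floor] at hx1
    have hc1 : IsCoprime (W : ℤ) ((y3 : ℤ) ^ 2) := (isCoprime_of_dvd_sub_one hy.mod3).pow_right
    have hc2 : IsCoprime ((y2 : ℤ) ^ 2) ((y3 : ℤ) ^ 2) :=
      (Nat.isCoprime_iff_coprime.mpr hy.cop23).pow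
    obtain ⟨r, s, hrs⟩ := hc1.mul_left hc2
    have hpos : 0 < W * y3 ^ 2 := Nat.mul_pos hW (pow_pos hy.pos3 2)
    have := le_card_of_residue hpos
      (((latticePairs W y1 y2 y3 A).filter fun x => x.1 = x1).image Prod.snd)
      (A / (2 * y2 ^ 2)) (A / (2 * y2 ^ 2)) (1 - W * (r * (x1 * y1 ^ 2 + y2 ^ 2)))
      fun x l u h => by
        push_cast at h
        obtain ⟨k, hk⟩ := h
        refine Finset.mem_image.mpr ⟨(x1, x), Finset.mem_filter.mpr ⟨mem_latticePairs.mpr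
          ⟨⟨hx1.1, l, u⟩, hx1.2, ?_, ?_⟩, rfl⟩, rfl⟩
        · exact ⟨y3 ^ 2 * k - r * (x1 * y1 ^ 2 + y2 ^ 2), by linear_combination hk⟩
        · exact ⟨s * (x1 * y1 ^ 2 + y2 ^ 2) + W * k * y2 ^ 2, by
            linear_combination (y2 : ℤ) ^ 2 * hk - (x1 * y1 ^ 2 + y2 ^ 2) * hrs⟩
    have h3 := Finset.card_image_le
      (s := (latticePairs W y1 y2 y3 A).filter fun x => x.1 = x1) (f := Prod.snd)
    have h4 : A / (2 * W * y2 ^ 2 * y3 ^ 2) =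
        A / (2 * y2 ^ 2) / ((W * y3 ^ 2 : ℕ) : ℝ) := by
      rw [div_div]
      push_cast
      congr 1
      ring
    rw [h4]
    exact this.trans (Nat.cast_le.mpr h3)
  have hcard : (latticePairs W y1 y2 y3 A).card =
      ∑ x1 ∈ X, ((latticePairs W y1 y2 y3 A).filter fun x => x.1 = x1).card :=
    Finset.card_eq_sum_card_fiberwise fun x hx => by
      have := mem_latticePairs.mp hx
      rw [hX, Finset.mem_coe, Finset.mem_filter, Finset.mem_Ioc, Int.floor_lt, Int.le_floor]
      exact ⟨this.1.1, this.2.1⟩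
  rw [hcard]
  push_cast
  calc _ ≤ X.card * (A / (2 * W * y2 ^ 2 * y3 ^ 2) - 1) :=
        mul_le_mul_of_nonneg_right hXc (by linarith)
    _ = ∑ x1 ∈ X, (A / (2 * W * y2 ^ 2 * y3 ^ 2) - 1) := by rw [Finset.sum_const, nsmul_eq_mul]
    _ ≤ _ := Finset.sum_le_sum hfib

theorem card_latticePairs_subset_le (hW : 0 < W) (hy : UnitTriple W y1 y2 y3) (hA : 0 ≤ A)
    (E : Finset (ℤ × ℤ)) (hE : E ⊆ latticePairs W y1 y2 y3 A) {d1 d2 : ℕ} (hd1 : 0 < d1)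
    (hd2 : 0 < d2) (hc1 : W.Coprime d1) (hc2 : W.Coprime d2) (h1 : ∀ x ∈ E, (d1 : ℤ) ∣ x.1)
    (h2 : ∀ x ∈ E, ∀ x' ∈ E, x.1 = x'.1 → (d2 : ℤ) * y3 ^ 2 ∣ x.2 - x'.2) :
    (E.card : ℝ) ≤ (A / (W * y1 ^ 2) / d1 + 1) * (A / (2 * W * y2 ^ 2 * y3 ^ 2) / d2 + 1) := by
  have hm := fun x (hx : x ∈ E) => mem_latticePairs.mp (hE hx)
  have hq2 : 0 < W * (d2 * y3 ^ 2) := Nat.mul_pos hW (Nat.mul_pos hd2 (pow_pos hy.pos3 2))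
  have := card_le_of_dvd_sub_pairs E (Nat.mul_pos hW hd1) hq2 (a := A / y1 ^ 2)
    (b := A / (2 * y2 ^ 2)) (L1 := A / y1 ^ 2) (L2 := A / (2 * y2 ^ 2)) (by positivity)
    (by positivity)
    (fun x hx => ⟨⟨(hm x hx).1.1.1.le, (hm x hx).1.1.2⟩, (hm x hx).1.2.1.le, (hm x hx).1.2.2⟩)
    (by
      intro x hx x' hx'
      push_cast
      apply IsCoprime.mul_dvd (Nat.isCoprime_iff_coprime.mpr hc1)
      · rw [show x.1 - x'.1 = (x.1 - 1) - (x'.1 - 1) by ring]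
        exact dvd_sub (hm x hx).2.1 (hm x' hx').2.1
      · exact dvd_sub (h1 x hx) (h1 x' hx'))
    (by
      intro x hx x' hx' e
      push_cast
      apply IsCoprime.mul_dvd
      · exact (Nat.isCoprime_iff_coprime.mpr hc2).mul_right
          (isCoprime_of_dvd_sub_one hy.mod3).pow_right
      · rw [show x.2 - x'.2 = (x.2 - 1) - (x'.2 - 1) by ring]
        exact dvd_sub (hm x hx).2.2.1 (hm x' hx').2.2.1
      · exact h2 x hx x' hx' e)
  refine this.trans (le_of_eq ?_)
  simp only [div_div]
  push_cast
  congr 3 <;> ring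

/-- Two second coordinates over the same first coordinate agree modulo `y₃²`, and modulo `d y₃²`
if `d` divides both of them. -/
theorem dvd_snd_sub_of_dvd (hy : UnitTriple W y1 y2 y3) {x x' : ℤ × ℤ}
    (hx : x ∈ latticePairs W y1 y2 y3 A) (hx' : x' ∈ latticePairs W y1 y2 y3 A) (e : x.1 = x'.1)
    {d : ℕ} (hd : d.Coprime y3) (h : (d : ℤ) ∣ x.2) (h' : (d : ℤ) ∣ x'.2) :
    (d : ℤ) * y3 ^ 2 ∣ x.2 - x'.2 := by
  apply IsCoprime.mul_dvd (Nat.isCoprime_iff_coprime.mpr hd).pow_right (dvd_sub h h')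
  have h1 := dvd_sub (mem_latticePairs.mp hx).2.2.2 (mem_latticePairs.mp hx').2.2.2
  rw [e, show x'.1 * (y1 : ℤ) ^ 2 + x.2 * y2 ^ 2 - (x'.1 * y1 ^ 2 + x'.2 * y2 ^ 2) =
    (x.2 - x'.2) * y2 ^ 2 by ring] at h1
  exact IsCoprime.dvd_of_dvd_mul_right (Nat.isCoprime_iff_coprime.mpr hy.cop23.symm).pow h1

theorem dvd_snd_sub_of_mul_dvd (hy : UnitTriple W y1 y2 y3) {x x' : ℤ × ℤ} (e : x.1 = x'.1)
    {d : ℕ} (hd : d.Coprime y2) (h : (d : ℤ) * y3 ^ 2 ∣ x.1 * y1 ^ 2 + x.2 * y2 ^ 2)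
    (h' : (d : ℤ) * y3 ^ 2 ∣ x'.1 * y1 ^ 2 + x'.2 * y2 ^ 2) :
    (d : ℤ) * y3 ^ 2 ∣ x.2 - x'.2 := by
  have h1 := dvd_sub h h'
  rw [e, show x'.1 * (y1 : ℤ) ^ 2 + x.2 * y2 ^ 2 - (x'.1 * y1 ^ 2 + x'.2 * y2 ^ 2) =
    (x.2 - x'.2) * y2 ^ 2 by ring] at h1
  refine IsCoprime.dvd_of_dvd_mul_right (IsCoprime.mul_left ?_ ?_) h1
  · exact (Nat.isCoprime_iff_coprime.mpr hd).pow_right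
  · exact (Nat.isCoprime_iff_coprime.mpr hy.cop23.symm).pow

end Lattice

theorem exists_prime_sq_dvd_of_not_squarefree {x : ℤ} (h : ¬Squarefree x) :
    ∃ p : ℕ, p.Prime ∧ (p : ℤ) ^ 2 ∣ x := by
  rw [← Int.squarefree_natAbs, Nat.squarefree_iff_prime_squarefree] at h
  push Not at h
  obtain ⟨p, hp, hd⟩ := h
  refine ⟨p, hp, ?_⟩
  rw [← Int.dvd_natAbs, sq]
  exact_mod_cast hd

theorem exists_prime_dvd_of_gcd_ne_one {x z : ℤ} (h : Int.gcd x z ≠ 1) :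
    ∃ p : ℕ, p.Prime ∧ (p : ℤ) ∣ x ∧ (p : ℤ) ∣ z := by
  obtain ⟨p, hp, hd⟩ := Nat.exists_prime_and_dvd h
  have hd' : (p : ℤ) ∣ Int.gcd x z := by exact_mod_cast hd
  exact ⟨p, hp, hd'.trans (Int.gcd_dvd_left _ _), hd'.trans (Int.gcd_dvd_right _ _)⟩

/-- The `xᵢ` are squarefree and pairwise coprime. -/
def SqfreeTriple (x1 x2 x3 : ℤ) : Prop :=
  (Squarefree x1 ∧ Squarefree x2 ∧ Squarefree x3) ∧
    Int.gcd x1 x2 = 1 ∧ Int.gcd x1 x3 = 1 ∧ Int.gcd x2 x3 = 1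

theorem exists_prime_of_not_sqfreeTriple {W y1 y2 y3 : ℕ} (hW : 4 ∣ W)
    (hy : UnitTriple W y1 y2 y3) {x1 x2 x3 : ℤ} (h1 : (W : ℤ) ∣ x1 - 1) (h2 : (W : ℤ) ∣ x2 - 1)
    (e : x1 * y1 ^ 2 + x2 * y2 ^ 2 = x3 * y3 ^ 2) (h : ¬SqfreeTriple x1 x2 x3) :
    ∃ p : ℕ, p.Prime ∧ ¬p ∣ W ∧
      ((p : ℤ) ^ 2 ∣ x1 ∨ (¬p ∣ y3 ∧ (p : ℤ) ^ 2 ∣ x2) ∨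
        (¬p ∣ y2 ∧ (p : ℤ) ^ 2 * y3 ^ 2 ∣ x1 * y1 ^ 2 + x2 * y2 ^ 2) ∨
        (¬p ∣ y3 ∧ (p : ℤ) ∣ x1 ∧ (p : ℤ) ∣ x2) ∨ (p ∣ y2 * y3 ∧ (p : ℤ) ∣ x1) ∨
        (p ∣ y1 ∧ (p : ℤ) ∣ x2)) := by
  have hunit : ∀ {p : ℕ} {x : ℤ}, p.Prime → (W : ℤ) ∣ x - 1 → (p : ℤ) ∣ x → ¬p ∣ W := by
    intro p x hp hx hpx hpW
    have hc := isCoprime_of_dvd_sub_one hx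
    have := hc.isUnit_of_dvd' (Int.natCast_dvd_natCast.mpr hpW) hpx
    exact (Nat.prime_iff_prime_int.mp hp).not_isUnit this
  have hcop : ∀ {p a b : ℕ}, p.Prime → a.Coprime b → p ∣ a → p ∣ b → False := by
    intro p a b hp hc ha hb
    exact Nat.not_coprime_of_dvd_of_dvd hp.one_lt ha hb hc
  have hsplit : ∀ {p y : ℕ} {x : ℤ}, p.Prime → (p : ℤ) ∣ x * (y : ℤ) ^ 2 → (p : ℤ) ∣ x ∨ p ∣ y := by
    intro p y x hp hd
    have hpi := Nat.prime_iff_prime_int.mp hp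
    rcases hpi.dvd_or_dvd hd with h | h
    · exact Or.inl h
    · exact Or.inr (Int.natCast_dvd_natCast.mp (hpi.dvd_of_dvd_pow h))
  have hcast : ∀ {p y : ℕ} {x : ℤ}, p ∣ y → (p : ℤ) ∣ x * (y : ℤ) ^ 2 := fun h =>
    ((Int.natCast_dvd_natCast.mpr h).pow two_ne_zero).mul_left _
  by_cases s1 : Squarefree x1
  swap
  · obtain ⟨p, hp, hd⟩ := exists_prime_sq_dvd_of_not_squarefree s1
    exact ⟨p, hp, hunit hp h1 ((dvd_pow_self _ two_ne_zero).trans hd), Or.inl hd⟩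
  by_cases s2 : Squarefree x2
  swap
  · obtain ⟨p, hp, hd⟩ := exists_prime_sq_dvd_of_not_squarefree s2
    have hd' : (p : ℤ) ∣ x2 := (dvd_pow_self _ two_ne_zero).trans hd
    refine ⟨p, hp, hunit hp h2 hd', ?_⟩
    by_cases h3 : p ∣ y3
    · have : (p : ℤ) ∣ x1 * y1 ^ 2 := by
        rw [show x1 * (y1 : ℤ) ^ 2 = x3 * y3 ^ 2 - x2 * y2 ^ 2 by linarith]
        exact dvd_sub (hcast h3) (hd'.mul_right _)
      rcases hsplit hp this with h | h
      · exact Or.inr (Or.inr (Or.inr (Or.inr (Or.inl ⟨h3.mul_left _, h⟩))))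
      · exact absurd h3 fun h3 => hcop hp hy.cop13 h h3
    · exact Or.inr (Or.inl ⟨h3, hd⟩)
  have hx3 : (W : ℤ) ∣ x3 - 2 := by
    obtain ⟨a, ha⟩ := h1
    obtain ⟨b, hb⟩ := h2
    obtain ⟨c, hc⟩ := hy.mod1
    obtain ⟨d, hd⟩ := hy.mod2
    obtain ⟨k, hk⟩ := hy.mod3
    refine ⟨a * y1 ^ 2 + c * (y1 + 1) + b * y2 ^ 2 + d * (y2 + 1) - x3 * k * (y3 + 1), ?_⟩
    linear_combination (y1 : ℤ) ^ 2 * ha + (y1 + 1 : ℤ) * hc + (y2 : ℤ) ^ 2 * hb +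
      (y2 + 1 : ℤ) * hd - x3 * (y3 + 1) * hk - e
  by_cases s3 : Squarefree x3
  swap
  · obtain ⟨p, hp, hd⟩ := exists_prime_sq_dvd_of_not_squarefree s3
    have hd' : (p : ℤ) ∣ x3 := (dvd_pow_self _ two_ne_zero).trans hd
    have hpW : ¬p ∣ W := by
      intro hpW
      have hp2 : (p : ℤ) ∣ 2 := by
        rw [show (2 : ℤ) = x3 - (x3 - 2) by ring]
        exact dvd_sub hd' ((Int.natCast_dvd_natCast.mpr hpW).trans hx3)
      obtain rfl : p = 2 := (Nat.prime_dvd_prime_iff_eq hp Nat.prime_two).mp (by exact_mod_cast hp2)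
      have h4 : (4 : ℤ) ∣ x3 - 2 := (by exact_mod_cast hW : (4 : ℤ) ∣ W).trans hx3
      have h4' : (4 : ℤ) ∣ x3 := by
        have : ((2 : ℕ) : ℤ) ^ 2 = 4 := by norm_num
        rwa [this] at hd
      omega
    refine ⟨p, hp, hpW, ?_⟩
    by_cases h3 : p ∣ y2
    · have : (p : ℤ) ∣ x1 * y1 ^ 2 := by
        rw [show x1 * (y1 : ℤ) ^ 2 = x3 * y3 ^ 2 - x2 * y2 ^ 2 by linarith]
        exact dvd_sub (hd'.mul_right _) (hcast h3)
      rcases hsplit hp this with h | h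
      · exact Or.inr (Or.inr (Or.inr (Or.inr (Or.inl ⟨h3.mul_right _, h⟩))))
      · exact absurd h3 fun h3 => hcop hp hy.cop12 h h3
    · refine Or.inr (Or.inr (Or.inl ⟨h3, ?_⟩))
      rw [e]
      exact mul_dvd_mul_right hd _
  have hboth : ∀ p : ℕ, p.Prime → (p : ℤ) ∣ x1 → (p : ℤ) ∣ x2 →
      (¬p ∣ y3 ∧ (p : ℤ) ∣ x1 ∧ (p : ℤ) ∣ x2) ∨ (p ∣ y2 * y3 ∧ (p : ℤ) ∣ x1) := by
    intro p _ hd1 hd2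
    by_cases h3 : p ∣ y3
    · exact Or.inr ⟨h3.mul_left _, hd1⟩
    · exact Or.inl ⟨h3, hd1, hd2⟩
  by_cases g12 : Int.gcd x1 x2 = 1
  swap
  · obtain ⟨p, hp, hd1, hd2⟩ := exists_prime_dvd_of_gcd_ne_one g12
    refine ⟨p, hp, hunit hp h1 hd1, ?_⟩
    have := hboth p hp hd1 hd2
    tauto
  by_cases g13 : Int.gcd x1 x3 = 1
  swap
  · obtain ⟨p, hp, hd1, hd3⟩ := exists_prime_dvd_of_gcd_ne_one g13
    refine ⟨p, hp, hunit hp h1 hd1, ?_⟩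
    have : (p : ℤ) ∣ x2 * y2 ^ 2 := by
      rw [show x2 * (y2 : ℤ) ^ 2 = x3 * y3 ^ 2 - x1 * y1 ^ 2 by linarith]
      exact dvd_sub (hd3.mul_right _) (hd1.mul_right _)
    rcases hsplit hp this with h | h
    · have := hboth p hp hd1 h
      tauto
    · exact Or.inr (Or.inr (Or.inr (Or.inr (Or.inl ⟨h.mul_right _, hd1⟩))))
  by_cases g23 : Int.gcd x2 x3 = 1
  swap
  · obtain ⟨p, hp, hd2, hd3⟩ := exists_prime_dvd_of_gcd_ne_one g23
    refine ⟨p, hp, hunit hp h2 hd2, ?_⟩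
    have : (p : ℤ) ∣ x1 * y1 ^ 2 := by
      rw [show x1 * (y1 : ℤ) ^ 2 = x3 * y3 ^ 2 - x2 * y2 ^ 2 by linarith]
      exact dvd_sub (hd3.mul_right _) (hd2.mul_right _)
    rcases hsplit hp this with h | h
    · have := hboth p hp h hd2
      tauto
    · exact Or.inr (Or.inr (Or.inr (Or.inr (Or.inr ⟨h, hd2⟩))))
  exact absurd ⟨⟨s1, s2, s3⟩, g12, g13, g23⟩ h

/-- The sum of the reciprocals of the prime divisors of `y`. -/
noncomputable def primeRecipSum (y : ℕ) : ℝ := ∑ p ∈ y.primeFactors, (p : ℝ)⁻¹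

theorem sum_Ioc_inv_sq_le_inv {k : ℕ} (hk : k ≠ 0) (n : ℕ) :
    ∑ p ∈ Finset.Ioc k n, ((p : ℝ) ^ 2)⁻¹ ≤ (k : ℝ)⁻¹ := by
  rcases le_total k n with h | h
  · have := sum_Ioc_inv_sq_le_sub (α := ℝ) hk h
    have h0 : (0 : ℝ) ≤ (n : ℝ)⁻¹ := by positivity
    linarith
  · rw [Finset.Ioc_eq_empty_of_le h]
    simp

theorem sum_Ioc_inv_le {k : ℕ} (n : ℕ) : ∑ p ∈ Finset.Ioc k n, (p : ℝ)⁻¹ ≤ 1 + log n := by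
  have h := harmonic_le_one_add_log n
  rw [harmonic_eq_sum_Icc] at h
  push_cast at h
  refine le_trans (Finset.sum_le_sum_of_subset_of_nonneg ?_ fun _ _ _ => by positivity) h
  intro p hp
  rw [Finset.mem_Ioc] at hp
  exact Finset.mem_Icc.mpr ⟨by omega, hp.2⟩

theorem primeRecipSum_mul {a b : ℕ} (h : a.Coprime b) :
    primeRecipSum (a * b) = primeRecipSum a + primeRecipSum b := by
  rw [primeRecipSum, h.primeFactors_mul, Finset.sum_union h.disjoint_primeFactors]
  rfl

theorem card_primeFactors_le (n : ℕ) : n.primeFactors.card ≤ n := by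
  have : n.primeFactors ⊆ Finset.Icc 1 n := fun p hp =>
    Finset.mem_Icc.mpr ⟨(Nat.prime_of_mem_primeFactors hp).pos, Nat.le_of_mem_primeFactors hp⟩
  simpa using Finset.card_le_card this

theorem card_biUnion_le_of_bound {α : Type*} [DecidableEq α] {P : Finset ℕ} {E : ℕ → Finset α}
    {f : ℕ → ℝ} {c : ℝ} (h : ∀ p ∈ P, ((E p).card : ℝ) ≤ f p + c) :
    ((P.biUnion E).card : ℝ) ≤ ∑ p ∈ P, f p + P.card * c := by
  calc ((P.biUnion E).card : ℝ) ≤ ((∑ p ∈ P, (E p).card : ℕ) : ℝ) :=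
        Nat.cast_le.mpr Finset.card_biUnion_le
    _ ≤ ∑ p ∈ P, (f p + c) := by
        push_cast
        exact Finset.sum_le_sum h
    _ = _ := by rw [Finset.sum_add_distrib, Finset.sum_const, nsmul_eq_mul]

section Lattice

variable {W y1 y2 y3 : ℕ} {A : ℝ}

theorem bounds_of_mem_latticePairs (hy : UnitTriple W y1 y2 y3) (hA : 0 < A) {x : ℤ × ℤ}
    (hx : x ∈ latticePairs W y1 y2 y3 A) :
    (0 < x.1 ∧ 0 < x.2) ∧ A < x.1 * y1 ^ 2 ∧ (x.1 : ℝ) * y1 ^ 2 ≤ 2 * A ∧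
      (x.2 : ℝ) * y2 ^ 2 ≤ A ∧ (x.1 : ℝ) ≤ 2 * A ∧ (x.2 : ℝ) ≤ A := by
  obtain ⟨⟨⟨l1, u1⟩, l2, u2⟩, -⟩ := mem_latticePairs.mp hx
  have hy1 : (1 : ℝ) ≤ y1 := by exact_mod_cast hy.pos1
  have hy2 : (1 : ℝ) ≤ y2 := by exact_mod_cast hy.pos2
  have p1 : (0 : ℝ) < x.1 := lt_of_le_of_lt (by positivity) l1
  have p2 : (0 : ℝ) < x.2 := lt_of_le_of_lt (by positivity) l2
  have hs1 : (1 : ℝ) ≤ y1 ^ 2 := one_le_pow₀ hy1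
  have hs2 : (1 : ℝ) ≤ y2 ^ 2 := one_le_pow₀ hy2
  rw [div_lt_iff₀ (by positivity)] at l1
  rw [← add_div, le_div_iff₀ (by positivity)] at u1
  rw [← add_div, le_div_iff₀ (by positivity)] at u2
  have u2' : (x.2 : ℝ) * y2 ^ 2 ≤ A := by linarith
  refine ⟨⟨by exact_mod_cast p1, by exact_mod_cast p2⟩, l1, by linarith, u2', ?_, ?_⟩
  · nlinarith
  · nlinarith

theorem exists_prime_of_mem_latticePairs (hW : 4 ∣ W) (hy : UnitTriple W y1 y2 y3) (hA : 0 < A)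
    {x : ℤ × ℤ} (hx : x ∈ latticePairs W y1 y2 y3 A) {x3 : ℤ}
    (e : x.1 * y1 ^ 2 + x.2 * y2 ^ 2 = x3 * y3 ^ 2) (h : ¬SqfreeTriple x.1 x.2 x3) :
    ∃ p : ℕ, p.Prime ∧ ¬p ∣ W ∧
      ((p ≤ ⌊√(3 * A)⌋₊ ∧ ((p : ℤ) ^ 2 ∣ x.1 ∨ (¬p ∣ y3 ∧ (p : ℤ) ^ 2 ∣ x.2) ∨
        (¬p ∣ y2 ∧ (p : ℤ) ^ 2 * y3 ^ 2 ∣ x.1 * y1 ^ 2 + x.2 * y2 ^ 2))) ∨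
        (p ≤ ⌊2 * A⌋₊ ∧ ¬p ∣ y3 ∧ (p : ℤ) ∣ x.1 ∧ (p : ℤ) ∣ x.2) ∨
        (p ∈ (y2 * y3).primeFactors ∧ (p : ℤ) ∣ x.1) ∨ (p ∈ y1.primeFactors ∧ (p : ℤ) ∣ x.2)) := by
  obtain ⟨⟨q1, q2⟩, b1, b2, b3, b4, b5⟩ := bounds_of_mem_latticePairs hy hA hx
  obtain ⟨p, hp, hpW, hc⟩ := exists_prime_of_not_sqfreeTriple hW hy
    (mem_latticePairs.mp hx).2.1 (mem_latticePairs.mp hx).2.2.1 e h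
  refine ⟨p, hp, hpW, ?_⟩
  have hQ : ∀ z : ℤ, 0 < z → (z : ℝ) ≤ 3 * A → (p : ℤ) ^ 2 ∣ z → p ≤ ⌊√(3 * A)⌋₊ := by
    intro z hz hz3 hd
    have h1 : (((p : ℤ) ^ 2 : ℤ) : ℝ) ≤ z := Int.cast_le.mpr (Int.le_of_dvd hz hd)
    push_cast at h1
    exact Nat.le_floor (Real.le_sqrt_of_sq_le (by linarith))
  have hy1 := hy.pos1
  have hy2 := hy.pos2
  have hy3 := hy.pos3
  rcases hc with h | h | h | h | h | h
  · exact Or.inl ⟨hQ _ q1 (by linarith) h, Or.inl h⟩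
  · exact Or.inl ⟨hQ _ q2 (by linarith) h.2, Or.inr (Or.inl h)⟩
  · refine Or.inl ⟨hQ (x.1 * y1 ^ 2 + x.2 * y2 ^ 2) (by positivity) ?_
      ((dvd_mul_right _ _).trans h.2), Or.inr (Or.inr h)⟩
    push_cast
    linarith
  · refine Or.inr (Or.inl ⟨?_, h⟩)
    have h1 : ((p : ℤ) : ℝ) ≤ x.1 := Int.cast_le.mpr (Int.le_of_dvd q1 h.2.1)
    push_cast at h1
    exact Nat.le_floor (by linarith)
  · exact Or.inr (Or.inr (Or.inl ⟨Nat.mem_primeFactors.mpr ⟨hp, h.1, by positivity⟩, h.2⟩))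
  · exact Or.inr (Or.inr (Or.inr ⟨Nat.mem_primeFactors.mpr ⟨hp, h.1, by positivity⟩, h.2⟩))

theorem mul_add_one_le_of_le {L M A : ℝ} (hL : 0 ≤ L) (hLA : L ≤ A) (hMA : M ≤ A)
    (hA : 1 ≤ A) {d : ℕ} (hd : 0 < d) : (L / d + 1) * (M + 1) ≤ L * M * (d : ℝ)⁻¹ + 3 * A := by
  have : L / d ≤ L := div_le_self hL (by exact_mod_cast hd)
  have e : L * M * (d : ℝ)⁻¹ = L / d * M := by rw [div_eq_mul_inv]; ring
  rw [e]
  linarith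

theorem mul_add_one_le_of_le' {L M A : ℝ} (hLA : L ≤ A) (hMA : M ≤ A)
    {d : ℕ} : (L / d + 1) * (M / d + 1) ≤
      (L * M * ((d : ℝ) ^ 2)⁻¹ + 2 * A * (d : ℝ)⁻¹) + 1 := by
  have h1 : L * (d : ℝ)⁻¹ ≤ A * (d : ℝ)⁻¹ := by gcongr
  have h2 : M * (d : ℝ)⁻¹ ≤ A * (d : ℝ)⁻¹ := by gcongr
  have e : (L / d + 1) * (M / d + 1) =
      L * M * ((d : ℝ) ^ 2)⁻¹ + L * (d : ℝ)⁻¹ + M * (d : ℝ)⁻¹ + 1 := by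
    rw [div_eq_mul_inv, div_eq_mul_inv, ← inv_pow]
    ring
  rw [e]
  linarith

set_option maxHeartbeats 1000000 in
theorem le_card_filter_sqfreeTriple (hW : 4 ∣ W) (hW0 : 0 < W)
    (hWp : ∀ p : ℕ, p.Prime → ¬p ∣ W → 20 < p) (hy : UnitTriple W y1 y2 y3) (hA : 1 ≤ A)
    (hA1 : (y1 : ℝ) ≤ √A) (hA2 : ((y2 * y3 : ℕ) : ℝ) ≤ √A)
    (hM : 1 ≤ A / (2 * W * y2 ^ 2 * y3 ^ 2)) {G : Finset (ℤ × ℤ)}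
    (hG : ∀ x ∈ latticePairs W y1 y2 y3 A, ∀ x3 : ℤ,
      x.1 * y1 ^ 2 + x.2 * y2 ^ 2 = x3 * y3 ^ 2 → SqfreeTriple x.1 x.2 x3 → x ∈ G) :
    A / (W * y1 ^ 2) * (A / (2 * W * y2 ^ 2 * y3 ^ 2)) *
      (4 / 5 - primeRecipSum y1 - primeRecipSum y2 - primeRecipSum y3) - 32 * (A * √A) ≤
      G.card := by
  classical
  set L := A / (W * y1 ^ 2) with hL
  set M := A / (2 * W * y2 ^ 2 * y3 ^ 2) with hMdef
  set Ω := latticePairs W y1 y2 y3 A with hΩ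
  have hA0 : 0 < A := by linarith
  have hy1 : (1 : ℝ) ≤ y1 := by exact_mod_cast hy.pos1
  have hy2 : (1 : ℝ) ≤ y2 := by exact_mod_cast hy.pos2
  have hy3 : (1 : ℝ) ≤ y3 := by exact_mod_cast hy.pos3
  have hWr : (1 : ℝ) ≤ W := by exact_mod_cast hW0
  have hL0 : 0 ≤ L := by positivity
  have hM0 : 0 ≤ M := by positivity
  have hLA : L ≤ A := div_le_self hA0.le (one_le_mul_of_one_le_of_one_le hWr (one_le_pow₀ hy1))
  have hMA : M ≤ A := by
    apply div_le_self hA0.le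
    apply one_le_mul_of_one_le_of_one_le _ (one_le_pow₀ hy3)
    apply one_le_mul_of_one_le_of_one_le _ (one_le_pow₀ hy2)
    linarith
  have hs1 : 1 ≤ √A := Real.one_le_sqrt.mpr hA
  have hss : √A * √A = A := Real.mul_self_sqrt hA0.le
  set P1 := (Finset.Ioc 20 ⌊√(3 * A)⌋₊).filter fun p => p.Prime ∧ ¬p ∣ W with hP1
  set P2 := (Finset.Ioc 20 ⌊2 * A⌋₊).filter fun p => p.Prime ∧ ¬p ∣ W with hP2
  set P3 := (y2 * y3).primeFactors.filter fun p => ¬p ∣ W with hP3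
  set P4 := y1.primeFactors.filter fun p => ¬p ∣ W with hP4
  set Ea : ℕ → Finset (ℤ × ℤ) := fun p => Ω.filter fun x => (p : ℤ) ^ 2 ∣ x.1 with hEa
  set Eb : ℕ → Finset (ℤ × ℤ) := fun p => Ω.filter fun x => ¬p ∣ y3 ∧ (p : ℤ) ^ 2 ∣ x.2 with hEb
  set Ec : ℕ → Finset (ℤ × ℤ) := fun p => Ω.filter fun x =>
    ¬p ∣ y2 ∧ (p : ℤ) ^ 2 * y3 ^ 2 ∣ x.1 * y1 ^ 2 + x.2 * y2 ^ 2 with hEc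
  set Ed : ℕ → Finset (ℤ × ℤ) := fun p => Ω.filter fun x =>
    ¬p ∣ y3 ∧ (p : ℤ) ∣ x.1 ∧ (p : ℤ) ∣ x.2 with hEd
  set Ee : ℕ → Finset (ℤ × ℤ) := fun p => Ω.filter fun x => (p : ℤ) ∣ x.1 with hEe
  set Ef : ℕ → Finset (ℤ × ℤ) := fun p => Ω.filter fun x => (p : ℤ) ∣ x.2 with hEf
  have hcov : Ω ⊆ G ∪ (P1.biUnion Ea ∪ P1.biUnion Eb ∪ P1.biUnion Ec ∪ P2.biUnion Ed ∪
      P3.biUnion Ee ∪ P4.biUnion Ef) := by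
    intro x hx
    by_cases hxG : x ∈ G
    · exact Finset.mem_union_left _ hxG
    apply Finset.mem_union_right
    obtain ⟨x3, hx3⟩ := (mem_latticePairs.mp hx).2.2.2
    replace hx3 := hx3.trans (mul_comm _ _)
    obtain ⟨p, hp, hpW, hc⟩ := exists_prime_of_mem_latticePairs hW hy hA0 hx hx3
      fun h => hxG (hG x hx x3 hx3 h)
    have h20 := hWp p hp hpW
    simp only [Finset.mem_union, Finset.mem_biUnion]
    rcases hc with ⟨hle, h | h | h⟩ | ⟨hle, h⟩ | ⟨hm, h⟩ | ⟨hm, h⟩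
    · exact Or.inl (Or.inl (Or.inl (Or.inl (Or.inl ⟨p, Finset.mem_filter.mpr
        ⟨Finset.mem_Ioc.mpr ⟨h20, hle⟩, hp, hpW⟩, Finset.mem_filter.mpr ⟨hx, h⟩⟩))))
    · exact Or.inl (Or.inl (Or.inl (Or.inl (Or.inr ⟨p, Finset.mem_filter.mpr
        ⟨Finset.mem_Ioc.mpr ⟨h20, hle⟩, hp, hpW⟩, Finset.mem_filter.mpr ⟨hx, h⟩⟩))))
    · exact Or.inl (Or.inl (Or.inl (Or.inr ⟨p, Finset.mem_filter.mpr
        ⟨Finset.mem_Ioc.mpr ⟨h20, hle⟩, hp, hpW⟩, Finset.mem_filter.mpr ⟨hx, h⟩⟩)))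
    · exact Or.inl (Or.inl (Or.inr ⟨p, Finset.mem_filter.mpr
        ⟨Finset.mem_Ioc.mpr ⟨h20, hle⟩, hp, hpW⟩, Finset.mem_filter.mpr ⟨hx, h⟩⟩))
    · exact Or.inl (Or.inr ⟨p, Finset.mem_filter.mpr ⟨hm, hpW⟩, Finset.mem_filter.mpr ⟨hx, h⟩⟩)
    · exact Or.inr ⟨p, Finset.mem_filter.mpr ⟨hm, hpW⟩, Finset.mem_filter.mpr ⟨hx, h⟩⟩
  have hcopW : ∀ {p : ℕ}, p.Prime → ¬p ∣ W → W.Coprime p := fun hp h =>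
    ((Nat.Prime.coprime_iff_not_dvd hp).mpr h).symm
  have base : ∀ (E : Finset (ℤ × ℤ)), E ⊆ Ω → ∀ x ∈ E, ∀ x' ∈ E, x.1 = x'.1 →
      ((1 : ℕ) : ℤ) * y3 ^ 2 ∣ x.2 - x'.2 := fun E hE x hx x' hx' e =>
    dvd_snd_sub_of_dvd hy (hE hx) (hE hx') e (Nat.coprime_one_left _) (by simp) (by simp)
  have ba : ∀ p ∈ P1, ((Ea p).card : ℝ) ≤ L * M * ((p : ℝ) ^ 2)⁻¹ + 3 * A := by
    intro p hp
    obtain ⟨-, hp, hpW⟩ := Finset.mem_filter.mp hp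
    have h := card_latticePairs_subset_le hW0 hy hA0.le (Ea p) (Finset.filter_subset _ _)
      (pow_pos hp.pos 2) one_pos ((hcopW hp hpW).pow_right 2) (Nat.coprime_one_right _)
      (fun x hx => by exact_mod_cast (Finset.mem_filter.mp hx).2)
      (base (Ea p) (Finset.filter_subset _ _))
    rw [Nat.cast_one, div_one] at h
    exact_mod_cast h.trans (mul_add_one_le_of_le hL0 hLA hMA hA (pow_pos hp.pos 2))
  have bb : ∀ p ∈ P1, ((Eb p).card : ℝ) ≤ L * M * ((p : ℝ) ^ 2)⁻¹ + 3 * A := by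
    intro p hp
    obtain ⟨-, hp, hpW⟩ := Finset.mem_filter.mp hp
    have h := card_latticePairs_subset_le hW0 hy hA0.le (Eb p) (Finset.filter_subset _ _)
      one_pos (pow_pos hp.pos 2) (Nat.coprime_one_right _) ((hcopW hp hpW).pow_right 2)
      (fun x hx => by simp) fun x hx x' hx' e => by
        obtain ⟨m, hn, hd⟩ := Finset.mem_filter.mp hx
        obtain ⟨m', -, hd'⟩ := Finset.mem_filter.mp hx'
        exact dvd_snd_sub_of_dvd hy m m' e
          (((Nat.Prime.coprime_iff_not_dvd hp).mpr hn).pow_left 2)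
          (by exact_mod_cast hd) (by exact_mod_cast hd')
    rw [Nat.cast_one, div_one, mul_comm] at h
    rw [mul_comm L M]
    exact_mod_cast h.trans (mul_add_one_le_of_le hM0 hMA hLA hA (pow_pos hp.pos 2))
  have bc : ∀ p ∈ P1, ((Ec p).card : ℝ) ≤ L * M * ((p : ℝ) ^ 2)⁻¹ + 3 * A := by
    intro p hp
    obtain ⟨-, hp, hpW⟩ := Finset.mem_filter.mp hp
    have h := card_latticePairs_subset_le hW0 hy hA0.le (Ec p) (Finset.filter_subset _ _)
      one_pos (pow_pos hp.pos 2) (Nat.coprime_one_right _) ((hcopW hp hpW).pow_right 2)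
      (fun x hx => by simp) fun x hx x' hx' e => by
        obtain ⟨m, hn, hd⟩ := Finset.mem_filter.mp hx
        obtain ⟨m', -, hd'⟩ := Finset.mem_filter.mp hx'
        exact dvd_snd_sub_of_mul_dvd hy e
          (((Nat.Prime.coprime_iff_not_dvd hp).mpr hn).pow_left 2)
          (by exact_mod_cast hd) (by exact_mod_cast hd')
    rw [Nat.cast_one, div_one, mul_comm] at h
    rw [mul_comm L M]
    exact_mod_cast h.trans (mul_add_one_le_of_le hM0 hMA hLA hA (pow_pos hp.pos 2))
  have bd : ∀ p ∈ P2, ((Ed p).card : ℝ) ≤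
      (L * M * ((p : ℝ) ^ 2)⁻¹ + 2 * A * (p : ℝ)⁻¹) + 1 := by
    intro p hp
    obtain ⟨-, hp, hpW⟩ := Finset.mem_filter.mp hp
    have h := card_latticePairs_subset_le hW0 hy hA0.le (Ed p) (Finset.filter_subset _ _)
      hp.pos hp.pos (hcopW hp hpW) (hcopW hp hpW)
      (fun x hx => (Finset.mem_filter.mp hx).2.2.1) fun x hx x' hx' e => by
        obtain ⟨m, hn, -, hd⟩ := Finset.mem_filter.mp hx
        obtain ⟨m', -, -, hd'⟩ := Finset.mem_filter.mp hx'
        exact dvd_snd_sub_of_dvd hy m m' e ((Nat.Prime.coprime_iff_not_dvd hp).mpr hn) hd hd'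
    exact h.trans (mul_add_one_le_of_le' hLA hMA)
  have be : ∀ p ∈ P3, ((Ee p).card : ℝ) ≤ L * M * (p : ℝ)⁻¹ + 3 * A := by
    intro p hp
    obtain ⟨hp, hpW⟩ := Finset.mem_filter.mp hp
    replace hp := Nat.prime_of_mem_primeFactors hp
    have h := card_latticePairs_subset_le hW0 hy hA0.le (Ee p) (Finset.filter_subset _ _)
      hp.pos one_pos (hcopW hp hpW) (Nat.coprime_one_right _)
      (fun x hx => (Finset.mem_filter.mp hx).2) (base (Ee p) (Finset.filter_subset _ _))
    rw [Nat.cast_one, div_one] at h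
    exact h.trans (mul_add_one_le_of_le hL0 hLA hMA hA hp.pos)
  have bf : ∀ p ∈ P4, ((Ef p).card : ℝ) ≤ L * M * (p : ℝ)⁻¹ + 3 * A := by
    intro p hp
    obtain ⟨hp, hpW⟩ := Finset.mem_filter.mp hp
    have hp1 := Nat.dvd_of_mem_primeFactors hp
    replace hp := Nat.prime_of_mem_primeFactors hp
    have h := card_latticePairs_subset_le hW0 hy hA0.le (Ef p) (Finset.filter_subset _ _)
      one_pos hp.pos (Nat.coprime_one_right _) (hcopW hp hpW)
      (fun x hx => by simp) fun x hx x' hx' e => by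
        obtain ⟨m, hd⟩ := Finset.mem_filter.mp hx
        obtain ⟨m', hd'⟩ := Finset.mem_filter.mp hx'
        exact dvd_snd_sub_of_dvd hy m m' e (Nat.Coprime.coprime_dvd_left hp1 hy.cop13) hd hd'
    rw [Nat.cast_one, div_one, mul_comm] at h
    rw [mul_comm L M]
    exact h.trans (mul_add_one_le_of_le hM0 hMA hLA hA hp.pos)
  have hc1 : (P1.card : ℝ) ≤ 2 * √A := by
    have h1 : P1.card ≤ ⌊√(3 * A)⌋₊ := by
      refine (Finset.card_filter_le _ _).trans ?_
      rw [Nat.card_Ioc]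
      exact Nat.sub_le _ _
    have h2 := Nat.floor_le (Real.sqrt_nonneg (3 * A))
    have h3 : √(3 * A) ≤ 2 * √A := by
      rw [Real.sqrt_le_left (by positivity), mul_pow, sq √A, hss]
      linarith
    exact (Nat.cast_le.mpr h1).trans (h2.trans h3)
  have hc2 : (P2.card : ℝ) ≤ 2 * A := by
    have h1 : P2.card ≤ ⌊2 * A⌋₊ := by
      refine (Finset.card_filter_le _ _).trans ?_
      rw [Nat.card_Ioc]
      exact Nat.sub_le _ _
    exact (Nat.cast_le.mpr h1).trans (Nat.floor_le (by positivity))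
  have hc3 : (P3.card : ℝ) ≤ √A := by
    exact (Nat.cast_le.mpr ((Finset.card_filter_le _ _).trans (card_primeFactors_le _))).trans hA2
  have hc4 : (P4.card : ℝ) ≤ √A := by
    exact (Nat.cast_le.mpr ((Finset.card_filter_le _ _).trans (card_primeFactors_le _))).trans hA1
  have hLM : 0 ≤ L * M := mul_nonneg hL0 hM0
  have s1 : ∑ p ∈ P1, L * M * ((p : ℝ) ^ 2)⁻¹ ≤ L * M * (1 / 20) := by
    rw [← Finset.mul_sum]
    apply mul_le_mul_of_nonneg_left _ hLM
    refine (Finset.sum_le_sum_of_subset_of_nonneg (Finset.filter_subset _ _)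
      fun _ _ _ => by positivity).trans ((sum_Ioc_inv_sq_le_inv (by norm_num) _).trans ?_)
    norm_num
  have s2 : ∑ p ∈ P2, (L * M * ((p : ℝ) ^ 2)⁻¹ + 2 * A * (p : ℝ)⁻¹) ≤
      L * M * (1 / 20) + 2 * A * (2 * √A) := by
    rw [Finset.sum_add_distrib, ← Finset.mul_sum, ← Finset.mul_sum]
    apply add_le_add
    · apply mul_le_mul_of_nonneg_left _ hLM
      refine (Finset.sum_le_sum_of_subset_of_nonneg (Finset.filter_subset _ _)
        fun _ _ _ => by positivity).trans ((sum_Ioc_inv_sq_le_inv (by norm_num) _).trans ?_)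
      norm_num
    · apply mul_le_mul_of_nonneg_left _ (by positivity)
      refine (Finset.sum_le_sum_of_subset_of_nonneg (Finset.filter_subset _ _)
        fun _ _ _ => by positivity).trans ((sum_Ioc_inv_le _).trans ?_)
      have h1 : log (⌊2 * A⌋₊ : ℝ) ≤ log (2 * (√A * √A)) := by
        rw [hss]
        apply Real.log_le_log _ (Nat.floor_le (by positivity))
        exact_mod_cast Nat.floor_pos.mpr (by linarith)
      rw [Real.log_mul (by norm_num) (by positivity), Real.log_mul (by positivity)
        (by positivity)] at h1
      have h2 := Real.log_le_sub_one_of_pos (by positivity : 0 < √A)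
      have h3 := Real.log_two_lt_d9
      linarith
  have s3 : ∑ p ∈ P3, L * M * (p : ℝ)⁻¹ ≤ L * M * (primeRecipSum y2 + primeRecipSum y3) := by
    rw [← Finset.mul_sum, ← primeRecipSum_mul hy.cop23]
    exact mul_le_mul_of_nonneg_left (Finset.sum_le_sum_of_subset_of_nonneg
      (Finset.filter_subset _ _) fun _ _ _ => by positivity) hLM
  have s4 : ∑ p ∈ P4, L * M * (p : ℝ)⁻¹ ≤ L * M * primeRecipSum y1 := by
    rw [← Finset.mul_sum]
    exact mul_le_mul_of_nonneg_left (Finset.sum_le_sum_of_subset_of_nonneg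
      (Finset.filter_subset _ _) fun _ _ _ => by positivity) hLM
  have hlow := le_card_latticePairs hW0 hy hM
  have ta := card_biUnion_le_of_bound ba
  have tb := card_biUnion_le_of_bound bb
  have tc := card_biUnion_le_of_bound bc
  have td := card_biUnion_le_of_bound bd
  have te := card_biUnion_le_of_bound be
  have tf := card_biUnion_le_of_bound bf
  have hcard : (Ω.card : ℝ) ≤ G.card + ((P1.biUnion Ea).card + (P1.biUnion Eb).card +
      (P1.biUnion Ec).card + (P2.biUnion Ed).card + (P3.biUnion Ee).card +
      (P4.biUnion Ef).card) := by
    have := Finset.card_le_card hcov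
    have h1 := Finset.card_union_le G (P1.biUnion Ea ∪ P1.biUnion Eb ∪ P1.biUnion Ec ∪
      P2.biUnion Ed ∪ P3.biUnion Ee ∪ P4.biUnion Ef)
    have h2 := Finset.card_union_le (P1.biUnion Ea ∪ P1.biUnion Eb ∪ P1.biUnion Ec ∪
      P2.biUnion Ed ∪ P3.biUnion Ee) (P4.biUnion Ef)
    have h3 := Finset.card_union_le (P1.biUnion Ea ∪ P1.biUnion Eb ∪ P1.biUnion Ec ∪
      P2.biUnion Ed) (P3.biUnion Ee)
    have h4 := Finset.card_union_le (P1.biUnion Ea ∪ P1.biUnion Eb ∪ P1.biUnion Ec)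
      (P2.biUnion Ed)
    have h5 := Finset.card_union_le (P1.biUnion Ea ∪ P1.biUnion Eb) (P1.biUnion Ec)
    have h6 := Finset.card_union_le (P1.biUnion Ea) (P1.biUnion Eb)
    exact_mod_cast (by omega)
  have hAs : A ≤ A * √A := le_mul_of_one_le_right hA0.le hs1
  have h3A : 0 ≤ 3 * A := by positivity
  have m1 := mul_le_mul_of_nonneg_right hc1 h3A
  have m3 := mul_le_mul_of_nonneg_right hc3 h3A
  have m4 := mul_le_mul_of_nonneg_right hc4 h3A
  have hgoal : L * M - L - M ≤ G.card + (3 * (L * M * (1 / 20) + 2 * √A * (3 * A)) +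
      (L * M * (1 / 20) + 2 * A * (2 * √A) + 2 * A) +
      (L * M * (primeRecipSum y2 + primeRecipSum y3) + √A * (3 * A)) +
      (L * M * primeRecipSum y1 + √A * (3 * A))) := by
    linarith only [hlow, hcard, ta, tb, tc, td, te, tf, s1, s2, s3, s4, m1, hc2, m3, m4]
  linarith only [hgoal, hAs, hLA, hMA]

end Lattice

section Lattice

variable {W y1 y2 y3 : ℕ} {A T : ℝ}

theorem stackyCounted_of_mem_latticePairs (hy : UnitTriple W y1 y2 y3) (hA : 0 < A)
    (hT : 12 * A ^ 4 ≤ T * (y1 * y2 * y3) ^ 2) {x : ℤ × ℤ} (hx : x ∈ latticePairs W y1 y2 y3 A)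
    {x3 : ℤ} (e : x.1 * y1 ^ 2 + x.2 * y2 ^ 2 = x3 * y3 ^ 2) (h : SqfreeTriple x.1 x.2 x3) :
    StackyCounted T x.1 x.2 x3 y1 y2 y3 := by
  obtain ⟨⟨q1, q2⟩, b1, b2, b3, b4, b5⟩ := bounds_of_mem_latticePairs hy hA hx
  have hy1 := hy.pos1
  have hy2 := hy.pos2
  have hy3 := hy.pos3
  have q3 : 0 < x3 := by
    have : 0 < x3 * (y3 : ℤ) ^ 2 := e ▸ (by positivity)
    exact pos_of_mul_pos_left this (by positivity)
  have er : (x.1 : ℝ) * y1 ^ 2 + x.2 * y2 ^ 2 = x3 * y3 ^ 2 := by exact_mod_cast e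
  refine ⟨q1.ne', q2.ne', q3.ne', by positivity, by positivity, by positivity, h.2.1, h.2.2.1,
    h.2.2.2, hy.cop12, hy.cop13, hy.cop23, h.1.1, h.1.2.1, h.1.2.2, e, q1, ?_, ?_⟩
  · rw [abs_of_pos (by positivity)]
    have : (x.2 : ℝ) * y2 ^ 2 ≤ x.1 * y1 ^ 2 := by linarith
    exact_mod_cast this
  · rw [abs_of_pos (by positivity)]
    push_cast
    have r1 : (0 : ℝ) < x.1 := by exact_mod_cast q1
    have r2 : (0 : ℝ) < x.2 := by exact_mod_cast q2
    have r3 : (0 : ℝ) < x3 := by exact_mod_cast q3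
    have b6 : (x3 : ℝ) * y3 ^ 2 ≤ 3 * A := by linarith
    have hpos : (0 : ℝ) < (y1 * y2 * y3) ^ 2 := by positivity
    refine le_of_mul_le_mul_right ?_ hpos
    refine le_trans ?_ hT
    calc ((x.1 : ℝ) * y1) ^ 2 * x.2 * x3 * (y1 * y2 * y3) ^ 2 =
          (x.1 * y1 ^ 2) ^ 2 * (x.2 * y2 ^ 2) * (x3 * y3 ^ 2) := by ring
      _ ≤ (2 * A) ^ 2 * A * (3 * A) := by gcongr
      _ = 12 * A ^ 4 := by ring

theorem exists_card_stackyCounted_ge (hW : 4 ∣ W) (hW0 : 0 < W)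
    (hWp : ∀ p : ℕ, p.Prime → ¬p ∣ W → 20 < p) (hy : UnitTriple W y1 y2 y3) {Z : ℕ}
    (hZ : 10 * W ≤ Z) (hT : (Z : ℝ) ^ 80 ≤ T) (h1 : y1 ≤ Z) (h2 : y2 ≤ Z) (h3 : y3 ≤ Z) :
    ∃ G : Finset (ℤ × ℤ × ℤ), (∀ x ∈ G, StackyCounted T x.1 x.2.1 x.2.2 y1 y2 y3) ∧
      √T / (8 * W ^ 2 * (y1 * y2 * y3)) *
        (1 / 2 - primeRecipSum y1 - primeRecipSum y2 - primeRecipSum y3) ≤ G.card := by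
  classical
  have hy1 : (1 : ℝ) ≤ y1 := by exact_mod_cast hy.pos1
  have hy2 : (1 : ℝ) ≤ y2 := by exact_mod_cast hy.pos2
  have hy3 : (1 : ℝ) ≤ y3 := by exact_mod_cast hy.pos3
  have hWr : (1 : ℝ) ≤ W := by exact_mod_cast hW0
  have hZr : 10 * (W : ℝ) ≤ Z := by exact_mod_cast hZ
  have h1' : (y1 : ℝ) ≤ Z := Nat.cast_le.mpr h1
  have h2' : (y2 : ℝ) ≤ Z := Nat.cast_le.mpr h2
  have h3' : (y3 : ℝ) ≤ Z := Nat.cast_le.mpr h3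
  set Y : ℝ := y1 * y2 * y3 with hY
  have hY1 : 1 ≤ Y := one_le_mul_of_one_le_of_one_le (one_le_mul_of_one_le_of_one_le hy1 hy2) hy3
  have hYZ : Y ≤ Z ^ 3 := by
    calc Y ≤ Z * Z * Z := by rw [hY]; gcongr
      _ = _ := by ring
  have hZ10 : (10 : ℝ) ≤ Z := by linarith
  have hT0 : 0 ≤ T := le_trans (by positivity) hT
  have hsT : (Z : ℝ) ^ 40 ≤ √T := Real.le_sqrt_of_sq_le (by rw [← pow_mul]; exact hT)
  set A := √(√T * Y) / 2 with hA
  have hAsq : A ^ 2 = √T * Y / 4 := by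
    rw [hA, div_pow, Real.sq_sqrt (by positivity)]
    norm_num
  have hA20 : (Z : ℝ) ^ 20 / 2 ≤ A := by
    rw [hA]
    gcongr
    apply Real.le_sqrt_of_sq_le
    rw [← pow_mul]
    exact hsT.trans (le_mul_of_one_le_right (Real.sqrt_nonneg _) hY1)
  clear_value A
  have hAW : (214 * (W : ℝ) ^ 2 * Z ^ 6) ^ 2 ≤ A := by
    have h4 : (10 * (W : ℝ)) ^ 4 * Z ^ 4 * Z ^ 12 ≤ Z ^ 4 * Z ^ 4 * Z ^ 12 := by gcongr
    have h5 : (W : ℝ) ^ 4 * 10 ^ 4 * Z ^ 12 ≤ (W : ℝ) ^ 4 * Z ^ 4 * Z ^ 12 := by gcongr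
    have h6 : 0 ≤ (W : ℝ) ^ 4 * Z ^ 12 := by positivity
    nlinarith
  have hsA : 214 * (W : ℝ) ^ 2 * Z ^ 6 ≤ √A := Real.le_sqrt_of_sq_le hAW
  have hW2 : (1 : ℝ) ≤ W ^ 2 := one_le_pow₀ hWr
  have hbig : ∀ k ≤ 6, (Z : ℝ) ^ k ≤ √A := by
    intro k hk
    have h4 : (Z : ℝ) ^ k ≤ Z ^ 6 := pow_le_pow_right₀ (by linarith) hk
    have h5 : (0 : ℝ) ≤ Z ^ 6 := by positivity
    nlinarith
  have hs1 : 1 ≤ √A := by simpa using hbig 0 (by norm_num)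
  have hA1 : 1 ≤ A := Real.one_le_sqrt.mp hs1
  have hA0 : 0 < A := by linarith
  have hss : √A * √A = A := Real.mul_self_sqrt hA0.le
  have hM : 1 ≤ A / (2 * W * y2 ^ 2 * y3 ^ 2) := by
    rw [one_le_div (by positivity)]
    calc 2 * (W : ℝ) * y2 ^ 2 * y3 ^ 2 ≤ 2 * W * (Z : ℝ) ^ 2 * (Z : ℝ) ^ 2 := by gcongr
      _ = (2 * W) * (Z : ℝ) ^ 4 := by ring
      _ ≤ (Z : ℝ) ^ 1 * (Z : ℝ) ^ 4 := by gcongr; linarith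
      _ ≤ √A * √A := by gcongr <;> exact hbig _ (by norm_num)
      _ = A := hss
  set G0 := (latticePairs W y1 y2 y3 A).filter fun x =>
    StackyCounted T x.1 x.2 ((x.1 * y1 ^ 2 + x.2 * y2 ^ 2) / y3 ^ 2) y1 y2 y3 with hG0
  have hcount := le_card_filter_sqfreeTriple hW hW0 hWp hy hA1
    (h1'.trans (by simpa using hbig 1 (by norm_num)))
    (by
      push_cast
      calc (y2 : ℝ) * y3 ≤ Z * Z := by gcongr
        _ = Z ^ 2 := by ring
        _ ≤ _ := hbig 2 (by norm_num)) hM (G := G0) (by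
      intro x hx x3 e h
      rw [hG0, Finset.mem_filter]
      refine ⟨hx, ?_⟩
      have hne : (y3 : ℤ) ^ 2 ≠ 0 := by have := hy.pos3; positivity
      rw [e, Int.mul_ediv_cancel _ hne]
      refine stackyCounted_of_mem_latticePairs hy hA0 ?_ hx e h
      have h4 : A ^ 4 = T * Y ^ 2 / 16 := by
        rw [show A ^ 4 = (A ^ 2) ^ 2 by ring, hAsq, div_pow, mul_pow, Real.sq_sqrt hT0]
        norm_num
      rw [h4]
      nlinarith [mul_nonneg hT0 (sq_nonneg Y)])
  refine ⟨G0.image fun x => (x.1, x.2, (x.1 * (y1 : ℤ) ^ 2 + x.2 * y2 ^ 2) / y3 ^ 2), ?_, ?_⟩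
  · intro x hx
    obtain ⟨z, hz, rfl⟩ := Finset.mem_image.mp hx
    exact (Finset.mem_filter.mp hz).2
  rw [Finset.card_image_of_injective _ (fun a b h => by
    simp only [Prod.mk.injEq] at h
    exact Prod.ext h.1 h.2.1)]
  refine le_trans ?_ hcount
  have hLM : A / (W * y1 ^ 2) * (A / (2 * W * y2 ^ 2 * y3 ^ 2)) = √T / (8 * W ^ 2 * Y) := by
    rw [div_mul_div_comm, ← sq, hAsq, hY]
    field_simp
    ring
  rw [hLM]
  have herr : 32 * (A * √A) ≤ √T / (8 * W ^ 2 * Y) * (3 / 10) := by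
    have h4 : √T / (8 * W ^ 2 * Y) = A ^ 2 / (2 * W ^ 2 * Y ^ 2) := by
      rw [hAsq]
      field_simp
      ring
    rw [h4, div_mul_eq_mul_div, le_div_iff₀ (by positivity)]
    have h5 : 214 * (W : ℝ) ^ 2 * Y ^ 2 ≤ √A := by
      refine le_trans ?_ hsA
      calc 214 * (W : ℝ) ^ 2 * Y ^ 2 ≤ 214 * W ^ 2 * (Z ^ 3) ^ 2 := by gcongr
        _ = _ := by ring
    have h6 : A * √A * (214 * (W : ℝ) ^ 2 * Y ^ 2) ≤ A * √A * √A := by gcongr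
    have h7 : A * √A * √A = A ^ 2 := by rw [mul_assoc, hss, sq]
    have h8 : 0 ≤ A * √A * ((W : ℝ) ^ 2 * Y ^ 2) := by positivity
    nlinarith
  linarith

end Lattice

/-- Positive integers up to `Z` that are `1` modulo `W`. -/
def unitRange (W Z : ℕ) : Finset ℕ := (Finset.Ioc 0 Z).filter fun y => (W : ℤ) ∣ (y : ℤ) - 1

theorem mem_unitRange {W Z y : ℕ} :
    y ∈ unitRange W Z ↔ (0 < y ∧ y ≤ Z) ∧ (W : ℤ) ∣ (y : ℤ) - 1 := by
  rw [unitRange, Finset.mem_filter, Finset.mem_Ioc]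

section UnitRange

variable {W Z : ℕ}

theorem sum_unitRange_filter_dvd_le {p : ℕ} (hp : 0 < p) :
    ∑ y ∈ (unitRange W Z).filter (p ∣ ·), (y : ℝ)⁻¹ ≤
      (p : ℝ)⁻¹ * ∑ y ∈ unitRange W Z, (y : ℝ)⁻¹ := by
  set g : ℕ → ℕ := fun y => y / p - (y / p - 1) % W with hg
  have key : ∀ y ∈ (unitRange W Z).filter (p ∣ ·), ∃ z k : ℕ, y = p * z ∧ 0 < z ∧
      z = g y + (z - 1) % W ∧ 0 < g y ∧ g y = 1 + W * k ∧ g y ≤ z ∧ z ≤ Z ∧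
      (W : ℤ) ∣ (p : ℤ) * z - 1 := by
    intro y hy
    obtain ⟨hy, z, rfl⟩ := Finset.mem_filter.mp hy
    obtain ⟨⟨h1, h2⟩, h3⟩ := mem_unitRange.mp hy
    have hz : 0 < z := Nat.pos_of_mul_pos_left h1
    have hzZ : z ≤ Z := (Nat.le_mul_of_pos_left z hp).trans h2
    have e : g (p * z) = z - (z - 1) % W := by
      simp only [hg, Nat.mul_div_cancel_left z hp]
    have h4 := Nat.mod_add_div (z - 1) W
    push_cast at h3
    refine ⟨z, (z - 1) / W, rfl, hz, ?_, ?_, ?_, ?_, hzZ, h3⟩ <;> rw [e] <;> omega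
  have hinj : Set.InjOn g ((unitRange W Z).filter (p ∣ ·)) := by
    intro y hy y' hy' h
    obtain ⟨z, k, rfl, hz, e, -, -, -, -, hd⟩ := key y hy
    obtain ⟨z', k', rfl, hz', e', -, -, -, -, hd'⟩ := key y' hy'
    have h1 : (W : ℤ) ∣ (z : ℤ) - z' := by
      have h2 := dvd_sub hd hd'
      rw [show (p : ℤ) * z - 1 - (p * z' - 1) = p * (z - z') by ring] at h2
      refine IsCoprime.dvd_of_dvd_mul_left ?_ h2
      exact (isCoprime_of_dvd_sub_one hd).of_mul_right_left
    have h3 : (z - 1) % W = (z' - 1) % W := by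
      have : (z - 1) ≡ (z' - 1) [MOD W] := by
        rw [Nat.modEq_iff_dvd]
        push_cast [Nat.cast_sub hz, Nat.cast_sub hz']
        rw [show (z' : ℤ) - 1 - (z - 1) = -(z - z') by ring]
        exact h1.neg_right
      exact this
    rw [e, e', h, h3]
  calc ∑ y ∈ (unitRange W Z).filter (p ∣ ·), (y : ℝ)⁻¹
      ≤ ∑ y ∈ (unitRange W Z).filter (p ∣ ·), (p : ℝ)⁻¹ * (g y : ℝ)⁻¹ := by
        apply Finset.sum_le_sum
        intro y hy
        obtain ⟨z, k, e, hz, -, hg0, -, hgz, -, -⟩ := key y hy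
        have : (0 : ℝ) < g y := by exact_mod_cast hg0
        rw [← mul_inv]
        nth_rewrite 1 [e]
        push_cast
        gcongr
    _ = (p : ℝ)⁻¹ * ∑ z ∈ ((unitRange W Z).filter (p ∣ ·)).image g, (z : ℝ)⁻¹ := by
        rw [← Finset.mul_sum, Finset.sum_image hinj]
    _ ≤ _ := by
        apply mul_le_mul_of_nonneg_left _ (by positivity)
        apply Finset.sum_le_sum_of_subset_of_nonneg _ fun _ _ _ => by positivity
        intro z hz
        obtain ⟨y, hy, rfl⟩ := Finset.mem_image.mp hz
        obtain ⟨z, k, -, hz, -, h0, e, hgz, hzZ, -⟩ := key y hy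
        refine mem_unitRange.mpr ⟨⟨h0, hgz.trans hzZ⟩, ⟨k, ?_⟩⟩
        rw [e]
        push_cast
        ring

theorem lt_of_dvd_mem_unitRange (hWp : ∀ p : ℕ, p.Prime → ¬p ∣ W → 20 < p) {y p : ℕ}
    (hy : y ∈ unitRange W Z) (hp : p.Prime) (hd : p ∣ y) : p ∈ Finset.Ioc 20 Z := by
  obtain ⟨⟨h1, h2⟩, h3⟩ := mem_unitRange.mp hy
  refine Finset.mem_Ioc.mpr ⟨hWp p hp fun h => ?_, (Nat.le_of_dvd h1 hd).trans h2⟩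
  have := (isCoprime_of_dvd_sub_one h3).isUnit_of_dvd' (Int.natCast_dvd_natCast.mpr h)
    (Int.natCast_dvd_natCast.mpr hd)
  exact (Nat.prime_iff_prime_int.mp hp).not_isUnit this

theorem sum_unitRange_primeRecipSum_le (hWp : ∀ p : ℕ, p.Prime → ¬p ∣ W → 20 < p) :
    ∑ y ∈ unitRange W Z, (y : ℝ)⁻¹ * primeRecipSum y ≤
      (∑ y ∈ unitRange W Z, (y : ℝ)⁻¹) * (1 / 20) := by
  set S := ∑ y ∈ unitRange W Z, (y : ℝ)⁻¹ with hS
  have hS0 : 0 ≤ S := Finset.sum_nonneg fun _ _ => by positivity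
  calc ∑ y ∈ unitRange W Z, (y : ℝ)⁻¹ * primeRecipSum y
      ≤ ∑ y ∈ unitRange W Z, ∑ p ∈ Finset.Ioc 20 Z,
          if p ∣ y then (p : ℝ)⁻¹ * (y : ℝ)⁻¹ else 0 := by
        apply Finset.sum_le_sum
        intro y hy
        rw [← Finset.sum_filter, primeRecipSum, Finset.mul_sum]
        simp_rw [mul_comm (y : ℝ)⁻¹]
        apply Finset.sum_le_sum_of_subset_of_nonneg _ fun _ _ _ => by positivity
        intro p hp
        have hp1 := Nat.prime_of_mem_primeFactors hp
        have hp2 := Nat.dvd_of_mem_primeFactors hp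
        exact Finset.mem_filter.mpr ⟨lt_of_dvd_mem_unitRange hWp hy hp1 hp2, hp2⟩
    _ = ∑ p ∈ Finset.Ioc 20 Z, (p : ℝ)⁻¹ *
          ∑ y ∈ (unitRange W Z).filter (p ∣ ·), (y : ℝ)⁻¹ := by
        rw [Finset.sum_comm]
        apply Finset.sum_congr rfl
        intro p _
        rw [← Finset.sum_filter, Finset.mul_sum]
    _ ≤ ∑ p ∈ Finset.Ioc 20 Z, S * ((p : ℝ) ^ 2)⁻¹ := by
        apply Finset.sum_le_sum
        intro p hp
        rw [Finset.mem_Ioc] at hp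
        rw [show S * ((p : ℝ) ^ 2)⁻¹ = (p : ℝ)⁻¹ * ((p : ℝ)⁻¹ * S) by rw [← inv_pow]; ring]
        exact mul_le_mul_of_nonneg_left (sum_unitRange_filter_dvd_le (by omega)) (by positivity)
    _ ≤ _ := by
        rw [← Finset.mul_sum]
        apply mul_le_mul_of_nonneg_left _ hS0
        refine (sum_Ioc_inv_sq_le_inv (by norm_num) _).trans ?_
        norm_num

theorem sum_unitRange_not_coprime_le (hWp : ∀ p : ℕ, p.Prime → ¬p ∣ W → 20 < p) :
    ∑ a ∈ unitRange W Z, ∑ b ∈ unitRange W Z,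
      (if a.Coprime b then 0 else (a : ℝ)⁻¹ * (b : ℝ)⁻¹) ≤
      (∑ y ∈ unitRange W Z, (y : ℝ)⁻¹) ^ 2 * (1 / 20) := by
  set S := ∑ y ∈ unitRange W Z, (y : ℝ)⁻¹ with hS
  have hS0 : 0 ≤ S := Finset.sum_nonneg fun _ _ => by positivity
  calc ∑ a ∈ unitRange W Z, ∑ b ∈ unitRange W Z,
        (if a.Coprime b then 0 else (a : ℝ)⁻¹ * (b : ℝ)⁻¹)
      ≤ ∑ a ∈ unitRange W Z, ∑ b ∈ unitRange W Z, ∑ p ∈ Finset.Ioc 20 Z,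
          (if p ∣ a then (a : ℝ)⁻¹ else 0) * (if p ∣ b then (b : ℝ)⁻¹ else 0) := by
        refine Finset.sum_le_sum fun a ha => Finset.sum_le_sum fun b _ => ?_
        have hnn : ∀ p ∈ Finset.Ioc 20 Z, 0 ≤
            (if p ∣ a then (a : ℝ)⁻¹ else 0) * (if p ∣ b then (b : ℝ)⁻¹ else 0) := fun p _ => by
          apply mul_nonneg <;> split_ifs <;> positivity
        split_ifs with h
        · exact Finset.sum_nonneg hnn
        · obtain ⟨p, hp, hpa, hpb⟩ := Nat.Prime.not_coprime_iff_dvd.mp h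
          have := Finset.single_le_sum hnn (lt_of_dvd_mem_unitRange hWp ha hp hpa)
          rwa [if_pos hpa, if_pos hpb] at this
    _ = ∑ p ∈ Finset.Ioc 20 Z, (∑ a ∈ (unitRange W Z).filter (p ∣ ·), (a : ℝ)⁻¹) *
          ∑ b ∈ (unitRange W Z).filter (p ∣ ·), (b : ℝ)⁻¹ := by
        simp_rw [Finset.sum_comm (s := unitRange W Z) (t := Finset.Ioc 20 Z)]
        apply Finset.sum_congr rfl
        intro p _
        rw [Finset.sum_filter, Finset.sum_mul_sum]
    _ ≤ ∑ p ∈ Finset.Ioc 20 Z, S ^ 2 * ((p : ℝ) ^ 2)⁻¹ := by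
        apply Finset.sum_le_sum
        intro p hp
        rw [Finset.mem_Ioc] at hp
        rw [show S ^ 2 * ((p : ℝ) ^ 2)⁻¹ = ((p : ℝ)⁻¹ * S) * ((p : ℝ)⁻¹ * S) by
          rw [← inv_pow]; ring]
        have h := sum_unitRange_filter_dvd_le (W := W) (Z := Z) (p := p) (by omega)
        exact mul_le_mul h h (Finset.sum_nonneg fun _ _ => by positivity) (by positivity)
    _ ≤ _ := by
        rw [← Finset.mul_sum]
        apply mul_le_mul_of_nonneg_left _ (by positivity)
        refine (sum_Ioc_inv_sq_le_inv (by norm_num) _).trans ?_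
        norm_num

theorem log_div_le_sum_unitRange (hW : 0 < W) (hZ : 0 < Z) :
    log (Z / W) / W ≤ ∑ y ∈ unitRange W Z, (y : ℝ)⁻¹ := by
  have hWr : (1 : ℝ) ≤ W := by exact_mod_cast hW
  set n := (Z - 1) / W + 1 with hn
  have h1 := log_add_one_le_harmonic n
  rw [harmonic] at h1
  push_cast at h1
  have h2 : (Z : ℝ) / W ≤ n + 1 := by
    rw [div_le_iff₀ (by positivity)]
    have h4 := Nat.mod_add_div (Z - 1) W
    have h5 := Nat.mod_lt (Z - 1) hW
    have h3 : Z ≤ (n + 1) * W := by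
      have e : (n + 1) * W = W * ((Z - 1) / W) + 2 * W := by rw [hn]; ring
      omega
    exact_mod_cast h3
  have h3 : log (Z / W) ≤ log (n + 1) := Real.log_le_log (by positivity) h2
  have h6 : (∑ i ∈ Finset.range n, ((i : ℝ) + 1)⁻¹) / W ≤
      ∑ i ∈ Finset.range n, ((1 + W * i : ℕ) : ℝ)⁻¹ := by
    rw [Finset.sum_div]
    apply Finset.sum_le_sum
    intro i _
    rw [div_eq_mul_inv, ← mul_inv]
    push_cast
    gcongr
    linarith
  have h7 : ∑ i ∈ Finset.range n, ((1 + W * i : ℕ) : ℝ)⁻¹ =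
      ∑ y ∈ (Finset.range n).image fun i => 1 + W * i, (y : ℝ)⁻¹ := by
    rw [Finset.sum_image]
    intro i _ j _ h
    have : W * i = W * j := by simpa using h
    exact Nat.eq_of_mul_eq_mul_left hW this
  refine le_trans ?_ (h6.trans (h7.le.trans ?_))
  · gcongr
    exact h3.trans h1
  · apply Finset.sum_le_sum_of_subset_of_nonneg _ fun _ _ _ => by positivity
    intro y hy
    obtain ⟨i, hi, rfl⟩ := Finset.mem_image.mp hy
    rw [Finset.mem_range, hn, Nat.lt_succ_iff, Nat.le_div_iff_mul_le hW] at hi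
    refine mem_unitRange.mpr ⟨⟨by positivity, ?_⟩, ⟨i, by push_cast; ring⟩⟩
    rw [mul_comm] at hi
    omega

theorem le_sum_coprime_triples (hWp : ∀ p : ℕ, p.Prime → ¬p ∣ W → 20 < p) :
    (∑ y ∈ unitRange W Z, (y : ℝ)⁻¹) ^ 3 / 4 ≤
      ∑ t ∈ (unitRange W Z ×ˢ unitRange W Z ×ˢ unitRange W Z).filter
        (fun t => t.1.Coprime t.2.1 ∧ t.1.Coprime t.2.2 ∧ t.2.1.Coprime t.2.2),
        ((t.1 : ℝ)⁻¹ * (t.2.1 : ℝ)⁻¹ * (t.2.2 : ℝ)⁻¹) *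
          (1 / 2 - primeRecipSum t.1 - primeRecipSum t.2.1 - primeRecipSum t.2.2) := by
  set U := unitRange W Z with hU
  set S := ∑ y ∈ U, (y : ℝ)⁻¹ with hS
  have hS0 : 0 ≤ S := Finset.sum_nonneg fun _ _ => by positivity
  set F := ∑ y ∈ U, (y : ℝ)⁻¹ * primeRecipSum y with hF
  set c : ℕ → ℕ → ℝ := fun a b => if a.Coprime b then 0 else (a : ℝ)⁻¹ * (b : ℝ)⁻¹ with hc
  set C := ∑ a ∈ U, ∑ b ∈ U, c a b with hC
  have hf0 : ∀ y, 0 ≤ primeRecipSum y := fun y => Finset.sum_nonneg fun _ _ => by positivity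
  have hFle : F ≤ S * (1 / 20) := sum_unitRange_primeRecipSum_le hWp
  have hCle : C ≤ S ^ 2 * (1 / 20) := sum_unitRange_not_coprime_le hWp
  have hpt : ∀ a b d : ℕ,
      (a : ℝ)⁻¹ * (b : ℝ)⁻¹ * (d : ℝ)⁻¹ * (1 / 2) -
        ((a : ℝ)⁻¹ * primeRecipSum a) * (b : ℝ)⁻¹ * (d : ℝ)⁻¹ -
        (a : ℝ)⁻¹ * ((b : ℝ)⁻¹ * primeRecipSum b) * (d : ℝ)⁻¹ -
        (a : ℝ)⁻¹ * (b : ℝ)⁻¹ * ((d : ℝ)⁻¹ * primeRecipSum d) -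
        1 / 2 * (c a b * (d : ℝ)⁻¹) - 1 / 2 * (c a d * (b : ℝ)⁻¹) -
        1 / 2 * ((a : ℝ)⁻¹ * c b d) ≤
      if a.Coprime b ∧ a.Coprime d ∧ b.Coprime d then
        (a : ℝ)⁻¹ * (b : ℝ)⁻¹ * (d : ℝ)⁻¹ *
          (1 / 2 - primeRecipSum a - primeRecipSum b - primeRecipSum d) else 0 := by
    intro a b d
    have hw : 0 ≤ (a : ℝ)⁻¹ * (b : ℝ)⁻¹ * (d : ℝ)⁻¹ := by positivity
    have ha := mul_nonneg hw (hf0 a)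
    have hb := mul_nonneg hw (hf0 b)
    have hd := mul_nonneg hw (hf0 d)
    simp only [hc]
    split_ifs <;> first | (exfalso; tauto) | linarith
  have hsum : ∀ u v w : ℕ → ℝ, ∑ a ∈ U, ∑ b ∈ U, ∑ d ∈ U, u a * v b * w d =
      (∑ a ∈ U, u a) * (∑ b ∈ U, v b) * ∑ d ∈ U, w d := by
    intro u v w
    simp_rw [← Finset.mul_sum, ← Finset.sum_mul]
    rw [Finset.sum_mul_sum U U u v]
  have hsum1 : ∑ a ∈ U, ∑ b ∈ U, ∑ d ∈ U, c a b * (d : ℝ)⁻¹ = C * S := by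
    simp_rw [← Finset.mul_sum, ← Finset.sum_mul]
    rfl
  have hsum2 : ∑ a ∈ U, ∑ b ∈ U, ∑ d ∈ U, c a d * (b : ℝ)⁻¹ = C * S := by
    rw [← hsum1]
    exact Finset.sum_congr rfl fun a _ => Finset.sum_comm
  have hsum3 : ∑ a ∈ U, ∑ b ∈ U, ∑ d ∈ U, (a : ℝ)⁻¹ * c b d = S * C := by
    simp_rw [← Finset.mul_sum, ← Finset.sum_mul]
    rfl
  rw [Finset.sum_filter, Finset.sum_product]
  simp_rw [Finset.sum_product]
  refine le_trans ?_ (Finset.sum_le_sum fun a _ => Finset.sum_le_sum fun b _ =>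
    Finset.sum_le_sum fun d _ => hpt a b d)
  simp only [Finset.sum_sub_distrib, ← Finset.mul_sum (a := (1 / 2 : ℝ)), hsum1, hsum2, hsum3]
  simp only [← Finset.sum_mul (a := (1 / 2 : ℝ))]
  rw [hsum, hsum, hsum, hsum, ← hS, ← hF]
  have e1 := mul_le_mul_of_nonneg_left hFle (sq_nonneg S)
  have e2 := mul_le_mul_of_nonneg_left hCle hS0
  have e3 : 0 ≤ S ^ 3 := by positivity
  nlinarith

end UnitRange

theorem stackyN_ge_of_pow_le {W Z : ℕ} {T : ℝ} (hW : 4 ∣ W) (hW0 : 0 < W)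
    (hWp : ∀ p : ℕ, p.Prime → ¬p ∣ W → 20 < p) (hZ : 10 * W ≤ Z) (hT : (Z : ℝ) ^ 80 ≤ T)
    (hT2 : 2 ≤ T) :
    √T / (8 * W ^ 2) * ((∑ y ∈ unitRange W Z, (y : ℝ)⁻¹) ^ 3 / 4) ≤ stackyN T := by
  classical
  set U := unitRange W Z with hU
  set 𝒯 := (U ×ˢ U ×ˢ U).filter
    (fun t => t.1.Coprime t.2.1 ∧ t.1.Coprime t.2.2 ∧ t.2.1.Coprime t.2.2) with hTr
  have hex : ∀ t ∈ 𝒯, ∃ G : Finset (ℤ × ℤ × ℤ),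
      (∀ x ∈ G, StackyCounted T x.1 x.2.1 x.2.2 t.1 t.2.1 t.2.2) ∧
      √T / (8 * W ^ 2 * (t.1 * t.2.1 * t.2.2)) *
        (1 / 2 - primeRecipSum t.1 - primeRecipSum t.2.1 - primeRecipSum t.2.2) ≤ G.card := by
    intro t ht
    obtain ⟨hm, c1, c2, c3⟩ := Finset.mem_filter.mp ht
    obtain ⟨m1, m2, m3⟩ : t.1 ∈ U ∧ t.2.1 ∈ U ∧ t.2.2 ∈ U := by
      simpa only [Finset.mem_product] using hm
    obtain ⟨⟨p1, l1⟩, d1⟩ := mem_unitRange.mp m1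
    obtain ⟨⟨p2, l2⟩, d2⟩ := mem_unitRange.mp m2
    obtain ⟨⟨p3, l3⟩, d3⟩ := mem_unitRange.mp m3
    exact exists_card_stackyCounted_ge hW hW0 hWp ⟨p1, p2, p3, d1, d2, d3, c1, c2, c3⟩ hZ hT
      l1 l2 l3
  choose! G hG hGc using hex
  set e : (Σ _ : ℕ × ℕ × ℕ, ℤ × ℤ × ℤ) → ℤ × ℤ × ℤ × ℤ × ℤ × ℤ := fun v =>
    (v.2.1, v.2.2.1, v.2.2.2, v.1.1, v.1.2.1, v.1.2.2) with he
  have hinj : Function.Injective e := by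
    rintro ⟨⟨a, b, c⟩, x, y, z⟩ ⟨⟨a', b', c'⟩, x', y', z'⟩ h
    simp only [he, Prod.mk.injEq, Nat.cast_inj] at h
    obtain ⟨rfl, rfl, rfl, rfl, rfl, rfl⟩ := h
    rfl
  have hcard : (𝒯.sigma G).card ≤ stackyN T := by
    rw [← Finset.card_image_of_injective _ hinj, ← Set.ncard_coe_finset, stackyN]
    apply Set.ncard_le_ncard _ (stackyN_upper_bound hT2).1
    intro v hv
    obtain ⟨s, hs, rfl⟩ := Finset.mem_image.mp (Finset.mem_coe.mp hv)
    obtain ⟨h1, h2⟩ := Finset.mem_sigma.mp hs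
    exact hG _ h1 _ h2
  have hcard' : ∑ t ∈ 𝒯, ((G t).card : ℝ) ≤ stackyN T := by
    rw [Finset.card_sigma] at hcard
    exact_mod_cast hcard
  refine le_trans ?_ hcard'
  refine le_trans ?_ (Finset.sum_le_sum hGc)
  refine (mul_le_mul_of_nonneg_left (le_sum_coprime_triples hWp) (by positivity)).trans ?_
  rw [Finset.mul_sum]
  apply le_of_eq
  apply Finset.sum_congr rfl
  intro t _
  rw [← mul_assoc, ← mul_inv, ← mul_inv, ← div_eq_mul_inv, div_div]

theorem exists_modulus : ∃ W : ℕ, 4 ∣ W ∧ 0 < W ∧ ∀ p : ℕ, p.Prime → ¬p ∣ W → 20 < p :=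
  ⟨Nat.factorial 20, Nat.dvd_factorial (by norm_num) (by norm_num), Nat.factorial_pos _,
    fun p hp h => by
      by_contra hle
      exact h ((Nat.Prime.dvd_factorial hp).mpr (by omega))⟩

theorem exists_pow_le_lt {k : ℕ} (hk : k ≠ 0) {T : ℝ} (hT : 0 ≤ T) :
    ∃ Z : ℕ, (Z : ℝ) ^ k ≤ T ∧ T < ((Z : ℝ) + 1) ^ k := by
  have h0 : 0 ≤ T ^ ((k : ℝ)⁻¹) := by positivity
  have h1 : (T ^ ((k : ℝ)⁻¹)) ^ k = T := Real.rpow_inv_natCast_pow hT hk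
  refine ⟨⌊T ^ ((k : ℝ)⁻¹)⌋₊, ?_, ?_⟩
  · calc _ ≤ (T ^ ((k : ℝ)⁻¹)) ^ k := by
          gcongr
          exact Nat.floor_le h0
      _ = T := h1
  · calc T = (T ^ ((k : ℝ)⁻¹)) ^ k := h1.symm
      _ < _ := pow_lt_pow_left₀ (Nat.lt_floor_add_one _) h0 hk

theorem stackyN_lower_bound : ∃ c C : ℝ, 0 < c ∧
    ∀ T : ℝ, C < T → c * (√T * log T ^ 3) ≤ stackyN T := by
  obtain ⟨W, hW, hW0, hWp⟩ := exists_modulus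
  have hWr : (1 : ℝ) ≤ W := by exact_mod_cast hW0
  refine ⟨1 / (32 * W ^ 2 * (320 * W) ^ 3), ((10 * W ^ 2 : ℕ) + 1 : ℝ) ^ 80, by positivity, ?_⟩
  intro T hT
  have h1T : (1 : ℝ) ≤ ((10 * W ^ 2 : ℕ) + 1 : ℝ) ^ 80 :=
    one_le_pow₀ (by
      have : (0 : ℝ) ≤ (10 * W ^ 2 : ℕ) := Nat.cast_nonneg _
      linarith)
  obtain ⟨Z, hZ1, hZ2⟩ := exists_pow_le_lt (k := 80) (by norm_num) (by linarith : 0 ≤ T)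
  have hZW : 10 * W ^ 2 ≤ Z := by
    have h1 := lt_of_pow_lt_pow_left₀ 80 (by positivity) (hT.trans hZ2)
    have h2 : ((10 * W ^ 2 : ℕ) : ℝ) < Z := by linarith
    exact_mod_cast h2.le
  have hWW : W ≤ W ^ 2 := Nat.le_self_pow two_ne_zero W
  have hZ10 : 10 ≤ Z := by omega
  have hZr : (10 : ℝ) ≤ Z := by exact_mod_cast hZ10
  have hT2 : 2 ≤ T := by
    refine le_trans ?_ hZ1
    calc (2 : ℝ) ≤ Z ^ 1 := by linarith
      _ ≤ Z ^ 80 := pow_le_pow_right₀ (by linarith) (by norm_num)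
  refine le_trans ?_ (stackyN_ge_of_pow_le hW hW0 hWp (by omega) hZ1 hT2)
  set S := ∑ y ∈ unitRange W Z, (y : ℝ)⁻¹ with hS
  have hlogT : log T ≤ 160 * log Z := by
    have h2 : T ≤ (Z : ℝ) ^ 160 := by
      calc T ≤ ((Z : ℝ) + 1) ^ 80 := hZ2.le
        _ ≤ ((Z : ℝ) ^ 2) ^ 80 := by gcongr; nlinarith
        _ = _ := by ring
    have h3 := Real.log_le_log (by linarith) h2
    rw [Real.log_pow] at h3
    exact_mod_cast h3
  have hlogZ : log Z / 2 ≤ log (Z / W) := by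
    have h2 : log ((W : ℝ) ^ 2) ≤ log Z := by
      apply Real.log_le_log (by positivity)
      exact_mod_cast (by omega : W ^ 2 ≤ Z)
    rw [Real.log_pow] at h2
    rw [Real.log_div (by positivity) (by positivity)]
    push_cast at h2
    linarith
  have hSle : log T / (320 * W) ≤ S := by
    refine le_trans ?_ (log_div_le_sum_unitRange hW0 (by omega))
    rw [← div_div]
    gcongr
    linarith
  have hlog0 : 0 ≤ log T := Real.log_nonneg (by linarith)
  calc _ = √T / (8 * W ^ 2) * ((log T / (320 * W)) ^ 3 / 4) := by
        field_simp
        ring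
    _ ≤ _ := by gcongr

theorem stackyN_order_of_magnitude :
    ∃ c1 c2 c3 : ℝ, 0 < c1 ∧ 0 < c2 ∧ 0 < c3 ∧
      ∀ T : ℝ, c3 < T →
        c1 * Real.sqrt T * (Real.log T) ^ 3 < (stackyN T : ℝ) ∧
        (stackyN T : ℝ) < c2 * Real.sqrt T * (Real.log T) ^ 3 := by
  obtain ⟨c, C, hc, h⟩ := stackyN_lower_bound
  refine ⟨c / 2, 10 ^ 15, max C 2, by positivity, by norm_num,
    lt_max_of_lt_right two_pos, fun T hT => ?_⟩
  obtain ⟨hC, h2⟩ := max_lt_iff.mp hT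
  have hlog := Real.log_pos (by linarith : 1 < T)
  have hpos : 0 < √T * log T ^ 3 := by positivity
  have hl := h T hC
  have hu := (stackyN_upper_bound h2.le).2
  rw [mul_assoc, mul_assoc]
  constructor <;> nlinarith
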